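/- Let ω = (ω₁, ω₂) ∈ ℝ², let s₁ ≥ 1 be real and 2 ≤ p < ∞. For a trigonometric polynomial h on 𝕋² with coefficients ĥ and s ∈ ℝ, let Λ_x^s h be the trigonometric polynomial with coefficients (1+(ω·n)²)^{s/2}·ĥ(n), and let D_x h have coefficients (ω·n)·ĥ(n). Then there exists a constant C = C(s₁, p, ω) such that for all trigonometric polynomials f, g on 𝕋²: ‖Λ_x^{s₁}(f·g) − f·Λ_x^{s₁}g‖_{L^p(𝕋²)} ≤ C·( ‖Λ_x^{s₁}f‖_{L^p(𝕋²)}·‖g‖_{L^∞} + ‖D_x f‖_{L^∞}·‖Λ_x^{s₁−1}g‖_{L^p(𝕋²)} ). -/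

import Mathlib

open scoped Real

/-- The trigonometric polynomial on `𝕋²` with Fourier coefficients `c : ℤ² → ℂ`. -/
noncomputable def trigSum (c : ℤ × ℤ → ℂ) (x : ℝ × ℝ) : ℂ :=
  ∑' n : ℤ × ℤ, c n * Complex.exp (2 * Real.pi * Complex.I *
    (((n.1 : ℝ) * x.1 + (n.2 : ℝ) * x.2 : ℝ) : ℂ))

/-- The `L^p(𝕋²)` norm of a function, computed over the fundamental
domain `[0,1]²`. -/
noncomputable def lpNormT2 (p : ℝ) (u : ℝ × ℝ → ℂ) : ℝ :=
  (∫ x in Set.Icc (0 : ℝ) 1 ×ˢ Set.Icc (0 : ℝ) 1, ‖u x‖ ^ p) ^ (1 / p)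

/-- The sup norm `‖f‖_{L^∞} = sup_{x∈ℝ²} |f(x)|` of a trigonometric polynomial. -/
noncomputable def supNorm (c : ℤ × ℤ → ℂ) : ℝ := ⨆ x : ℝ × ℝ, ‖trigSum c x‖

/-- The Fourier coefficients of the product of two trigonometric polynomials. -/
noncomputable def convCoef (f g : ℤ × ℤ → ℂ) (n : ℤ × ℤ) : ℂ :=
  ∑' a : ℤ × ℤ, f a * g (n - a)

/-- The symbol of the tangential inhomogeneous derivative `⟨∂_x⟩^s`:
`n ↦ (1+(ω·n)²)^{s/2}`. -/
noncomputable def lamX (ω : ℝ × ℝ) (s : ℝ) (n : ℤ × ℤ) : ℝ :=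
  (1 + (ω.1 * (n.1 : ℝ) + ω.2 * (n.2 : ℝ)) ^ 2) ^ (s / 2)


set_option linter.all false
open MeasureTheory Set

namespace KP

noncomputable section

/-- the character -/
def ch (n : ℤ × ℤ) (x : ℝ × ℝ) : ℂ := Complex.exp (2 * Real.pi * Complex.I *
    (((n.1 : ℝ) * x.1 + (n.2 : ℝ) * x.2 : ℝ) : ℂ))

/-- the frequency -/
def fr (ω : ℝ × ℝ) (n : ℤ × ℤ) : ℝ := ω.1 * (n.1 : ℝ) + ω.2 * (n.2 : ℝ)

/-- the flow -/
def fl (ω : ℝ × ℝ) (σ : ℝ) : ℝ × ℝ := (σ * ω.1 / (2 * Real.pi), σ * ω.2 / (2 * Real.pi))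

/-- finite trigonometric sums -/
def P (S : Finset (ℤ × ℤ)) (c : ℤ × ℤ → ℂ) (x : ℝ × ℝ) : ℂ := ∑ n ∈ S, c n * ch n x

/-- torus measure -/
def mT : Measure (ℝ × ℝ) := volume.restrict (Icc (0 : ℝ) 1 ×ˢ Icc (0 : ℝ) 1)

/-- periodicity -/
def Per {E : Type*} (u : ℝ × ℝ → E) : Prop :=
  ∀ x : ℝ × ℝ, u (x.1 + 1, x.2) = u x ∧ u (x.1, x.2 + 1) = u x

instance : IsFiniteMeasure mT := by
  unfold mT
  exact ⟨by
    rw [Measure.restrict_apply_univ]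
    exact (isCompact_Icc.prod isCompact_Icc).measure_lt_top⟩

lemma mT_eq : mT = (volume.restrict (Icc (0:ℝ) 1)).prod (volume.restrict (Icc (0:ℝ) 1)) := by
  rw [mT, Measure.prod_restrict]; rfl

lemma mT_univ : mT univ = 1 := by
  rw [mT_eq, ← univ_prod_univ, Measure.prod_prod]; simp

instance : IsProbabilityMeasure mT := ⟨mT_univ⟩

lemma mT_integrable {E : Type*} [NormedAddCommGroup E] {u : ℝ × ℝ → E} (hu : Continuous u) :
    Integrable u mT :=
  (hu.continuousOn.integrableOn_compact (isCompact_Icc.prod isCompact_Icc))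

lemma mT_int {u : ℝ × ℝ → ℂ} (hu : Continuous u) :
    ∫ x, u x ∂mT = ∫ a in (0:ℝ)..1, ∫ b in (0:ℝ)..1, u (a, b) := by
  have h := mT_integrable hu
  rw [mT_eq] at h ⊢
  rw [integral_prod _ h]
  simp only [intervalIntegral.integral_of_le zero_le_one, integral_Icc_eq_integral_Ioc]

lemma mT_int_real {u : ℝ × ℝ → ℝ} (hu : Continuous u) :
    ∫ x, u x ∂mT = ∫ a in (0:ℝ)..1, ∫ b in (0:ℝ)..1, u (a, b) := by
  have h := mT_integrable hu
  rw [mT_eq] at h ⊢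
  rw [integral_prod _ h]
  simp only [intervalIntegral.integral_of_le zero_le_one, integral_Icc_eq_integral_Ioc]

lemma mT_shift {u : ℝ × ℝ → ℝ} (hu : Continuous u) (hp : Per u) (v : ℝ × ℝ) :
    ∫ x, u (x + v) ∂mT = ∫ x, u x ∂mT := by
  rw [mT_int_real hu, mT_int_real (u := fun x => u (x + v)) (by fun_prop)]
  have h1 : ∀ a, ∫ b in (0:ℝ)..1, u ((a, b) + v) = ∫ b in (0:ℝ)..1, u (a + v.1, b) := by
    intro a
    have hper : Function.Periodic (fun b => u (a + v.1, b)) 1 := fun b => (hp (a + v.1, b)).2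
    have := intervalIntegral.integral_comp_add_right (a := 0) (b := 1)
      (fun b => u (a + v.1, b)) v.2
    have h2 := hper.intervalIntegral_add_eq 0 v.2
    simp only [zero_add] at h2 this
    rw [h2, add_comm v.2 1, ← this]
    rfl
  simp only [h1]
  have hper : Function.Periodic (fun a => ∫ b in (0:ℝ)..1, u (a, b)) 1 := by
    intro a
    simp only
    congr 1; ext b; exact (hp (a, b)).1
  have := intervalIntegral.integral_comp_add_right (a := 0) (b := 1)
      (fun a => ∫ b in (0:ℝ)..1, u (a, b)) v.1
  have h2 := hper.intervalIntegral_add_eq 0 v.1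
  simp only [zero_add] at h2 this
  rw [h2, add_comm v.1 1, ← this]

lemma ch_add (n : ℤ × ℤ) (x y : ℝ × ℝ) : ch n (x + y) = ch n x * ch n y := by
  unfold ch; rw [← Complex.exp_add]; congr 1; simp; ring

lemma ch_mul (n m : ℤ × ℤ) (x : ℝ × ℝ) : ch n x * ch m x = ch (n + m) x := by
  unfold ch; rw [← Complex.exp_add]; congr 1; simp; ring

lemma ch_zero (x : ℝ × ℝ) : ch 0 x = 1 := by simp [ch]

lemma ch_norm (n : ℤ × ℤ) (x : ℝ × ℝ) : ‖ch n x‖ = 1 := by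
  unfold ch
  rw [Complex.norm_exp]
  simp

@[fun_prop]
lemma ch_cont (n : ℤ × ℤ) : Continuous (ch n) := by unfold ch; fun_prop

lemma ch_per (n : ℤ × ℤ) : Per (ch n) := by
  intro x
  constructor
  · have : ((x.1 + 1, x.2) : ℝ × ℝ) = x + (1, 0) := by ext <;> simp
    rw [this, ch_add]
    have : ch n (1, 0) = 1 := by
      unfold ch; rw [Complex.exp_eq_one_iff]; exact ⟨n.1, by simp; ring⟩
    rw [this, mul_one]
  · have : ((x.1, x.2 + 1) : ℝ × ℝ) = x + (0, 1) := by ext <;> simp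
    rw [this, ch_add]
    have : ch n (0, 1) = 1 := by
      unfold ch; rw [Complex.exp_eq_one_iff]; exact ⟨n.2, by simp; ring⟩
    rw [this, mul_one]

lemma ch_fl (ω : ℝ × ℝ) (n : ℤ × ℤ) (σ : ℝ) :
    ch n (fl ω σ) = Complex.exp (Complex.I * (fr ω n : ℂ) * σ) := by
  unfold ch fl fr
  congr 1
  have : (Real.pi : ℂ) ≠ 0 := by exact_mod_cast Real.pi_ne_zero
  push_cast
  field_simp

lemma fl_zero (ω : ℝ × ℝ) : fl ω 0 = 0 := by ext <;> simp [fl]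
lemma fl_add (ω : ℝ × ℝ) (s t : ℝ) : fl ω (s + t) = fl ω s + fl ω t := by
  ext <;> simp [fl] <;> ring

@[fun_prop]
lemma fl_cont (ω : ℝ × ℝ) : Continuous (fl ω) := by unfold fl; fun_prop

@[fun_prop]
lemma P_cont (S : Finset (ℤ × ℤ)) (c : ℤ × ℤ → ℂ) : Continuous (P S c) := by
  unfold P; fun_prop

lemma P_per (S : Finset (ℤ × ℤ)) (c : ℤ × ℤ → ℂ) : Per (P S c) := by
  intro x
  constructor
  · unfold P; exact Finset.sum_congr rfl fun n _ => by rw [(ch_per n x).1]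
  · unfold P; exact Finset.sum_congr rfl fun n _ => by rw [(ch_per n x).2]

lemma int_exp (k : ℤ) (hk : k ≠ 0) :
    ∫ a in (0:ℝ)..1, Complex.exp (2 * Real.pi * Complex.I * k * a) = 0 := by
  have h0 : (2 * Real.pi * Complex.I * k : ℂ) ≠ 0 := by
    simp [Real.pi_ne_zero, hk]
  rw [integral_exp_mul_complex h0]
  have : Complex.exp (2 * Real.pi * Complex.I * k * (1:ℝ)) = 1 := by
    rw [Complex.exp_eq_one_iff]; exact ⟨k, by push_cast; ring⟩
  rw [this]; simp

lemma ch_int (n : ℤ × ℤ) : ∫ x, ch n x ∂mT = if n = 0 then 1 else 0 := by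
  split_ifs with h
  · subst h; simp [ch_zero]
  · rw [mT_int (ch_cont n)]
    have : ∀ a b : ℝ, ch n (a, b) = Complex.exp (2 * Real.pi * Complex.I * n.1 * a) *
        Complex.exp (2 * Real.pi * Complex.I * n.2 * b) := by
      intro a b; unfold ch; rw [← Complex.exp_add]; congr 1; push_cast; ring
    simp only [this, intervalIntegral.integral_const_mul, intervalIntegral.integral_mul_const]
    by_cases h1 : n.1 = 0
    · have h2 : n.2 ≠ 0 := fun h2 => h (Prod.ext h1 h2)
      rw [int_exp _ h2]; simp
    · rw [int_exp _ h1]; simp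

/-- flow derivative -/
def FD (ω : ℝ × ℝ) (u u' : ℝ × ℝ → ℝ) : Prop :=
  ∀ x, HasDerivAt (fun σ => u (x + fl ω σ)) (u' x) 0

lemma FD.at {ω : ℝ × ℝ} {u u' : ℝ × ℝ → ℝ} (h : FD ω u u') (x : ℝ × ℝ) (σ : ℝ) :
    HasDerivAt (fun σ => u (x + fl ω σ)) (u' (x + fl ω σ)) σ := by
  have h1 := h (x + fl ω σ)
  have h2 : HasDerivAt (fun r : ℝ => r - σ) 1 σ := by simpa using (hasDerivAt_id σ).sub_const σ
  have h1' : HasDerivAt (fun τ => u (x + fl ω σ + fl ω τ)) (u' (x + fl ω σ)) (σ - σ) := by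
    simpa using h1
  have h3 := HasDerivAt.comp (h := fun r : ℝ => r - σ) σ h1' h2
  simp only [mul_one] at h3
  refine h3.congr_of_eventuallyEq (Filter.Eventually.of_forall fun r => ?_)
  simp only [Function.comp]
  rw [add_assoc, ← fl_add]; congr 3; ring

lemma FD.per {ω : ℝ × ℝ} {u u' : ℝ × ℝ → ℝ} (h : FD ω u u') (hu : Per u) : Per u' := by
  intro x
  constructor
  · apply HasDerivAt.unique (h (x.1 + 1, x.2))
    refine (h x).congr_of_eventuallyEq (Filter.Eventually.of_forall fun σ => ?_)
    show u ((x.1 + 1, x.2) + fl ω σ) = u (x + fl ω σ)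
    rw [← (hu (x + fl ω σ)).1]
    congr 1; ext <;> simp; ring
  · apply HasDerivAt.unique (h (x.1, x.2 + 1))
    refine (h x).congr_of_eventuallyEq (Filter.Eventually.of_forall fun σ => ?_)
    show u ((x.1, x.2 + 1) + fl ω σ) = u (x + fl ω σ)
    rw [← (hu (x + fl ω σ)).2]
    congr 1; ext <;> simp; ring

lemma FD.int_zero {ω : ℝ × ℝ} {u u' : ℝ × ℝ → ℝ} (h : FD ω u u') (hu : Per u)
    (hc : Continuous u) (hc' : Continuous u') : ∫ x, u' x ∂mT = 0 := by
  have h1 : ∀ x, ∫ σ in (0:ℝ)..1, u' (x + fl ω σ) = u (x + fl ω 1) - u x := by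
    intro x
    rw [intervalIntegral.integral_eq_sub_of_hasDerivAt (fun σ _ => h.at x σ)]
    · simp [fl_zero]
    · apply Continuous.intervalIntegrable; fun_prop
  have h2 : ∫ x, (∫ σ in (0:ℝ)..1, u' (x + fl ω σ)) ∂mT = 0 := by
    simp only [h1]
    rw [integral_sub (mT_integrable (by fun_prop)) (mT_integrable hc), mT_shift hc hu, sub_self]
  have h3 : ∫ x, (∫ σ in (0:ℝ)..1, u' (x + fl ω σ)) ∂mT =
      ∫ σ in (0:ℝ)..1, ∫ x, u' (x + fl ω σ) ∂mT := by
    simp only [intervalIntegral.integral_of_le zero_le_one]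
    rw [integral_integral_swap]
    have hcc : Continuous (fun z : (ℝ × ℝ) × ℝ => u' (z.1 + fl ω z.2)) := by fun_prop
    have := hcc.continuousOn.integrableOn_compact (μ := volume)
      ((isCompact_Icc (a := (0:ℝ)) (b := 1)).prod (isCompact_Icc (a := (0:ℝ)) (b := 1)) |>.prod
        (isCompact_Icc (a := (0:ℝ)) (b := 1)))
    have h4 := this.mono_set (prod_mono_right (Ioc_subset_Icc_self))
    rw [IntegrableOn, Measure.volume_eq_prod, ← Measure.prod_restrict] at h4
    exact h4
  rw [h3] at h2
  simp only [mT_shift hc' (h.per hu)] at h2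
  simpa using h2

end

end KP

set_option linter.all false
open MeasureTheory Set

namespace KP

noncomputable section

/-- joint continuity for nonnegative times -/
def Cts (v : ℝ → ℝ × ℝ → ℝ) : Prop :=
  ContinuousOn (fun z : ℝ × (ℝ × ℝ) => v z.1 z.2) (Ici 0 ×ˢ univ)

lemma Cts.max {v : ℝ → ℝ × ℝ → ℝ} (h : Cts v) :
    Continuous (fun z : ℝ × (ℝ × ℝ) => v (max z.1 0) z.2) := by
  have : Continuous (fun z : ℝ × (ℝ × ℝ) => ((Max.max z.1 0, z.2) : ℝ × (ℝ × ℝ))) := by fun_prop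
  exact h.comp_continuous this (fun z => by simp)

lemma Cts.sp {v : ℝ → ℝ × ℝ → ℝ} (h : Cts v) {t : ℝ} (ht : 0 ≤ t) : Continuous (v t) := by
  have : Continuous (fun x : (ℝ × ℝ) => ((t, x) : ℝ × (ℝ × ℝ))) := by fun_prop
  exact h.comp_continuous this (fun z => by simpa using ht)

lemma Cts.tm {v : ℝ → ℝ × ℝ → ℝ} (h : Cts v) (x : ℝ × ℝ) : ContinuousOn (fun t => v t x) (Ici 0) := by
  have : Continuous (fun t : ℝ => ((t, x) : ℝ × (ℝ × ℝ))) := by fun_prop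
  exact h.comp this.continuousOn (fun z hz => by simpa using hz)

lemma Cts.speed {v : ℝ → ℝ × ℝ → ℝ} (h : Cts v) {ρ : ℝ} (hρ : 0 ≤ ρ) :
    Cts (fun t x => v (ρ * t) x) := by
  have : Continuous (fun z : ℝ × (ℝ × ℝ) => ((ρ * z.1, z.2) : ℝ × (ℝ × ℝ))) := by fun_prop
  refine h.comp this.continuousOn (fun z hz => ?_)
  simp at hz ⊢; positivity

lemma Cts.add {v w : ℝ → ℝ × ℝ → ℝ} (h : Cts v) (h' : Cts w) : Cts (fun t x => v t x + w t x) :=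
  ContinuousOn.add h h'
lemma Cts.sub {v w : ℝ → ℝ × ℝ → ℝ} (h : Cts v) (h' : Cts w) : Cts (fun t x => v t x - w t x) :=
  ContinuousOn.sub h h'
lemma Cts.mul {v w : ℝ → ℝ × ℝ → ℝ} (h : Cts v) (h' : Cts w) : Cts (fun t x => v t x * w t x) :=
  ContinuousOn.mul h h'
lemma Cts.const (c : ℝ) : Cts (fun _ _ => c) := continuousOn_const
lemma Cts.rpow {v : ℝ → ℝ × ℝ → ℝ} (h : Cts v) (hv : ∀ t, 0 ≤ t → ∀ x, 0 < v t x) (θ : ℝ) :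
    Cts (fun t x => v t x ^ θ) :=
  ContinuousOn.rpow_const h (fun z hz => Or.inl (hv z.1 (by simpa using hz) z.2).ne')

lemma engine_eq {ω : ℝ × ℝ} {b bt φ φs : ℝ → ℝ × ℝ → ℝ} (hb : Cts b) (hbt : Cts bt)
    (hφ : Cts φ) (hφs : Cts φs) (hper : ∀ t, 0 ≤ t → Per (φ t))
    (dt : ∀ t, 0 ≤ t → ∀ x, HasDerivAt (fun t => b t x) (bt t x) t)
    (ds : ∀ t, 0 ≤ t → FD ω (φ t) (φs t)) {T : ℝ} (hT : 0 ≤ T) :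
    ∫ x, b T x ∂mT + ∫ t in (0:ℝ)..T, ∫ x, (φs t x - bt t x) ∂mT = ∫ x, b 0 x ∂mT := by
  have h1 : ∀ x, ∫ t in (0:ℝ)..T, bt t x = b T x - b 0 x := by
    intro x
    apply intervalIntegral.integral_eq_sub_of_hasDerivAt
    · intro t ht
      rw [uIcc_of_le hT] at ht
      exact dt t ht.1 x
    · apply ContinuousOn.intervalIntegrable
      rw [uIcc_of_le hT]
      exact (hbt.tm x).mono Icc_subset_Ici_self
  have h2 : ∀ t, 0 ≤ t → ∫ x, (φs t x - bt t x) ∂mT = - ∫ x, bt t x ∂mT := by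
    intro t ht
    rw [integral_sub (mT_integrable (hφs.sp ht)) (mT_integrable (hbt.sp ht)),
      (ds t ht).int_zero (hper t ht) (hφ.sp ht) (hφs.sp ht), zero_sub]
  have h3 : ∫ t in (0:ℝ)..T, ∫ x, (φs t x - bt t x) ∂mT =
      - ∫ t in (0:ℝ)..T, ∫ x, bt t x ∂mT := by
    rw [← intervalIntegral.integral_neg]
    apply intervalIntegral.integral_congr
    intro t ht
    rw [uIcc_of_le hT] at ht
    exact h2 t ht.1
  have h4 : ∫ t in (0:ℝ)..T, ∫ x, bt t x ∂mT = ∫ x, (∫ t in (0:ℝ)..T, bt t x) ∂mT := by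
    simp only [intervalIntegral.integral_of_le hT]
    rw [integral_integral_swap]
    have hcc := hbt.mono (t := Icc 0 T ×ˢ (Icc (0:ℝ) 1 ×ˢ Icc (0:ℝ) 1))
      (prod_mono Icc_subset_Ici_self (subset_univ _))
    have := hcc.integrableOn_compact (μ := volume)
      (isCompact_Icc.prod (isCompact_Icc.prod isCompact_Icc))
    have h4 := this.mono_set (prod_mono_left (Ioc_subset_Icc_self))
    rw [IntegrableOn, Measure.volume_eq_prod, ← Measure.prod_restrict] at h4
    exact h4
  rw [h3, h4]
  simp only [h1]
  rw [integral_sub (mT_integrable (hb.sp hT)) (mT_integrable (hb.sp le_rfl))]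
  ring

lemma lint_of_bound {Z : ℝ → ℝ × ℝ → ℝ} (hZ : Cts Z) (hZ0 : ∀ t, 0 ≤ t → ∀ x, 0 ≤ Z t x)
    {B : ℝ} (h : ∀ T, 0 ≤ T → ∫ t in (0:ℝ)..T, ∫ x, Z t x ∂mT ≤ B) :
    ∫⁻ t in Ioi (0:ℝ), ∫⁻ x, ENNReal.ofReal (Z t x) ∂mT ≤ ENNReal.ofReal B := by
  have hU : Ioi (0:ℝ) = ⋃ n : ℕ, Ioc (0:ℝ) n := by
    ext t
    simp only [mem_Ioi, mem_iUnion, mem_Ioc]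
    constructor
    · intro h; obtain ⟨n, hn⟩ := exists_nat_ge t; exact ⟨n, h, hn⟩
    · rintro ⟨n, h, _⟩; exact h
  have hcont : Continuous (fun t => ∫ x, Z (max t 0) x ∂mT) := by
    unfold mT
    apply continuous_parametric_integral_of_continuous (f := fun t x => Z (max t 0) x)
    · exact hZ.max
    · exact isCompact_Icc.prod isCompact_Icc
  rw [hU, setLIntegral_iUnion_of_directed]
  · apply iSup_le
    intro n
    have h1 : ∫⁻ t in Ioc (0:ℝ) n, ∫⁻ x, ENNReal.ofReal (Z t x) ∂mT =
        ∫⁻ t in Ioc (0:ℝ) n, ENNReal.ofReal (∫ x, Z (max t 0) x ∂mT) := by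
      apply setLIntegral_congr_fun measurableSet_Ioc
      intro t ht
      simp only
      rw [max_eq_left ht.1.le, ofReal_integral_eq_lintegral_ofReal (mT_integrable (hZ.sp ht.1.le))
        (Filter.Eventually.of_forall (hZ0 t ht.1.le))]
    rw [h1, ← ofReal_integral_eq_lintegral_ofReal]
    · apply ENNReal.ofReal_le_ofReal
      have := h n (by positivity)
      rw [intervalIntegral.integral_of_le (by positivity)] at this
      refine le_trans (le_of_eq ?_) this
      apply setIntegral_congr_fun measurableSet_Ioc
      intro t ht
      simp only
      rw [max_eq_left ht.1.le]
    · exact (hcont.continuousOn.integrableOn_compact isCompact_Icc).mono_set Ioc_subset_Icc_self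
    · exact Filter.Eventually.of_forall fun t => integral_nonneg fun x => hZ0 _ (le_max_right _ _) x
  · apply Monotone.directed_le
    intro m n hmn
    exact Ioc_subset_Ioc_right (by exact_mod_cast hmn)

lemma engine {ω : ℝ × ℝ} {b bt φ φs : ℝ → ℝ × ℝ → ℝ} (hb : Cts b) (hbt : Cts bt)
    (hφ : Cts φ) (hφs : Cts φs) (hper : ∀ t, 0 ≤ t → Per (φ t))
    (dt : ∀ t, 0 ≤ t → ∀ x, HasDerivAt (fun t => b t x) (bt t x) t)
    (ds : ∀ t, 0 ≤ t → FD ω (φ t) (φs t))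
    (hb0 : ∀ t, 0 ≤ t → ∀ x, 0 ≤ b t x)
    {Y : ℝ → ℝ × ℝ → ℝ} (hY0 : ∀ t, 0 ≤ t → ∀ x, 0 ≤ Y t x)
    (hY : ∀ t, 0 ≤ t → ∀ x, Y t x ≤ φs t x - bt t x) :
    ∫⁻ t in Ioi (0:ℝ), ∫⁻ x, ENNReal.ofReal (Y t x) ∂mT ≤ ENNReal.ofReal (∫ x, b 0 x ∂mT) := by
  refine le_trans ?_ (lint_of_bound (Z := fun t x => φs t x - bt t x) (hφs.sub hbt)
    (fun t ht x => (hY0 t ht x).trans (hY t ht x)) (B := ∫ x, b 0 x ∂mT) ?_)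
  · apply setLIntegral_mono' measurableSet_Ioi
    intro t ht
    exact lintegral_mono fun x => ENNReal.ofReal_le_ofReal (hY t (le_of_lt ht) x)
  · intro T hT
    have := engine_eq hb hbt hφ hφs hper dt ds hT
    have h2 : 0 ≤ ∫ x, b T x ∂mT := integral_nonneg fun x => hb0 T hT x
    linarith

lemma FD.add {ω : ℝ × ℝ} {u u' v v' : ℝ × ℝ → ℝ} (h : FD ω u u') (h2 : FD ω v v') :
    FD ω (fun x => u x + v x) (fun x => u' x + v' x) := fun x => (h x).add (h2 x)
lemma FD.mul {ω : ℝ × ℝ} {u u' v v' : ℝ × ℝ → ℝ} (h : FD ω u u') (h2 : FD ω v v') :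
    FD ω (fun x => u x * v x) (fun x => u' x * v x + u x * v' x) := fun x => by
  have := (h x).fun_mul (h2 x)
  simpa [fl_zero] using this
lemma FD.cmul {ω : ℝ × ℝ} {u u' : ℝ × ℝ → ℝ} (h : FD ω u u') (c : ℝ) :
    FD ω (fun x => c * u x) (fun x => c * u' x) := fun x => (h x).const_mul c
lemma FD.const {ω : ℝ × ℝ} (c : ℝ) : FD ω (fun _ => c) (fun _ => 0) := fun x => hasDerivAt_const _ _
lemma FD.rpow {ω : ℝ × ℝ} {u u' : ℝ × ℝ → ℝ} (h : FD ω u u') (hu : ∀ x, 0 < u x) (θ : ℝ) :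
    FD ω (fun x => u x ^ θ) (fun x => θ * u x ^ (θ - 1) * u' x) := fun x => by
  have := (h x).rpow_const (p := θ) (Or.inl (hu _).ne')
  simp only [fl_zero, add_zero] at this
  convert this using 1; ring
lemma FD.sum {ω : ℝ × ℝ} {ι : Type*} (s : Finset ι) {u u' : ι → ℝ × ℝ → ℝ}
    (h : ∀ i ∈ s, FD ω (u i) (u' i)) :
    FD ω (fun x => ∑ i ∈ s, u i x) (fun x => ∑ i ∈ s, u' i x) := fun x =>
  HasDerivAt.fun_sum fun i hi => h i hi x

/-- Positive subsolutions of the heat equation along the flow. -/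
structure SubSol (ω : ℝ × ℝ) (κ : ℝ) (W W1 W2 N : ℝ → ℝ × ℝ → ℝ) : Prop where
  pos : ∀ t, 0 ≤ t → ∀ x, 0 < W t x
  N0 : ∀ t, 0 ≤ t → ∀ x, 0 ≤ N t x
  dt : ∀ t, 0 ≤ t → ∀ x, HasDerivAt (fun t => W t x) (W2 t x - N t x) t
  d1 : ∀ t, 0 ≤ t → FD ω (W t) (W1 t)
  d2 : ∀ t, 0 ≤ t → FD ω (W1 t) (W2 t)
  grad : ∀ t, 0 ≤ t → ∀ x, W1 t x ^ 2 ≤ κ * (W t x * N t x)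
  c0 : Cts W
  c1 : Cts W1
  c2 : Cts W2
  cN : Cts N
  per : ∀ t, 0 ≤ t → Per (W t)

lemma SubSol.per1 {ω : ℝ × ℝ} {κ : ℝ} {W W1 W2 N : ℝ → ℝ × ℝ → ℝ} (h : SubSol ω κ W W1 W2 N) :
    ∀ t, 0 ≤ t → Per (W1 t) := fun t ht => (h.d1 t ht).per (h.per t ht)

lemma SubSol.smul {ω : ℝ × ℝ} {κ : ℝ} {W W1 W2 N : ℝ → ℝ × ℝ → ℝ} (h : SubSol ω κ W W1 W2 N)
    {c : ℝ} (hc : 0 < c) :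
    SubSol ω κ (fun t x => c * W t x) (fun t x => c * W1 t x) (fun t x => c * W2 t x)
      (fun t x => c * N t x) where
  pos t ht x := mul_pos hc (h.pos t ht x)
  N0 t ht x := mul_nonneg hc.le (h.N0 t ht x)
  dt t ht x := by simpa [mul_sub] using (h.dt t ht x).const_mul c
  d1 t ht := (h.d1 t ht).cmul c
  d2 t ht := (h.d2 t ht).cmul c
  grad t ht x := by
    have := mul_le_mul_of_nonneg_left (h.grad t ht x) (sq_nonneg c)
    nlinarith
  c0 := (Cts.const c).mul h.c0
  c1 := (Cts.const c).mul h.c1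
  c2 := (Cts.const c).mul h.c2
  cN := (Cts.const c).mul h.cN
  per t ht x := by simp only [(h.per t ht x).1, (h.per t ht x).2]; simp

lemma SubSol.rpow {ω : ℝ × ℝ} {κ : ℝ} {W W1 W2 N : ℝ → ℝ × ℝ → ℝ} (h : SubSol ω κ W W1 W2 N)
    (hκ : 0 ≤ κ) {θ η : ℝ} (hθ : 0 < θ) (hη0 : 0 < η) (hη1 : η ≤ 1) (hη : (1 - θ) * κ ≤ 1 - η) :
    ∃ N' : ℝ → ℝ × ℝ → ℝ, SubSol ω (θ * κ / η) (fun t x => W t x ^ θ)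
      (fun t x => θ * W t x ^ (θ - 1) * W1 t x)
      (fun t x => θ * W t x ^ (θ - 1) * W2 t x + θ * (θ - 1) * W t x ^ (θ - 2) * W1 t x ^ 2) N' ∧
      ∀ t, 0 ≤ t → ∀ x, η * θ * (W t x ^ (θ - 1) * N t x) ≤ N' t x := by
  have key : ∀ t, 0 ≤ t → ∀ x, η * θ * (W t x ^ (θ - 1) * N t x) ≤
      θ * (W t x ^ (θ - 1) * N t x) + θ * (θ - 1) * W t x ^ (θ - 2) * W1 t x ^ 2 := by
    intro t ht x
    have hW := h.pos t ht x
    have e1 : W t x ^ (θ - 1) = W t x ^ (θ - 2) * W t x := by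
      rw [← Real.rpow_add_one hW.ne']; congr 1; ring
    have hp : 0 < W t x ^ (θ - 2) := Real.rpow_pos_of_pos hW _
    rw [e1]
    have hg := h.grad t ht x
    have hN := mul_nonneg hW.le (h.N0 t ht x)
    have : (1 - θ) * W1 t x ^ 2 ≤ (1 - η) * (W t x * N t x) := by
      rcases le_total θ 1 with h1 | h1
      · calc (1 - θ) * W1 t x ^ 2 ≤ (1 - θ) * (κ * (W t x * N t x)) := by gcongr
          _ = ((1 - θ) * κ) * (W t x * N t x) := by ring
          _ ≤ _ := by gcongr
      · have : 0 ≤ (θ - 1) * W1 t x ^ 2 := mul_nonneg (by linarith) (sq_nonneg _)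
        have h2 : 0 ≤ (1 - η) * (W t x * N t x) := mul_nonneg (by linarith) hN
        linarith
    have := mul_le_mul_of_nonneg_left this (mul_pos hθ hp).le
    nlinarith
  refine ⟨fun t x => θ * (W t x ^ (θ - 1) * N t x) + θ * (θ - 1) * W t x ^ (θ - 2) * W1 t x ^ 2,
    ?_, key⟩
  have hr := fun e => h.c0.rpow h.pos e
  exact {
    pos := fun t ht x => Real.rpow_pos_of_pos (h.pos t ht x) _
    N0 := fun t ht x => le_trans (mul_nonneg (mul_pos hη0 hθ).le (mul_nonneg
      (Real.rpow_pos_of_pos (h.pos t ht x) _).le (h.N0 t ht x))) (key t ht x)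
    dt := fun t ht x => by
      have := (h.dt t ht x).rpow_const (p := θ) (Or.inl (h.pos t ht x).ne')
      convert this using 1; ring
    d1 := fun t ht => (h.d1 t ht).rpow (h.pos t ht) θ
    d2 := fun t ht => by
      have := (((h.d1 t ht).rpow (h.pos t ht) (θ - 1)).cmul θ).mul (h.d2 t ht)
      convert this using 2 with x
      rw [show θ - 1 - 1 = θ - 2 by ring]; ring
    grad := fun t ht x => by
      have hW := h.pos t ht x
      have hk := key t ht x
      have hpp : 0 < W t x ^ (θ - 1) := Real.rpow_pos_of_pos hW _
      have hp : 0 < W t x ^ θ := Real.rpow_pos_of_pos hW _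
      have e1 : W t x ^ θ = W t x ^ (θ - 1) * W t x := by
        rw [← Real.rpow_add_one hW.ne']; congr 1; ring
      have hg := h.grad t ht x
      have h1 := mul_le_mul_of_nonneg_left hk
        (show 0 ≤ θ * κ / η * W t x ^ θ by positivity)
      refine le_trans ?_ (le_trans h1 (le_of_eq (by ring)))
      have h2 := mul_le_mul_of_nonneg_left hg (show 0 ≤ θ ^ 2 * (W t x ^ (θ - 1)) ^ 2 by positivity)
      calc _ = θ ^ 2 * (W t x ^ (θ - 1)) ^ 2 * W1 t x ^ 2 := by ring
        _ ≤ _ := h2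
        _ = _ := by rw [e1]; field_simp
    c0 := hr θ
    c1 := ((Cts.const θ).mul (hr _)).mul h.c1
    c2 := (((Cts.const θ).mul (hr _)).mul h.c2).add
      (((Cts.const _).mul (hr _)).mul (ContinuousOn.pow h.c1 2))
    cN := ((Cts.const θ).mul ((hr _).mul h.cN)).add
      (((Cts.const _).mul (hr _)).mul (ContinuousOn.pow h.c1 2))
    per := fun t ht x => by simp only [(h.per t ht x).1, (h.per t ht x).2]; exact ⟨trivial, trivial⟩ }

end

end KP

set_option linter.all false
open MeasureTheory Set

namespace KP

noncomputable section

set_option maxHeartbeats 1000000 in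
lemma bell1_alg {α κ ρ₁ ρ₂ E M N Ne Nw M1 e1 w1 R : ℝ} (hα0 : 0 ≤ α) (hα1 : α ≤ 1) (hκ : 0 ≤ κ)
    (h1 : 0 < ρ₁) (h2 : 0 < ρ₂) (hE : 0 < E) (hM : 0 ≤ M) (hN : 0 ≤ N) (hNe : 0 ≤ Ne)
    (hNw : 0 ≤ Nw) (gM : M1 ^ 2 ≤ κ * (M * N)) (ge : e1 ^ 2 ≤ κ * (E * Ne))
    (gw : w1 ^ 2 ≤ κ * (E * Nw)) (hME : M ≤ E ^ (1 - α)) (hR : (ρ₁ + ρ₂) ^ 2 ≤ R * (ρ₁ * ρ₂)) :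
    1 / 2 * (ρ₁ * (E ^ α * N)) + R * (ρ₂ * Nw) ≤
      (4 * κ ^ 2 + 2 * κ) * ρ₁ * Ne + (4 * κ ^ 2 + 2 * κ + 1) * R * ρ₂ * Nw + ρ₁ * (E ^ α * N)
      + α * M * E ^ (α - 1) * (ρ₁ * Ne + ρ₂ * Nw)
      + α * (E ^ (α - 1) * M1 * (2 * ρ₁ * e1 + (ρ₁ + ρ₂) * w1))
      - α * (1 - α) * (M * E ^ (α - 2) * ((e1 + w1) * (ρ₁ * e1 + ρ₂ * w1))) := by
  have hR4 : 1 ≤ R := by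
    by_contra hcon
    push Not at hcon
    have : R * (ρ₁ * ρ₂) < 1 * (ρ₁ * ρ₂) := by gcongr
    nlinarith [mul_pos h1 h2, sq_nonneg (ρ₁ - ρ₂)]
  obtain ⟨n, hn0, rfl⟩ : ∃ n, 0 ≤ n ∧ Ne = n ^ 2 := ⟨√Ne, Real.sqrt_nonneg _, (Real.sq_sqrt hNe).symm⟩
  obtain ⟨v, hv0, rfl⟩ : ∃ n, 0 ≤ n ∧ Nw = n ^ 2 := ⟨√Nw, Real.sqrt_nonneg _, (Real.sq_sqrt hNw).symm⟩
  have hEα : 0 < E ^ α := Real.rpow_pos_of_pos hE _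
  have hEα1 : 0 < E ^ (α - 1) := Real.rpow_pos_of_pos hE _
  have hEα2 : 0 < E ^ (α - 2) := Real.rpow_pos_of_pos hE _
  obtain ⟨y, hy0, hy⟩ : ∃ n, 0 ≤ n ∧ E ^ α * N = n ^ 2 :=
    ⟨√(E ^ α * N), Real.sqrt_nonneg _, (Real.sq_sqrt (by positivity)).symm⟩
  have hME1 : M * E ^ (α - 1) ≤ 1 := by
    calc M * E ^ (α - 1) ≤ E ^ (1 - α) * E ^ (α - 1) := by gcongr
      _ = 1 := by rw [← Real.rpow_add hE]; simp
  have hE1 : E ^ (α - 1) * E = E ^ α := by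
    rw [← Real.rpow_add_one hE.ne']; congr 1; ring
  have hE2 : E ^ (α - 2) * E = E ^ (α - 1) := by
    rw [← Real.rpow_add_one hE.ne']; congr 1; ring
  have cross : ∀ z d : ℝ, 0 ≤ d → z ^ 2 ≤ κ * (E * d ^ 2) →
      |E ^ (α - 1) * M1 * z| ≤ κ * y * d := by
    intro z d hd hz
    apply abs_le_of_sq_le_sq _ (by positivity)
    calc (E ^ (α - 1) * M1 * z) ^ 2 = (E ^ (α - 1)) ^ 2 * (M1 ^ 2 * z ^ 2) := by ring
      _ ≤ (E ^ (α - 1)) ^ 2 * ((κ * (M * N)) * (κ * (E * d ^ 2))) := by gcongr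
      _ = κ ^ 2 * d ^ 2 * ((E ^ (α - 1) * E) * N) * (M * E ^ (α - 1)) := by ring
      _ ≤ κ ^ 2 * d ^ 2 * ((E ^ (α - 1) * E) * N) * 1 := by gcongr
      _ = (κ * y * d) ^ 2 := by rw [hE1, hy]; ring
  have ce := cross e1 n hn0 ge
  have cw := cross w1 v hv0 gw
  set Q := M * E ^ (α - 2) with hQ
  have hQ0 : 0 ≤ Q := by positivity
  have hQE : Q * E ≤ 1 := by rw [hQ, mul_assoc, hE2]; exact hME1
  have q1 : Q * e1 ^ 2 ≤ κ * n ^ 2 := by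
    calc Q * e1 ^ 2 ≤ Q * (κ * (E * n ^ 2)) := by gcongr
      _ = (Q * E) * (κ * n ^ 2) := by ring
      _ ≤ 1 * (κ * n ^ 2) := by gcongr
      _ = _ := one_mul _
  have q2 : Q * w1 ^ 2 ≤ κ * v ^ 2 := by
    calc Q * w1 ^ 2 ≤ Q * (κ * (E * v ^ 2)) := by gcongr
      _ = (Q * E) * (κ * v ^ 2) := by ring
      _ ≤ 1 * (κ * v ^ 2) := by gcongr
      _ = _ := one_mul _
  have q3 : |Q * (e1 * w1)| ≤ κ * n * v := by
    apply abs_le_of_sq_le_sq _ (by positivity)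
    calc (Q * (e1 * w1)) ^ 2 = (Q * e1 ^ 2) * (Q * w1 ^ 2) := by ring
      _ ≤ (κ * n ^ 2) * (κ * v ^ 2) := by gcongr
      _ = _ := by ring
  -- first block
  have b1 : -(κ * y * (2 * ρ₁ * n + (ρ₁ + ρ₂) * v)) ≤
      α * (E ^ (α - 1) * M1 * (2 * ρ₁ * e1 + (ρ₁ + ρ₂) * w1)) := by
    have a1 := (abs_le.1 ce).1
    have a2 := (abs_le.1 cw).1
    have : -(κ * y * (2 * ρ₁ * n + (ρ₁ + ρ₂) * v)) ≤
        E ^ (α - 1) * M1 * (2 * ρ₁ * e1 + (ρ₁ + ρ₂) * w1) := by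
      have a3 := mul_le_mul_of_nonneg_left a1 (show 0 ≤ 2 * ρ₁ by positivity)
      have a4 := mul_le_mul_of_nonneg_left a2 (show 0 ≤ ρ₁ + ρ₂ by positivity)
      linarith
    have hneg : 0 ≤ κ * y * (2 * ρ₁ * n + (ρ₁ + ρ₂) * v) := by positivity
    have t1 := mul_le_mul_of_nonneg_left this hα0
    have t2 := mul_le_mul_of_nonneg_right hα1 hneg
    linarith
  have b2 : α * (1 - α) * (Q * ((e1 + w1) * (ρ₁ * e1 + ρ₂ * w1))) ≤
      κ * (ρ₁ * n ^ 2 + ρ₂ * v ^ 2 + (ρ₁ + ρ₂) * (n * v)) := by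
    have a3 : Q * ((e1 + w1) * (ρ₁ * e1 + ρ₂ * w1)) ≤
        κ * (ρ₁ * n ^ 2 + ρ₂ * v ^ 2 + (ρ₁ + ρ₂) * (n * v)) := by
      have a1 := mul_le_mul_of_nonneg_left q1 h1.le
      have a2 := mul_le_mul_of_nonneg_left q2 h2.le
      have a4 := mul_le_mul_of_nonneg_left (abs_le.1 q3).2 (show 0 ≤ ρ₁ + ρ₂ by positivity)
      linarith
    have hpos : 0 ≤ κ * (ρ₁ * n ^ 2 + ρ₂ * v ^ 2 + (ρ₁ + ρ₂) * (n * v)) := by positivity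
    have hc0 : 0 ≤ α * (1 - α) := mul_nonneg hα0 (by linarith)
    have hc1 : α * (1 - α) ≤ 1 := by nlinarith
    calc _ ≤ α * (1 - α) * (κ * (ρ₁ * n ^ 2 + ρ₂ * v ^ 2 + (ρ₁ + ρ₂) * (n * v))) := by gcongr
      _ ≤ 1 * _ := by gcongr
      _ = _ := one_mul _
  have b3 : 0 ≤ α * M * E ^ (α - 1) * (ρ₁ * n ^ 2 + ρ₂ * v ^ 2) := by positivity
  have c1 : κ * y * (2 * ρ₁ * n) ≤ ρ₁ * y ^ 2 / 4 + 4 * κ ^ 2 * ρ₁ * n ^ 2 := by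
    nlinarith [mul_nonneg h1.le (sq_nonneg (y / 2 - 2 * κ * n))]
  have c2 : κ * y * ((ρ₁ + ρ₂) * v) ≤ ρ₁ * y ^ 2 / 4 + κ ^ 2 * (R * ρ₂) * v ^ 2 := by
    have : (ρ₁ + ρ₂) ^ 2 * (κ ^ 2 * v ^ 2) ≤ R * (ρ₁ * ρ₂) * (κ ^ 2 * v ^ 2) := by gcongr
    have h3 := sq_nonneg (ρ₁ * y / 2 - κ * (ρ₁ + ρ₂) * v)
    have h4 : ρ₁ * (κ * y * ((ρ₁ + ρ₂) * v)) ≤ ρ₁ * (ρ₁ * y ^ 2 / 4 + κ ^ 2 * (R * ρ₂) * v ^ 2) := by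
      nlinarith
    exact le_of_mul_le_mul_left h4 h1
  have c3 : (ρ₁ + ρ₂) * (n * v) ≤ ρ₁ * n ^ 2 + R * ρ₂ * v ^ 2 := by
    have : (ρ₁ + ρ₂) ^ 2 * v ^ 2 ≤ R * (ρ₁ * ρ₂) * v ^ 2 := by gcongr
    have h4 : ρ₁ * ((ρ₁ + ρ₂) * (n * v)) ≤ ρ₁ * (ρ₁ * n ^ 2 + R * ρ₂ * v ^ 2) := by
      nlinarith [sq_nonneg (ρ₁ * n - (ρ₁ + ρ₂) * v), sq_nonneg (ρ₁ * n), sq_nonneg ((ρ₁ + ρ₂) * v)]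
    exact le_of_mul_le_mul_left h4 h1
  have c4 : κ * (ρ₁ * n ^ 2 + ρ₂ * v ^ 2 + (ρ₁ + ρ₂) * (n * v)) ≤
      2 * κ * ρ₁ * n ^ 2 + 2 * κ * R * ρ₂ * v ^ 2 := by
    have : ρ₂ * v ^ 2 ≤ R * ρ₂ * v ^ 2 := by
      have : 0 ≤ ρ₂ * v ^ 2 := by positivity
      nlinarith
    have := mul_le_mul_of_nonneg_left (add_le_add this c3) hκ
    linarith
  have c5 : 0 ≤ κ ^ 2 * R * ρ₂ * v ^ 2 := by positivity
  have c6 : 0 ≤ κ * R * ρ₂ * v ^ 2 := by positivity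
  rw [hy]
  linarith

/-- subsolutions with speed -/
structure Sp (ω : ℝ × ℝ) (κ ρ : ℝ) (W W1 W2 N : ℝ → ℝ × ℝ → ℝ) : Prop where
  pos : ∀ t, 0 ≤ t → ∀ x, 0 < W t x
  N0 : ∀ t, 0 ≤ t → ∀ x, 0 ≤ N t x
  dt : ∀ t, 0 ≤ t → ∀ x, HasDerivAt (fun t => W t x) (ρ * (W2 t x - N t x)) t
  d1 : ∀ t, 0 ≤ t → FD ω (W t) (W1 t)
  d2 : ∀ t, 0 ≤ t → FD ω (W1 t) (W2 t)
  grad : ∀ t, 0 ≤ t → ∀ x, W1 t x ^ 2 ≤ κ * (W t x * N t x)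
  c0 : Cts W
  c1 : Cts W1
  c2 : Cts W2
  cN : Cts N
  per : ∀ t, 0 ≤ t → Per (W t)
  per1 : ∀ t, 0 ≤ t → Per (W1 t)

lemma SubSol.speed {ω : ℝ × ℝ} {κ κ' : ℝ} {W W1 W2 N : ℝ → ℝ × ℝ → ℝ} (h : SubSol ω κ W W1 W2 N)
    (hk : κ ≤ κ') {ρ : ℝ} (hρ : 0 < ρ) :
    Sp ω κ' ρ (fun t => W (ρ * t)) (fun t => W1 (ρ * t)) (fun t => W2 (ρ * t))
      (fun t => N (ρ * t)) where
  pos t ht x := h.pos _ (by positivity) x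
  N0 t ht x := h.N0 _ (by positivity) x
  dt t ht x := by
    have h2 : HasDerivAt (fun t => ρ * t) ρ t := by simpa using (hasDerivAt_id t).const_mul ρ
    have := HasDerivAt.comp (h := fun t => ρ * t) t (h.dt (ρ * t) (by positivity) x) h2
    rw [mul_comm]; exact this
  d1 t ht := h.d1 _ (by positivity)
  d2 t ht := h.d2 _ (by positivity)
  grad t ht x := (h.grad _ (by positivity) x).trans (by
    have := mul_nonneg (h.pos (ρ * t) (by positivity) x).le (h.N0 (ρ * t) (by positivity) x)
    gcongr)
  c0 := h.c0.speed hρ.le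
  c1 := h.c1.speed hρ.le
  c2 := h.c2.speed hρ.le
  cN := h.cN.speed hρ.le
  per t ht := h.per _ (by positivity)
  per1 t ht := h.per1 _ (by positivity)

lemma bell1 {ω : ℝ × ℝ} {κ ρ₁ ρ₂ α R : ℝ} {M M1 M2 N e e1 e2 Ne w w1 w2 Nw : ℝ → ℝ × ℝ → ℝ}
    (hM : Sp ω κ ρ₁ M M1 M2 N) (he : Sp ω κ ρ₁ e e1 e2 Ne) (hw : Sp ω κ ρ₂ w w1 w2 Nw)
    (hα0 : 0 ≤ α) (hα1 : α ≤ 1) (hκ : 0 ≤ κ) (h1 : 0 < ρ₁) (h2 : 0 < ρ₂)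
    (hMe : ∀ t, 0 ≤ t → ∀ x, M t x ≤ e t x ^ (1 - α)) (hR : (ρ₁ + ρ₂) ^ 2 ≤ R * (ρ₁ * ρ₂)) :
    ∫⁻ t in Ioi (0:ℝ), ∫⁻ x, ENNReal.ofReal
      (1 / 2 * (ρ₁ * ((e t x + w t x) ^ α * N t x)) + R * (ρ₂ * Nw t x)) ∂mT ≤
    ENNReal.ofReal ((4 * κ ^ 2 + 2 * κ + 2) * (∫ x, e 0 x ∂mT + R * ∫ x, w 0 x ∂mT)) := by
  have hR4 : 1 ≤ R := by
    by_contra hcon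
    push Not at hcon
    have : R * (ρ₁ * ρ₂) < 1 * (ρ₁ * ρ₂) := by gcongr
    nlinarith [mul_pos h1 h2, sq_nonneg (ρ₁ - ρ₂)]
  have hE : ∀ t, 0 ≤ t → ∀ x, 0 < e t x + w t x := fun t ht x =>
    add_pos (he.pos t ht x) (hw.pos t ht x)
  have hMb : ∀ t, 0 ≤ t → ∀ x, M t x ≤ (e t x + w t x) ^ (1 - α) := fun t ht x =>
    (hMe t ht x).trans (Real.rpow_le_rpow (he.pos t ht x).le
      (by linarith [hw.pos t ht x]) (by linarith))
  set K1 := 4 * κ ^ 2 + 2 * κ with hK1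
  set K2 := (4 * κ ^ 2 + 2 * κ + 1) * R with hK2
  have hK10 : 0 ≤ K1 := by positivity
  have hK20 : 0 ≤ K2 := by positivity
  have cE := fun a => (he.c0.add hw.c0).rpow hE a
  have dE : ∀ t, 0 ≤ t → FD ω (fun x => e t x + w t x) (fun x => e1 t x + w1 t x) := fun t ht =>
    (he.d1 t ht).add (hw.d1 t ht)
  have main := engine (ω := ω)
    (b := fun t x => K1 * e t x + K2 * w t x + M t x * (e t x + w t x) ^ α)
    (bt := fun t x => K1 * (ρ₁ * (e2 t x - Ne t x)) + K2 * (ρ₂ * (w2 t x - Nw t x)) +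
      (ρ₁ * (M2 t x - N t x) * (e t x + w t x) ^ α + M t x * (α * (e t x + w t x) ^ (α - 1) *
        (ρ₁ * (e2 t x - Ne t x) + ρ₂ * (w2 t x - Nw t x)))))
    (φ := fun t x => K1 * ρ₁ * e1 t x + K2 * ρ₂ * w1 t x + ρ₁ * (M1 t x * (e t x + w t x) ^ α) +
      α * (M t x * ((e t x + w t x) ^ (α - 1) * (ρ₁ * e1 t x + ρ₂ * w1 t x))))
    (φs := fun t x => K1 * ρ₁ * e2 t x + K2 * ρ₂ * w2 t x +
      ρ₁ * (M2 t x * (e t x + w t x) ^ α +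
        M1 t x * (α * (e t x + w t x) ^ (α - 1) * (e1 t x + w1 t x))) +
      α * (M1 t x * ((e t x + w t x) ^ (α - 1) * (ρ₁ * e1 t x + ρ₂ * w1 t x)) +
        M t x * (((α - 1) * (e t x + w t x) ^ (α - 1 - 1) * (e1 t x + w1 t x)) *
          (ρ₁ * e1 t x + ρ₂ * w1 t x) + (e t x + w t x) ^ (α - 1) *
          (ρ₁ * e2 t x + ρ₂ * w2 t x))))
    (Y := fun t x => 1 / 2 * (ρ₁ * ((e t x + w t x) ^ α * N t x)) + R * (ρ₂ * Nw t x))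
    ((((Cts.const _).mul he.c0).add ((Cts.const _).mul hw.c0)).add (hM.c0.mul (cE _)))
    ((((Cts.const _).mul ((Cts.const _).mul (he.c2.sub he.cN))).add
      ((Cts.const _).mul ((Cts.const _).mul (hw.c2.sub hw.cN)))).add
      ((((Cts.const _).mul (hM.c2.sub hM.cN)).mul (cE _)).add
        (hM.c0.mul (((Cts.const _).mul (cE _)).mul (((Cts.const _).mul (he.c2.sub he.cN)).add
          ((Cts.const _).mul (hw.c2.sub hw.cN)))))))
    ((((((Cts.const _).mul he.c1)).add ((Cts.const _).mul hw.c1)).add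
      ((Cts.const _).mul (hM.c1.mul (cE _)))).add
      ((Cts.const _).mul (hM.c0.mul ((cE _).mul (((Cts.const _).mul he.c1).add
        ((Cts.const _).mul hw.c1))))))
    ((((((Cts.const _).mul he.c2)).add ((Cts.const _).mul hw.c2)).add
      ((Cts.const _).mul ((hM.c2.mul (cE _)).add
        (hM.c1.mul (((Cts.const _).mul (cE _)).mul (he.c1.add hw.c1)))))).add
      ((Cts.const _).mul ((hM.c1.mul ((cE _).mul (((Cts.const _).mul he.c1).add
        ((Cts.const _).mul hw.c1)))).add (hM.c0.mul
        (((((Cts.const _).mul (cE _)).mul (he.c1.add hw.c1)).mul (((Cts.const _).mul he.c1).add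
        ((Cts.const _).mul hw.c1))).add ((cE _).mul (((Cts.const _).mul he.c2).add
        ((Cts.const _).mul hw.c2))))))))
    ?_ ?_ ?_ ?_ ?_ ?_
  · refine main.trans (ENNReal.ofReal_le_ofReal ?_)
    have i1 := mT_integrable (he.c0.sp le_rfl)
    have i2 := mT_integrable (hw.c0.sp le_rfl)
    rw [← integral_const_mul R, ← integral_add i1 (i2.const_mul R), ← integral_const_mul]
    apply integral_mono
    · exact ((i1.const_mul _).add (i2.const_mul _)).add
        (mT_integrable ((hM.c0.mul (cE α)).sp le_rfl))
    · exact (i1.add (i2.const_mul _)).const_mul _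
    · intro x
      simp only
      have p1 := he.pos 0 le_rfl x
      have p2 := hw.pos 0 le_rfl x
      have hp := hE 0 le_rfl x
      have : M 0 x * (e 0 x + w 0 x) ^ α ≤ e 0 x + w 0 x := by
        calc M 0 x * (e 0 x + w 0 x) ^ α ≤ (e 0 x + w 0 x) ^ (1 - α) * (e 0 x + w 0 x) ^ α := by
              gcongr; exact hMb 0 le_rfl x
          _ = _ := by rw [← Real.rpow_add hp]; simp
      have h5 : w 0 x ≤ R * w 0 x := by nlinarith
      rw [hK2]
      nlinarith
  · intro t ht x
    have q1 := he.per t ht x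
    have q2 := hw.per t ht x
    have q3 := hM.per t ht x
    have q4 := he.per1 t ht x
    have q5 := hw.per1 t ht x
    have q6 := hM.per1 t ht x
    simp only [q1.1, q1.2, q2.1, q2.2, q3.1, q3.2, q4.1, q4.2, q5.1, q5.2, q6.1, q6.2]
    exact ⟨trivial, trivial⟩
  · intro t ht x
    have g1 := he.dt t ht x
    have g2 := hw.dt t ht x
    have g3 := hM.dt t ht x
    have g4 := (g1.fun_add g2).rpow_const (p := α) (Or.inl (hE t ht x).ne')
    have := ((g1.const_mul K1).fun_add (g2.const_mul K2)).fun_add (g3.fun_mul g4)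
    exact this.congr_deriv (by ring)
  · intro t ht
    have r1 := (dE t ht).rpow (hE t ht) α
    have r2 := (dE t ht).rpow (hE t ht) (α - 1)
    exact ((((he.d2 t ht).cmul (K1 * ρ₁)).add ((hw.d2 t ht).cmul (K2 * ρ₂))).add
      (((hM.d2 t ht).mul r1).cmul ρ₁)).add (((hM.d1 t ht).mul (r2.mul
        (((he.d2 t ht).cmul ρ₁).add ((hw.d2 t ht).cmul ρ₂)))).cmul α)
  · intro t ht x
    have p1 := he.pos t ht x
    have p2 := hw.pos t ht x
    have p3 := hM.pos t ht x
    have hp := hE t ht x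
    positivity
  · intro t ht x
    have hp := hE t ht x
    have n1 := hM.N0 t ht x
    have n2 := hw.N0 t ht x
    positivity
  · intro t ht x
    have p1 := he.pos t ht x
    have p2 := hw.pos t ht x
    have n1 := he.N0 t ht x
    have n2 := hw.N0 t ht x
    have := bell1_alg (R := R) hα0 hα1 hκ h1 h2 (hE t ht x) (hM.pos t ht x).le (hM.N0 t ht x)
      n1 n2 (hM.grad t ht x)
      ((he.grad t ht x).trans (show _ ≤ κ * ((e t x + w t x) * Ne t x) by gcongr; linarith))
      ((hw.grad t ht x).trans (show _ ≤ κ * ((e t x + w t x) * Nw t x) by gcongr; linarith))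
      (hMb t ht x) hR
    refine this.trans (le_of_eq ?_)
    rw [show α - 1 - 1 = α - 2 by ring]
    simp only [hK1, hK2]
    ring

end

end KP

set_option linter.all false
open MeasureTheory Set

namespace KP

noncomputable section

lemma bell3 {ω : ℝ × ℝ} {κ ρ B : ℝ} {G G1 G2 N w w1 w2 Nw : ℝ → ℝ × ℝ → ℝ}
    (hG : Sp ω κ ρ G G1 G2 N) (hw : Sp ω κ 1 w w1 w2 Nw) (hκ : 0 ≤ κ) (h1 : 1 ≤ ρ)
    (hGB : ∀ t, 0 ≤ t → ∀ x, G t x ≤ B) :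
    ∫⁻ t in Ioi (0:ℝ), ∫⁻ x, ENNReal.ofReal (1 / 2 * (ρ * (N t x * w t x))) ∂mT ≤
    ENNReal.ofReal ((2 * κ ^ 2 + 1) * B * ρ * ∫ x, w 0 x ∂mT) := by
  have hB : 0 < B := (hG.pos 0 le_rfl 0).trans_le (hGB 0 le_rfl 0)
  set K := 2 * κ ^ 2 * B * ρ with hK
  have hK0 : 0 ≤ K := by positivity
  have main := engine (ω := ω)
    (b := fun t x => K * w t x + G t x * w t x)
    (bt := fun t x => K * (1 * (w2 t x - Nw t x)) + (ρ * (G2 t x - N t x) * w t x +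
      G t x * (1 * (w2 t x - Nw t x))))
    (φ := fun t x => K * w1 t x + (ρ * (G1 t x * w t x) + G t x * w1 t x))
    (φs := fun t x => K * w2 t x + (ρ * (G2 t x * w t x + G1 t x * w1 t x) +
      (G1 t x * w1 t x + G t x * w2 t x)))
    (Y := fun t x => 1 / 2 * (ρ * (N t x * w t x)))
    (((Cts.const _).mul hw.c0).add (hG.c0.mul hw.c0))
    (((Cts.const _).mul ((Cts.const _).mul (hw.c2.sub hw.cN))).add
      ((((Cts.const _).mul (hG.c2.sub hG.cN)).mul hw.c0).add
        (hG.c0.mul ((Cts.const _).mul (hw.c2.sub hw.cN)))))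
    (((Cts.const _).mul hw.c1).add (((Cts.const _).mul (hG.c1.mul hw.c0)).add (hG.c0.mul hw.c1)))
    (((Cts.const _).mul hw.c2).add (((Cts.const _).mul ((hG.c2.mul hw.c0).add (hG.c1.mul hw.c1))).add
      ((hG.c1.mul hw.c1).add (hG.c0.mul hw.c2))))
    ?_ ?_ ?_ ?_ ?_ ?_
  · refine main.trans (ENNReal.ofReal_le_ofReal ?_)
    have i2 := mT_integrable (hw.c0.sp le_rfl)
    rw [← integral_const_mul]
    apply integral_mono
    · exact (i2.const_mul _).add (mT_integrable ((hG.c0.mul hw.c0).sp le_rfl))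
    · exact i2.const_mul _
    · intro x
      simp only
      have p1 := hw.pos 0 le_rfl x
      have : G 0 x * w 0 x ≤ B * ρ * w 0 x := by
        have := hGB 0 le_rfl x
        gcongr
        nlinarith
      rw [hK]
      linarith
  · intro t ht x
    have q1 := hG.per t ht x
    have q2 := hw.per t ht x
    have q4 := hG.per1 t ht x
    have q5 := hw.per1 t ht x
    simp only [q1.1, q1.2, q2.1, q2.2, q4.1, q4.2, q5.1, q5.2]
    exact ⟨trivial, trivial⟩
  · intro t ht x
    have g1 := hG.dt t ht x
    have g2 := hw.dt t ht x
    exact (g2.const_mul K).fun_add (g1.fun_mul g2)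
  · intro t ht
    exact ((hw.d2 t ht).cmul K).add ((((hG.d2 t ht).mul (hw.d1 t ht)).cmul ρ).add
      ((hG.d1 t ht).mul (hw.d2 t ht)))
  · intro t ht x
    have p1 := hG.pos t ht x
    have p2 := hw.pos t ht x
    positivity
  · intro t ht x
    have p2 := hw.pos t ht x
    have n1 := hG.N0 t ht x
    positivity
  · intro t ht x
    have p1 := hG.pos t ht x
    have p2 := hw.pos t ht x
    have n1 := hG.N0 t ht x
    have n2 := hw.N0 t ht x
    have hb := hGB t ht x
    -- key estimate
    obtain ⟨y, hy0, hy⟩ : ∃ n, 0 ≤ n ∧ N t x * w t x = n ^ 2 :=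
      ⟨√(N t x * w t x), Real.sqrt_nonneg _, (Real.sq_sqrt (by positivity)).symm⟩
    obtain ⟨v, hv0, hv⟩ : ∃ n, 0 ≤ n ∧ B * Nw t x = n ^ 2 :=
      ⟨√(B * Nw t x), Real.sqrt_nonneg _, (Real.sq_sqrt (by positivity)).symm⟩
    have key : |G1 t x * w1 t x| ≤ κ * y * v := by
      apply abs_le_of_sq_le_sq _ (by positivity)
      have a1 := hG.grad t ht x
      have a2 := hw.grad t ht x
      calc (G1 t x * w1 t x) ^ 2 = G1 t x ^ 2 * w1 t x ^ 2 := by ring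
        _ ≤ (κ * (G t x * N t x)) * (κ * (w t x * Nw t x)) := by gcongr
        _ ≤ (κ * (B * N t x)) * (κ * (w t x * Nw t x)) := by gcongr
        _ = κ ^ 2 * ((N t x * w t x) * (B * Nw t x)) := by ring
        _ = _ := by rw [hy, hv]; ring
    have k1 := (abs_le.1 key).1
    have k2 : κ * y * v ≤ y ^ 2 / 4 + κ ^ 2 * v ^ 2 := by nlinarith [sq_nonneg (y / 2 - κ * v)]
    have k3 : 0 ≤ κ ^ 2 * v ^ 2 := by positivity
    have k4 : (ρ + 1) * (κ * y * v) ≤ 2 * ρ * (y ^ 2 / 4 + κ ^ 2 * v ^ 2) := by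
      have : 0 ≤ κ * y * v := by positivity
      calc (ρ + 1) * (κ * y * v) ≤ (2 * ρ) * (κ * y * v) := by gcongr; linarith
        _ ≤ _ := by gcongr
    have k5 : -((ρ + 1) * (κ * y * v)) ≤ (ρ + 1) * (G1 t x * w1 t x) := by
      have := mul_le_mul_of_nonneg_left k1 (show 0 ≤ ρ + 1 by linarith)
      linarith
    have k6 : K * Nw t x = 2 * κ ^ 2 * ρ * v ^ 2 := by rw [hK, ← hv]; ring
    have k7 : 0 ≤ G t x * Nw t x := by positivity
    have k8 : ρ * (N t x * w t x) = ρ * y ^ 2 := by rw [hy]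
    have : K * w2 t x + (ρ * (G2 t x * w t x + G1 t x * w1 t x) +
      (G1 t x * w1 t x + G t x * w2 t x)) - (K * (1 * (w2 t x - Nw t x)) +
      (ρ * (G2 t x - N t x) * w t x + G t x * (1 * (w2 t x - Nw t x)))) =
      K * Nw t x + ρ * (N t x * w t x) + G t x * Nw t x + (ρ + 1) * (G1 t x * w1 t x) := by ring
    rw [this]
    linarith

lemma per_int {E : Type*} {u : ℝ × ℝ → E} (hu : Per u) (m n : ℤ) (x : ℝ × ℝ) :
    u (x.1 + m, x.2 + n) = u x := by
  have h1 : Function.Periodic (fun a => u (a, x.2 + n)) 1 := fun a => (hu (a, x.2 + n)).1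
  have h2 : Function.Periodic (fun b => u (x.1, b)) 1 := fun b => (hu (x.1, b)).2
  have e1 := h1.int_mul m x.1
  have e2 := h2.int_mul n x.2
  simp only [mul_one] at e1 e2
  rw [e1, e2]

lemma per_fract {E : Type*} {u : ℝ × ℝ → E} (hu : Per u) (x : ℝ × ℝ) :
    u (Int.fract x.1, Int.fract x.2) = u x := by
  rw [← per_int hu ⌊x.1⌋ ⌊x.2⌋ (Int.fract x.1, Int.fract x.2)]
  simp

/-- maximum principle -/
lemma SubSol.sup {ω : ℝ × ℝ} {κ : ℝ} {W W1 W2 N : ℝ → ℝ × ℝ → ℝ} (h : SubSol ω κ W W1 W2 N)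
    (hκ : 0 ≤ κ) {B : ℝ} (hB : ∀ x, W 0 x ≤ B) {T : ℝ} (hT : 0 ≤ T) (x₀ : ℝ × ℝ) : W T x₀ ≤ B := by
  have hB0 : 0 < B := (h.pos 0 le_rfl 0).trans_le (hB 0)
  have step : ∀ n : ℕ, 1 ≤ n → ∫ x, W T x ^ (n:ℝ) ∂mT ≤ B ^ (n:ℝ) := by
    intro n hn
    have hn1 : (1:ℝ) ≤ n := by exact_mod_cast hn
    obtain ⟨N', hs, -⟩ := h.rpow hκ (θ := n) (η := 1) (by linarith) one_pos le_rfl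
      (by nlinarith)
    have e := engine_eq (ω := ω) hs.c0 (hs.c2.sub hs.cN) hs.c1 hs.c2 hs.per1 hs.dt hs.d2 hT
    have h0 : 0 ≤ ∫ t in (0:ℝ)..T, ∫ x, (((n:ℝ) * W t x ^ ((n:ℝ) - 1) * W2 t x +
        (n:ℝ) * ((n:ℝ) - 1) * W t x ^ ((n:ℝ) - 2) * W1 t x ^ 2) - (((n:ℝ) * W t x ^ ((n:ℝ) - 1) * W2 t x +
        (n:ℝ) * ((n:ℝ) - 1) * W t x ^ ((n:ℝ) - 2) * W1 t x ^ 2) - N' t x)) ∂mT := by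
      apply intervalIntegral.integral_nonneg hT
      intro t ht
      apply integral_nonneg
      intro x
      have := hs.N0 t ht.1 x
      simp only [Pi.zero_apply]; linarith
    have h1 : ∫ x, W 0 x ^ (n:ℝ) ∂mT ≤ ∫ x, B ^ (n:ℝ) ∂mT := by
      apply integral_mono (mT_integrable (hs.c0.sp le_rfl)) (integrable_const _)
      intro x
      exact Real.rpow_le_rpow (h.pos 0 le_rfl x).le (hB x) (by linarith)
    simp at h1
    simp only [Real.rpow_natCast] at *
    linarith
  by_contra hcon
  push Not at hcon
  -- an open set where W is large
  obtain ⟨A, hA1, hA2⟩ := exists_between hcon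
  set y₀ : ℝ × ℝ := (Int.fract x₀.1, Int.fract x₀.2) with hy₀
  have hWy : A < W T y₀ := by rw [hy₀, per_fract (h.per T hT)]; exact hA2
  set O : Set (ℝ × ℝ) := {x | A < W T x} with hO
  have hOo : IsOpen O := isOpen_lt continuous_const (h.c0.sp hT)
  have hpos : 0 < mT O := by
    have hcl : y₀ ∈ closure (Ioo (0:ℝ) 1 ×ˢ Ioo (0:ℝ) 1) := by
      rw [closure_prod_eq, closure_Ioo (by norm_num)]
      exact ⟨⟨Int.fract_nonneg _, (Int.fract_lt_one _).le⟩, ⟨Int.fract_nonneg _, (Int.fract_lt_one _).le⟩⟩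
    obtain ⟨z, hz1, hz2⟩ := mem_closure_iff.1 hcl O hOo hWy
    have hop : IsOpen (O ∩ (Ioo (0:ℝ) 1 ×ˢ Ioo (0:ℝ) 1)) := hOo.inter (isOpen_Ioo.prod isOpen_Ioo)
    have := hop.measure_pos volume ⟨z, hz1, hz2⟩
    rw [mT, Measure.restrict_apply hOo.measurableSet]
    refine this.trans_le (measure_mono ?_)
    exact inter_subset_inter_right _ (prod_mono Ioo_subset_Icc_self Ioo_subset_Icc_self)
  set m := mT.real O with hm
  have hmpos : 0 < m := by
    rw [hm, Measure.real]; exact ENNReal.toReal_pos hpos.ne' (measure_ne_top _ _)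
  have hineq : ∀ n : ℕ, 1 ≤ n → m * A ^ n ≤ B ^ n := by
    intro n hn
    have h1 := step n hn
    simp only [Real.rpow_natCast] at h1
    have hIntg : Integrable (fun x => W T x ^ n) mT := mT_integrable ((h.c0.sp hT).pow n)
    have h2 : ∫ x in O, A ^ n ∂mT ≤ ∫ x in O, W T x ^ n ∂mT := by
      apply setIntegral_mono_on (integrable_const _).integrableOn hIntg.integrableOn hOo.measurableSet
      intro x hx
      have : A < W T x := hx
      have hA0 : 0 ≤ A := by linarith
      gcongr
    have h3 : ∫ x in O, W T x ^ n ∂mT ≤ ∫ x, W T x ^ n ∂mT := by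
      apply setIntegral_le_integral hIntg
      exact Filter.Eventually.of_forall fun x => pow_nonneg (h.pos T hT x).le n
    rw [setIntegral_const, smul_eq_mul] at h2
    linarith
  have hr : 1 < A / B := (one_lt_div hB0).2 hA1
  obtain ⟨n, hn⟩ := pow_unbounded_of_one_lt (1 / m) hr
  have hn2 : 1 / m < (A / B) ^ (n + 1) := hn.trans_le (pow_le_pow_right₀ hr.le (Nat.le_succ n))
  have := hineq (n + 1) (by omega)
  rw [div_pow, div_lt_div_iff₀ hmpos (by positivity)] at hn2
  linarith

end

end KP

set_option linter.all false
open MeasureTheory Set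
namespace KP

noncomputable section

/-- heat extension with `j` derivatives and mass `1/2` -/
def U (ω : ℝ × ℝ) (S : Finset (ℤ × ℤ)) (c : ℤ × ℤ → ℂ) (j : ℕ) (t : ℝ) (x : ℝ × ℝ) : ℂ :=
  ∑ n ∈ S, c n * (Complex.I * fr ω n) ^ j * (Real.exp (-(t * (fr ω n ^ 2 + 1 / 2))) : ℝ) * ch n x

lemma U_zero (ω : ℝ × ℝ) (S : Finset (ℤ × ℤ)) (c : ℤ × ℤ → ℂ) (x : ℝ × ℝ) :
    U ω S c 0 0 x = P S c x := by simp [U, P]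

lemma U_cont (ω : ℝ × ℝ) (S : Finset (ℤ × ℤ)) (c : ℤ × ℤ → ℂ) (j : ℕ) :
    Continuous (fun z : ℝ × (ℝ × ℝ) => U ω S c j z.1 z.2) := by
  unfold U
  refine continuous_finsetSum _ fun n _ => ?_
  have h1 : Continuous (fun z : ℝ × (ℝ × ℝ) => ch n z.2) := (ch_cont n).comp continuous_snd
  have h2 : Continuous (fun z : ℝ × (ℝ × ℝ) =>
      ((Real.exp (-(z.1 * (fr ω n ^ 2 + 1 / 2))) : ℝ) : ℂ)) := by fun_prop
  exact (continuous_const.mul h2).mul h1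

lemma U_per (ω : ℝ × ℝ) (S : Finset (ℤ × ℤ)) (c : ℤ × ℤ → ℂ) (j : ℕ) (t : ℝ) :
    Per (U ω S c j t) := by
  have := P_per S (fun n => c n * (Complex.I * fr ω n) ^ j * (Real.exp (-(t * (fr ω n ^ 2 + 1 / 2))) : ℝ))
  exact this

lemma U_dt (ω : ℝ × ℝ) (S : Finset (ℤ × ℤ)) (c : ℤ × ℤ → ℂ) (j : ℕ) (t : ℝ) (x : ℝ × ℝ) :
    HasDerivAt (fun t => U ω S c j t x) (U ω S c (j + 2) t x - 1 / 2 * U ω S c j t x) t := by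
  unfold U
  rw [Finset.mul_sum, ← Finset.sum_sub_distrib]
  refine HasDerivAt.fun_sum fun n _ => ?_
  have h1 : HasDerivAt (fun t : ℝ => Real.exp (-(t * (fr ω n ^ 2 + 1 / 2))))
      (Real.exp (-(t * (fr ω n ^ 2 + 1 / 2))) * (-(1 * (fr ω n ^ 2 + 1 / 2)))) t :=
    (((hasDerivAt_id t).mul_const _).neg).exp
  have h2 := ((h1.ofReal_comp).const_mul (c n * (Complex.I * fr ω n) ^ j)).mul_const (ch n x)
  refine h2.congr_deriv ?_
  push_cast
  have : (Complex.I * (fr ω n : ℂ)) ^ (j + 2) = -((Complex.I * fr ω n) ^ j * fr ω n ^ 2) := by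
    rw [pow_add, mul_pow Complex.I _ 2, Complex.I_sq]; ring
  rw [this]; ring

lemma U_d1 (ω : ℝ × ℝ) (S : Finset (ℤ × ℤ)) (c : ℤ × ℤ → ℂ) (j : ℕ) (t : ℝ) (x : ℝ × ℝ) :
    HasDerivAt (fun σ => U ω S c j t (x + fl ω σ)) (U ω S c (j + 1) t x) 0 := by
  unfold U
  refine HasDerivAt.fun_sum fun n _ => ?_
  have h1 : HasDerivAt (fun σ : ℝ => Complex.exp (Complex.I * fr ω n * σ))
      (Complex.exp (Complex.I * fr ω n * (0:ℝ)) * (Complex.I * fr ω n * 1)) 0 := by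
    refine HasDerivAt.cexp ?_
    exact (((hasDerivAt_id (0:ℝ)).ofReal_comp).const_mul _).congr_deriv (by simp)
  have h2 := (h1.const_mul (ch n x)).const_mul
    (c n * (Complex.I * fr ω n) ^ j * (Real.exp (-(t * (fr ω n ^ 2 + 1 / 2))) : ℝ))
  have e : (fun σ : ℝ => c n * (Complex.I * fr ω n) ^ j *
      (Real.exp (-(t * (fr ω n ^ 2 + 1 / 2))) : ℝ) * ch n (x + fl ω σ)) = fun σ : ℝ =>
      c n * (Complex.I * fr ω n) ^ j * (Real.exp (-(t * (fr ω n ^ 2 + 1 / 2))) : ℝ) *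
      (ch n x * Complex.exp (Complex.I * fr ω n * σ)) := by
    funext σ; rw [ch_add, ch_fl]
  rw [e]
  refine h2.congr_deriv ?_
  simp; ring

lemma hda_re {f : ℝ → ℂ} {f' : ℂ} {t : ℝ} (h : HasDerivAt f f' t) :
    HasDerivAt (fun t => (f t).re) f'.re t :=
  Complex.reCLM.hasFDerivAt.comp_hasDerivAt t h
lemma hda_im {f : ℝ → ℂ} {f' : ℂ} {t : ℝ} (h : HasDerivAt f f' t) :
    HasDerivAt (fun t => (f t).im) f'.im t :=
  Complex.imCLM.hasFDerivAt.comp_hasDerivAt t h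

/-- real inner product on complex numbers -/
def ip (a b : ℂ) : ℝ := a.re * b.re + a.im * b.im

lemma hda_ip {f g : ℝ → ℂ} {f' g' : ℂ} {t : ℝ} (h : HasDerivAt f f' t) (h2 : HasDerivAt g g' t) :
    HasDerivAt (fun t => ip (f t) (g t)) (ip f' (g t) + ip (f t) g') t := by
  have := ((hda_re h).fun_mul (hda_re h2)).fun_add ((hda_im h).fun_mul (hda_im h2))
  exact this.congr_deriv (by unfold ip; ring)

lemma ip_self (a : ℂ) : ip a a = ‖a‖ ^ 2 := by
  rw [← Complex.normSq_eq_norm_sq, Complex.normSq_apply]; rfl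
lemma ip_comm (a b : ℂ) : ip a b = ip b a := by unfold ip; ring
lemma ip_sq (a b : ℂ) : ip a b ^ 2 ≤ ip a a * ip b b := by
  unfold ip; nlinarith [sq_nonneg (a.re * b.im - a.im * b.re)]
lemma ip_nn (a : ℂ) : 0 ≤ ip a a := by rw [ip_self]; positivity
lemma ip_cont {X : Type*} [TopologicalSpace X] {f g : X → ℂ} (hf : Continuous f) (hg : Continuous g) :
    Continuous (fun x => ip (f x) (g x)) := by
  unfold ip
  exact ((Complex.continuous_re.comp hf).mul (Complex.continuous_re.comp hg)).add
    ((Complex.continuous_im.comp hf).mul (Complex.continuous_im.comp hg))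

/-- generic recursion -/
def rec1 (b : ℕ → ℝ) : ℕ → ℕ → ℝ
  | 0, j => b j
  | k + 1, j => rec1 b k (j + 1) + 1 / 2 * rec1 b k j

def Th (ω : ℝ × ℝ) (S : Finset (ℤ × ℤ)) (c : ℤ × ℤ → ℂ) (k j : ℕ) (t : ℝ) (x : ℝ × ℝ) : ℝ :=
  rec1 (fun j => ip (U ω S c j t x) (U ω S c j t x)) k j
def Th1 (ω : ℝ × ℝ) (S : Finset (ℤ × ℤ)) (c : ℤ × ℤ → ℂ) (k j : ℕ) (t : ℝ) (x : ℝ × ℝ) : ℝ :=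
  rec1 (fun j => 2 * ip (U ω S c j t x) (U ω S c (j + 1) t x)) k j
def Th2 (ω : ℝ × ℝ) (S : Finset (ℤ × ℤ)) (c : ℤ × ℤ → ℂ) (k j : ℕ) (t : ℝ) (x : ℝ × ℝ) : ℝ :=
  rec1 (fun j => 2 * ip (U ω S c (j + 1) t x) (U ω S c (j + 1) t x) +
    2 * ip (U ω S c j t x) (U ω S c (j + 2) t x)) k j

lemma rec1_nn {b : ℕ → ℝ} (hb : ∀ j, 0 ≤ b j) (k j : ℕ) : 0 ≤ rec1 b k j := by
  induction k generalizing j with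
  | zero => exact hb j
  | succ k ih => have := ih (j + 1); have := ih j; simp only [rec1]; linarith

lemma rec1_le {b : ℕ → ℝ} (hb : ∀ j, 0 ≤ b j) (k j : ℕ) : rec1 b k j ≤ rec1 b (k + j) 0 := by
  induction j generalizing k with
  | zero => exact le_rfl
  | succ j ih =>
    have h1 := ih (k + 1)
    have h2 := rec1_nn hb k j
    simp only [rec1] at h1
    rw [show k + (j + 1) = k + 1 + j by ring]
    linarith

lemma rec1_mono {b : ℕ → ℝ} (hb : ∀ j, 0 ≤ b j) {j n : ℕ} (h : j ≤ n) :
    rec1 b j 0 ≤ 2 ^ (n - j) * rec1 b n 0 := by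
  induction n, h using Nat.le_induction with
  | base => simp
  | succ n hn ih =>
    have h2 := rec1_nn hb n (0 + 1)
    rw [show n + 1 - j = (n - j) + 1 by omega, pow_succ]
    have h3 : rec1 b n 0 ≤ 2 * rec1 b (n + 1) 0 := by simp only [rec1]; linarith
    calc _ ≤ _ := ih
      _ ≤ 2 ^ (n - j) * (2 * rec1 b (n + 1) 0) := by gcongr
      _ = _ := by ring

lemma le_of_sq_le {a b : ℝ} (h : a ^ 2 ≤ b ^ 2) (hb : 0 ≤ b) : a ≤ b :=
  (le_abs_self a).trans (by simpa [abs_of_nonneg hb] using sq_le_sq.1 h)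

lemma cs2 {a b c a' b' c' : ℝ} (hb : 0 ≤ b) (hc : 0 ≤ c) (hb' : 0 ≤ b') (hc' : 0 ≤ c')
    (h : a ^ 2 ≤ 4 * (b * c)) (h' : a' ^ 2 ≤ 4 * (b' * c')) :
    (a + a') ^ 2 ≤ 4 * ((b + b') * (c + c')) := by
  have h3 : a * a' ≤ 2 * (b * c' + b' * c) := by
    refine le_of_sq_le ?_ (by positivity)
    calc (a * a') ^ 2 = a ^ 2 * a' ^ 2 := by ring
      _ ≤ (4 * (b * c)) * (4 * (b' * c')) := by gcongr
      _ ≤ _ := by nlinarith [sq_nonneg (b * c' - b' * c)]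
  nlinarith

lemma rec1_cs {b d : ℕ → ℝ} (hb : ∀ j, 0 ≤ b j) (h : ∀ j, d j ^ 2 ≤ 4 * (b j * b (j + 1)))
    (k j : ℕ) : rec1 d k j ^ 2 ≤ 4 * (rec1 b k j * rec1 b k (j + 1)) := by
  induction k generalizing j with
  | zero => exact h j
  | succ k ih =>
    have h1 := ih j
    have h2 := ih (j + 1)
    have hh : (1 / 2 * rec1 d k j) ^ 2 ≤ 4 * ((1 / 2 * rec1 b k j) * (1 / 2 * rec1 b k (j + 1))) := by
      nlinarith
    exact cs2 (rec1_nn hb _ _) (rec1_nn hb _ _) (by have := rec1_nn hb k j; positivity)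
      (by have := rec1_nn hb k (j + 1); positivity) h2 hh

lemma rec1_lin {b d e : ℕ → ℝ} (h : ∀ j, b j = d j - e j) (k j : ℕ) :
    rec1 b k j = rec1 d k j - rec1 e k j := by
  induction k generalizing j with
  | zero => exact h j
  | succ k ih => simp only [rec1, ih]; ring

lemma rec1_shift {b e : ℕ → ℝ} (h : ∀ j, e j = 2 * (b (j + 1) + 1 / 2 * b j)) (k j : ℕ) :
    rec1 e k j = 2 * rec1 b (k + 1) j := by
  induction k generalizing j with
  | zero => exact h j
  | succ k ih => rw [rec1, ih, ih]; simp only [rec1]; ring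

lemma rec1_der {b : ℝ → ℕ → ℝ} {b' : ℕ → ℝ} {t : ℝ} (h : ∀ j, HasDerivAt (fun t => b t j) (b' j) t)
    (k j : ℕ) : HasDerivAt (fun t => rec1 (b t) k j) (rec1 b' k j) t := by
  induction k generalizing j with
  | zero => exact h j
  | succ k ih => exact (ih (j + 1)).fun_add ((ih j).const_mul (1 / 2))

lemma rec1_cont {X : Type*} [TopologicalSpace X] {b : X → ℕ → ℝ} (h : ∀ j, Continuous (fun t => b t j))
    (k j : ℕ) : Continuous (fun t => rec1 (b t) k j) := by
  induction k generalizing j with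
  | zero => exact h j
  | succ k ih => exact (ih (j + 1)).add ((ih j).const_mul (1 / 2))

section
variable (ω : ℝ × ℝ) (S : Finset (ℤ × ℤ)) (c : ℤ × ℤ → ℂ)

lemma Th_nn (k j : ℕ) (t : ℝ) (x : ℝ × ℝ) : 0 ≤ Th ω S c k j t x := rec1_nn (fun j => ip_nn _) k j

lemma Th_cont (k j : ℕ) : Continuous (fun z : ℝ × (ℝ × ℝ) => Th ω S c k j z.1 z.2) :=
  rec1_cont (fun j => ip_cont (U_cont ω S c j) (U_cont ω S c j)) k j
lemma Th1_cont (k j : ℕ) : Continuous (fun z : ℝ × (ℝ × ℝ) => Th1 ω S c k j z.1 z.2) :=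
  rec1_cont (fun j => (ip_cont (U_cont ω S c j) (U_cont ω S c _)).const_mul 2) k j
lemma Th2_cont (k j : ℕ) : Continuous (fun z : ℝ × (ℝ × ℝ) => Th2 ω S c k j z.1 z.2) :=
  rec1_cont (fun j => ((ip_cont (U_cont ω S c _) (U_cont ω S c _)).const_mul 2).add
    ((ip_cont (U_cont ω S c j) (U_cont ω S c _)).const_mul 2)) k j

lemma Th_dt (k : ℕ) (t : ℝ) (x : ℝ × ℝ) : HasDerivAt (fun t => Th ω S c k 0 t x)
    (Th2 ω S c k 0 t x - 2 * Th ω S c (k + 1) 0 t x) t := by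
  have h := rec1_der (b := fun t j => ip (U ω S c j t x) (U ω S c j t x))
    (fun j => hda_ip (U_dt ω S c j t x) (U_dt ω S c j t x)) k 0
  refine h.congr_deriv ?_
  unfold Th2 Th
  rw [← rec1_shift (e := fun j => 2 * (ip (U ω S c (j + 1) t x) (U ω S c (j + 1) t x) +
    1 / 2 * ip (U ω S c j t x) (U ω S c j t x))) (fun j => rfl)]
  apply rec1_lin
  intro j
  unfold ip
  simp
  ring

lemma Th_d1 (k : ℕ) (t : ℝ) : FD ω (Th ω S c k 0 t) (Th1 ω S c k 0 t) := by
  intro x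
  refine rec1_der (b := fun σ j => ip (U ω S c j t (x + fl ω σ)) (U ω S c j t (x + fl ω σ)))
    (fun j => (hda_ip (U_d1 ω S c j t x) (U_d1 ω S c j t x)).congr_deriv ?_) k 0
  simp only [fl_zero, add_zero]
  unfold ip; ring

lemma Th_d2 (k : ℕ) (t : ℝ) : FD ω (Th1 ω S c k 0 t) (Th2 ω S c k 0 t) := by
  intro x
  refine rec1_der (b := fun σ j => 2 * ip (U ω S c j t (x + fl ω σ)) (U ω S c (j + 1) t (x + fl ω σ)))
    (fun j => ((hda_ip (U_d1 ω S c j t x) (U_d1 ω S c (j + 1) t x)).const_mul 2).congr_deriv ?_) k 0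
  simp only [fl_zero, add_zero]
  unfold ip; ring

lemma Th_grad (k : ℕ) (t : ℝ) (x : ℝ × ℝ) :
    Th1 ω S c k 0 t x ^ 2 ≤ 4 * (Th ω S c k 0 t x * Th ω S c (k + 1) 0 t x) := by
  have h := rec1_cs (b := fun j => ip (U ω S c j t x) (U ω S c j t x))
    (d := fun j => 2 * ip (U ω S c j t x) (U ω S c (j + 1) t x)) (fun j => ip_nn _)
    (fun j => by have := ip_sq (U ω S c j t x) (U ω S c (j + 1) t x); nlinarith) k 0
  refine h.trans ?_
  have h1 := Th_nn ω S c k 0 t x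
  have h2 : rec1 (fun j => ip (U ω S c j t x) (U ω S c j t x)) k (0 + 1) ≤ Th ω S c (k + 1) 0 t x := by
    unfold Th at *
    simp only [rec1]; linarith
  unfold Th at *
  gcongr

lemma Th_per (k : ℕ) (t : ℝ) : Per (Th ω S c k 0 t) := by
  intro x
  unfold Th
  constructor <;> congr 1 <;> funext j
  · rw [((U_per ω S c j t) x).1]
  · rw [((U_per ω S c j t) x).2]

lemma Th_U (j : ℕ) (t : ℝ) (x : ℝ × ℝ) : ‖U ω S c j t x‖ ^ 2 ≤ Th ω S c j 0 t x := by
  have := rec1_le (b := fun j => ip (U ω S c j t x) (U ω S c j t x)) (fun j => ip_nn _) 0 j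
  simp only [zero_add, rec1, ip_self] at this
  simpa only [Th, ip_self] using this

lemma Th_mono {j n : ℕ} (h : j ≤ n) (t : ℝ) (x : ℝ × ℝ) :
    Th ω S c j 0 t x ≤ 2 ^ (n - j) * Th ω S c n 0 t x := rec1_mono (fun j => ip_nn _) h

/-- The heat subsolution. -/
lemma heat {δ : ℝ} (hδ : 0 < δ) (hδ2 : δ ≤ 1) (K : ℕ) : ∃ W W1 W2 N : ℝ → ℝ × ℝ → ℝ,
    (∀ ε, 0 < ε → SubSol ω (4 / (2 - δ)) (fun t x => ε + W t x) W1 W2 N) ∧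
    (∀ x, W 0 x = ‖P S c x‖ ^ 2) ∧ (∀ t, 0 ≤ t → ∀ x, 0 ≤ W t x) ∧
    (∀ k ≤ K, ∀ t, 0 ≤ t → ∀ x, δ ^ k / k.factorial * (t ^ k * Th ω S c k 0 t x) ≤ W t x) ∧
    (∀ k ≤ K, ∀ t, 0 ≤ t → ∀ x, δ ^ k / k.factorial * (t ^ k * Th ω S c (k + 1) 0 t x) ≤ N t x) := by
  set a : ℕ → ℝ := fun k => δ ^ k / k.factorial with ha
  have ha0 : ∀ k, 0 < a k := fun k => by positivity
  have ha1 : ∀ k : ℕ, a (k + 1) * ((k:ℝ) + 1) = δ * a k := fun k => by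
    simp only [ha, Nat.factorial_succ]; push_cast; field_simp; ring
  set W : ℝ → ℝ × ℝ → ℝ := fun t x => ∑ k ∈ Finset.range (K + 1), a k * t ^ k * Th ω S c k 0 t x with hW
  set W1 : ℝ → ℝ × ℝ → ℝ := fun t x => ∑ k ∈ Finset.range (K + 1), a k * t ^ k * Th1 ω S c k 0 t x
    with hW1
  set W2 : ℝ → ℝ × ℝ → ℝ := fun t x => ∑ k ∈ Finset.range (K + 1), a k * t ^ k * Th2 ω S c k 0 t x
    with hW2
  set Q : ℝ → ℝ × ℝ → ℝ := fun t x => ∑ k ∈ Finset.range (K + 1), a k * t ^ k * Th ω S c (k + 1) 0 t x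
    with hQ
  set N : ℝ → ℝ × ℝ → ℝ := fun t x => 2 * Q t x -
    δ * ∑ k ∈ Finset.range K, a k * t ^ k * Th ω S c (k + 1) 0 t x with hN
  have hterm : ∀ k i : ℕ, ∀ t, 0 ≤ t → ∀ x, 0 ≤ a k * t ^ k * Th ω S c i 0 t x := fun k i t ht x => by
    have := Th_nn ω S c i 0 t x; have := ha0 k; positivity
  have hW0 : ∀ t, 0 ≤ t → ∀ x, 0 ≤ W t x := fun t ht x => Finset.sum_nonneg fun k _ => hterm k k t ht x
  have hQ0 : ∀ t, 0 ≤ t → ∀ x, 0 ≤ Q t x := fun t ht x => Finset.sum_nonneg fun k _ => hterm k _ t ht x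
  have hNQ : ∀ t, 0 ≤ t → ∀ x, (2 - δ) * Q t x ≤ N t x := fun t ht x => by
    have : ∑ k ∈ Finset.range K, a k * t ^ k * Th ω S c (k + 1) 0 t x ≤ Q t x := by
      simp only [hQ, Finset.sum_range_succ]
      have := hterm K (K + 1) t ht x
      linarith
    have := mul_le_mul_of_nonneg_left this hδ.le
    simp only [hN]; linarith
  have hdt : ∀ t x, HasDerivAt (fun t => W t x) (W2 t x - N t x) t := by
    intro t x
    simp only [hW, hW2, hN, hQ]
    clear hW0 hQ0 hNQ hN hQ hW2 hW1 hW N Q W2 W1 W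
    induction K with
    | zero =>
      simp only [zero_add, Finset.sum_range_one, Finset.sum_range_zero, pow_zero, mul_one]
      exact ((Th_dt ω S c 0 t x).const_mul (a 0)).congr_deriv (by ring)
    | succ K ih =>
      simp only [Finset.sum_range_succ _ (K + 1), Finset.sum_range_succ _ K] at ih ⊢
      have h1 := (((hasDerivAt_id t).fun_pow (K + 1)).const_mul (a (K + 1))).fun_mul
        (Th_dt ω S c (K + 1) t x)
      refine (ih.fun_add h1).congr_deriv ?_
      have := ha1 K
      simp only [id, Nat.cast_add, Nat.cast_one, mul_one, Nat.add_sub_cancel] at *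
      linear_combination (t ^ K * Th ω S c (K + 1) 0 t x) * this
  have hcT : ∀ k : ℕ, ∀ {v : ℝ → ℝ × ℝ → ℝ}, Continuous (fun z : ℝ × (ℝ × ℝ) => v z.1 z.2) →
      Continuous (fun z : ℝ × (ℝ × ℝ) => a k * z.1 ^ k * v z.1 z.2) := fun k v hv => by fun_prop
  refine ⟨W, W1, W2, N, fun ε hε => ?_, ?_, hW0, ?_, ?_⟩
  · exact {
      pos := fun t ht x => by have := hW0 t ht x; linarith
      N0 := fun t ht x => le_trans (mul_nonneg (by linarith) (hQ0 t ht x)) (hNQ t ht x)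
      dt := fun t ht x => (hdt t x).const_add ε
      d1 := fun t ht => by
        have := FD.sum (ω := ω) (Finset.range (K + 1)) (fun k _ => (Th_d1 ω S c k t).cmul (a k * t ^ k))
        have h2 := (FD.const (ω := ω) ε).add this
        simpa only [zero_add] using h2
      d2 := fun t ht => FD.sum (ω := ω) (Finset.range (K + 1))
        (fun k _ => (Th_d2 ω S c k t).cmul (a k * t ^ k))
      grad := fun t ht x => by
        have h1 : ∀ L : ℕ, (∑ k ∈ Finset.range L, a k * t ^ k * Th1 ω S c k 0 t x) ^ 2 ≤
            4 * ((∑ k ∈ Finset.range L, a k * t ^ k * Th ω S c k 0 t x) *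
              ∑ k ∈ Finset.range L, a k * t ^ k * Th ω S c (k + 1) 0 t x) := by
          intro L
          induction L with
          | zero => simp
          | succ L ih =>
            simp only [Finset.sum_range_succ]
            refine cs2 (Finset.sum_nonneg fun k _ => hterm k k t ht x)
              (Finset.sum_nonneg fun k _ => hterm k _ t ht x) (hterm L L t ht x) (hterm L _ t ht x) ih ?_
            have := mul_le_mul_of_nonneg_left (Th_grad ω S c L t x) (sq_nonneg (a L * t ^ L))
            linarith
        refine (h1 (K + 1)).trans ?_
        have h2 : Q t x ≤ N t x / (2 - δ) := by
          rw [le_div_iff₀ (by linarith)]; have := hNQ t ht x; linarith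
        calc 4 * (W t x * Q t x) ≤ 4 * ((ε + W t x) * (N t x / (2 - δ))) := by
              have := hW0 t ht x; have := hQ0 t ht x; gcongr; linarith
          _ = _ := by ring
      c0 := (continuous_const.add (continuous_finsetSum _ fun k _ => hcT k (Th_cont ω S c k 0))).continuousOn
      c1 := (continuous_finsetSum _ fun k _ => hcT k (Th1_cont ω S c k 0)).continuousOn
      c2 := (continuous_finsetSum _ fun k _ => hcT k (Th2_cont ω S c k 0)).continuousOn
      cN := (((continuous_finsetSum _ fun k _ => hcT k (Th_cont ω S c (k + 1) 0)).const_mul 2).sub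
        ((continuous_finsetSum _ fun k _ => hcT k (Th_cont ω S c (k + 1) 0)).const_mul δ)).continuousOn
      per := fun t ht x => by
        have h := fun k => Th_per ω S c k t x
        simp only [hW, fun k => (h k).1, fun k => (h k).2]
        exact ⟨trivial, trivial⟩ }
  · intro x
    simp only [hW, Finset.sum_range_succ']
    simp [ha, Th, rec1, U_zero, ip_self]
  · intro k hk t ht x
    have := Finset.single_le_sum (f := fun k => a k * t ^ k * Th ω S c k 0 t x)
      (fun k _ => hterm k k t ht x) (Finset.mem_range.2 (Nat.lt_succ_of_le hk))
    simp only [mul_assoc] at this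
    simp only [hW, mul_assoc]
    exact this
  · intro k hk t ht x
    have := Finset.single_le_sum (f := fun k => a k * t ^ k * Th ω S c (k + 1) 0 t x)
      (fun k _ => hterm k _ t ht x) (Finset.mem_range.2 (Nat.lt_succ_of_le hk))
    have h2 := hNQ t ht x
    have h3 : Q t x ≤ (2 - δ) * Q t x := by nlinarith [hQ0 t ht x]
    simp only [mul_assoc] at this
    simp only [hQ, mul_assoc] at *
    linarith
end

end

end KP

set_option linter.all false
open MeasureTheory Set
namespace KP

noncomputable section

/-- square function atoms -/
def Sq (ω : ℝ × ℝ) (S : Finset (ℤ × ℤ)) (c : ℤ × ℤ → ℂ) (k : ℕ) (z : ℝ) (x : ℝ × ℝ) : ℝ :=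
  Real.sqrt (z ^ k * Th ω S c k 0 z x)

lemma Sq_nn (ω S c k z x) : 0 ≤ Sq ω S c k z x := Real.sqrt_nonneg _

lemma Sq_cont (ω S c k) : Continuous (fun z : ℝ × (ℝ × ℝ) => Sq ω S c k z.1 z.2) :=
  Real.continuous_sqrt.comp ((continuous_fst.pow k).mul (Th_cont ω S c k 0))

lemma Sq_sq (ω S c k) {z : ℝ} (hz : 0 ≤ z) (x) : Sq ω S c k z x ^ 2 = z ^ k * Th ω S c k 0 z x :=
  Real.sq_sqrt (mul_nonneg (pow_nonneg hz k) (Th_nn _ _ _ _ _ _ _))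

lemma pw_bd {y θ : ℝ} (hy : 0 ≤ y) (hθ : 0 < θ) : (1 + y ^ 2) ^ θ ≤ 2 ^ θ * (1 + y ^ (2 * θ)) := by
  have e : y ^ (2 * θ) = (y ^ 2) ^ θ := by rw [Real.rpow_mul hy]; norm_num
  rw [e]
  rcases le_total (y ^ 2) 1 with h | h
  · calc (1 + y ^ 2) ^ θ ≤ 2 ^ θ := Real.rpow_le_rpow (by positivity) (by linarith) hθ.le
      _ ≤ _ := le_mul_of_one_le_right (by positivity) (by
        have : 0 ≤ (y ^ 2) ^ θ := by positivity
        linarith)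
  · calc (1 + y ^ 2) ^ θ ≤ (2 * y ^ 2) ^ θ := Real.rpow_le_rpow (by positivity) (by linarith) hθ.le
      _ = 2 ^ θ * (y ^ 2) ^ θ := Real.mul_rpow (by norm_num) (by positivity)
      _ ≤ _ := by gcongr; linarith

lemma int_bd {u : ℝ × ℝ → ℂ} (hu : Continuous u) {θ r : ℝ} (hθ : 0 < θ) (hr : 2 * θ = r)
    (h : ∫ x, ‖u x‖ ^ r ∂mT ≤ 1) :
    ∫ x, (1 + ‖u x‖ ^ 2) ^ θ ∂mT ≤ 2 * 2 ^ θ := by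
  have hc : Continuous (fun x => ‖u x‖ ^ r) :=
    hu.norm.rpow_const fun x => Or.inr (by linarith)
  have hi := mT_integrable hc
  calc _ ≤ ∫ x, 2 ^ θ * (1 + ‖u x‖ ^ r) ∂mT := by
        apply integral_mono _ (((integrable_const _).add hi).const_mul _)
        · intro x; have := pw_bd (norm_nonneg (u x)) hθ; rw [hr] at this; exact this
        · exact mT_integrable ((continuous_const.add (hu.norm.pow 2)).rpow_const fun x =>
            Or.inr hθ.le)
    _ = 2 ^ θ * (1 + ∫ x, ‖u x‖ ^ r ∂mT) := by
        rw [integral_const_mul, integral_add (integrable_const _) hi]; simp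
    _ ≤ _ := by
        have : (0:ℝ) < 2 ^ θ := by positivity
        nlinarith

lemma lint_add {f g : ℝ → ℝ × ℝ → ℝ} (hf : Cts f) :
    ∫⁻ t in Ioi (0:ℝ), ∫⁻ x, ENNReal.ofReal (f t x + g t x) ∂mT ≤
    (∫⁻ t in Ioi (0:ℝ), ∫⁻ x, ENNReal.ofReal (f t x) ∂mT) +
    ∫⁻ t in Ioi (0:ℝ), ∫⁻ x, ENNReal.ofReal (g t x) ∂mT := by
  have h1 : ∀ t, 0 < t → ∫⁻ x, ENNReal.ofReal (f t x + g t x) ∂mT ≤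
      ∫⁻ x, ENNReal.ofReal (f (max t 0) x) ∂mT + ∫⁻ x, ENNReal.ofReal (g t x) ∂mT := by
    intro t ht
    rw [max_eq_left ht.le, ← lintegral_add_left (hf.sp ht.le).measurable.ennreal_ofReal]
    exact lintegral_mono fun x => ENNReal.ofReal_add_le
  have h2 : Measurable (fun t => ∫⁻ x, ENNReal.ofReal (f (max t 0) x) ∂mT) :=
    Measurable.lintegral_prod_right' (f := fun z : ℝ × (ℝ × ℝ) => ENNReal.ofReal (f (max z.1 0) z.2))
      hf.max.measurable.ennreal_ofReal
  calc _ ≤ ∫⁻ t in Ioi (0:ℝ), (∫⁻ x, ENNReal.ofReal (f (max t 0) x) ∂mT +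
        ∫⁻ x, ENNReal.ofReal (g t x) ∂mT) := setLIntegral_mono' measurableSet_Ioi h1
    _ = _ := by
      rw [lintegral_add_left h2]
      congr 1
      refine setLIntegral_congr_fun (measurableSet_Ioi (a := (0:ℝ))) fun t ht => ?_
      simp only [max_eq_left (le_of_lt (mem_Ioi.1 ht))]

set_option maxHeartbeats 2000000 in
lemma base {p q : ℝ} (hp : 2 ≤ p) (hq1 : 1 < q) (hq2 : q ≤ 2) (hpq : 1 / p + 1 / q = 1) :
    ∃ C κ : ℝ, 0 < C ∧ 0 ≤ κ ∧ 4 / (3 - q) ≤ κ ∧ ∀ K : ℕ, ∀ ω S₁ c₁ S₃ c₃,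
    ∫ x, ‖P S₁ c₁ x‖ ^ p ∂mT ≤ 1 → ∫ x, ‖P S₃ c₃ x‖ ^ q ∂mT ≤ 1 →
    ∀ ρ₁ ρ₃ : ℝ, 1 ≤ ρ₁ → 1 ≤ ρ₃ → ∃ E N V NV w1 w2 Nw : ℝ → ℝ × ℝ → ℝ,
    (∫⁻ t in Ioi (0:ℝ), ∫⁻ x, ENNReal.ofReal (ρ₁ * (E t x ^ (2 / q - 1) * N t x) +
      4 * ρ₁ * ρ₃ * (ρ₃ * (V t x ^ (q / 2 - 1) * NV t x))) ∂mT ≤ ENNReal.ofReal C) ∧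
    (∀ t, 0 ≤ t → ∀ x, 0 < V t x ∧ V t x ^ (q / 2) ≤ E t x ∧ 0 ≤ N t x ∧ 0 ≤ NV t x) ∧
    (∀ k ≤ K, ∀ t, 0 ≤ t → ∀ x, (q - 1) ^ k / k.factorial * ((ρ₁ * t) ^ k *
      Th ω S₁ c₁ (k + 1) 0 (ρ₁ * t) x) ≤ N t x) ∧
    (∀ k ≤ K, ∀ t, 0 ≤ t → ∀ x, (4 * ρ₁ * ρ₃) ^ (-(2 / q)) * ((q - 1) ^ k / k.factorial * ((ρ₃ * t) ^ k *
      Th ω S₃ c₃ (k + 1) 0 (ρ₃ * t) x)) ≤ NV t x) ∧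
    (∀ t, 0 ≤ t → ∀ x, (4 * ρ₁ * ρ₃) ^ (-(2 / q)) * Th ω S₃ c₃ 0 0 (ρ₃ * t) x ≤ V t x) ∧
    Sp ω κ ρ₃ (fun t x => V t x ^ (q / 2)) w1 w2 Nw ∧
    (∫ x, V 0 x ^ (q / 2) ∂mT ≤ C) := by
  have hq0 : 0 < q := by linarith
  have hp0 : 0 < p := by linarith
  set κ := 4 / (3 - q) with hκ
  have hκ0 : 0 < κ := by have : 0 < 3 - q := by linarith
                         positivity
  set η := (q - 1) / (3 - q) with hη
  have hη0 : 0 < η := div_pos (by linarith) (by linarith)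
  have hη1 : η ≤ 1 := by rw [hη, div_le_one (by linarith)]; linarith
  set κ' := κ + p / 2 * κ / 1 + q / 2 * κ / η with hκ'
  have hκ'0 : 0 ≤ κ' := by positivity
  set A := 4 * κ' ^ 2 + 2 * κ' + 2 with hA
  have hA0 : 0 < A := by positivity
  set B : ℝ := A * (2 * 2 ^ (p / 2) + 2 * 2 ^ (q / 2)) with hB
  have hB0 : 0 < B := by positivity
  have hα : 2 / q - 1 = 1 - 2 / p := by
    have : 2 / q = 2 * (1 / q) := by ring
    have h2 : 2 / p = 2 * (1 / p) := by ring
    rw [this, h2]; linarith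
  set m : ℝ := min (1 / 2) (η * (q / 2)) with hm
  have hm0 : 0 < m := by rw [hm]; positivity
  refine ⟨B / m + 2 * 2 ^ (q / 2), κ', by positivity, hκ'0, ?_, ?_⟩
  · have : 0 ≤ p / 2 * κ / 1 + q / 2 * κ / η := by positivity
    rw [hκ']; linarith
  intro K ω S₁ c₁ S₃ c₃ hF hh ρ₁ ρ₃ h1 h3
  have hκe : 4 / (2 - (q - 1)) = κ := by rw [hκ]; congr 1; ring
  obtain ⟨W, W1, W2, N, sF, W0, Wnn, Wk, Nk⟩ := heat ω S₁ c₁ (δ := q - 1) (by linarith) (by linarith) K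
  obtain ⟨V, V1, V2, NV, sV, V0, Vnn, Vk, NVk⟩ := heat ω S₃ c₃ (δ := q - 1) (by linarith) (by linarith) K
  rw [hκe] at sF sV
  replace sF := sF 1 one_pos
  replace sV := sV 1 one_pos
  set R := 4 * ρ₁ * ρ₃ with hR
  have hR0 : 0 < R := by positivity
  set l := R ^ (-(2 / q)) with hl
  have hl0 : 0 < l := by positivity
  have hlR : l ^ (q / 2) = R⁻¹ := by
    rw [hl, ← Real.rpow_mul hR0.le, show -(2 / q) * (q / 2) = -1 by field_simp, Real.rpow_neg_one]
  replace sV := sV.smul hl0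
  obtain ⟨Ne, se, -⟩ := sF.rpow hκ0.le (θ := p / 2) (η := 1) (by linarith) one_pos le_rfl
    (by nlinarith)
  obtain ⟨Nw, sw, hNw⟩ := sV.rpow hκ0.le (θ := q / 2) (η := η) (by linarith) hη0 hη1 (by
    have h3q : (3 - q) ≠ 0 := by linarith
    rw [hκ, hη]; apply le_of_eq; field_simp; ring)
  have hr1 : 0 < ρ₁ := by linarith
  have hr3 : 0 < ρ₃ := by linarith
  have hm1 := sF.speed (κ' := κ') (by
    have : 0 ≤ p / 2 * κ / 1 + q / 2 * κ / η := by positivity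
    rw [hκ']; linarith) hr1
  have hm2 := se.speed (κ' := κ') (by
    have : 0 ≤ q / 2 * κ / η := by positivity
    rw [hκ']; linarith) hr1
  have hm3 := sw.speed (κ' := κ') (by
    have : 0 ≤ p / 2 * κ / 1 := by positivity
    rw [hκ']; linarith) hr3
  have bb := bell1 (α := 2 / q - 1) (R := R) hm1 hm2 hm3 (by
      rw [sub_nonneg, le_div_iff₀ hq0]; linarith) (by
      rw [sub_le_iff_le_add, div_le_iff₀ hq0]; linarith) hκ'0 hr1 hr3 (by
      intro t ht x
      have := (sF.pos (ρ₁ * t) (by positivity) x)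
      rw [← Real.rpow_mul this.le, show p / 2 * (1 - (2 / q - 1)) = 1 by rw [hα]; field_simp; ring,
        Real.rpow_one]) (by
      rw [hR]
      have h13 : ρ₁ + ρ₃ ≤ 2 * (ρ₁ * ρ₃) := by nlinarith
      calc (ρ₁ + ρ₃) ^ 2 ≤ (2 * (ρ₁ * ρ₃)) ^ 2 := by gcongr
        _ = _ := by ring)
  simp only [mul_zero] at bb
  have iF := int_bd (P_cont S₁ c₁) (θ := p / 2) (by linarith) (by ring) hF
  have ih := int_bd (P_cont S₃ c₃) (θ := q / 2) (by linarith) (by ring) hh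
  have eh : ∫ x, (l * (1 + V 0 x)) ^ (q / 2) ∂mT = R⁻¹ * ∫ x, (1 + ‖P S₃ c₃ x‖ ^ 2) ^ (q / 2) ∂mT := by
    rw [← integral_const_mul]
    congr 1; funext x
    rw [V0, Real.mul_rpow hl0.le (by positivity), hlR]
  have bb2 : A * ((∫ x, (1 + W 0 x) ^ (p / 2) ∂mT) + R * ∫ x, (l * (1 + V 0 x)) ^ (q / 2) ∂mT) ≤ B := by
    rw [eh]
    simp only [W0]
    rw [hB, ← mul_assoc R, mul_inv_cancel₀ hR0.ne', one_mul]
    gcongr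
  refine ⟨fun t x => (1 + W (ρ₁ * t) x) ^ (p / 2) + (l * (1 + V (ρ₃ * t) x)) ^ (q / 2),
    fun t => N (ρ₁ * t), fun t x => l * (1 + V (ρ₃ * t) x), fun t x => l * NV (ρ₃ * t) x,
    _, _, _, ?_, ?_, ?_, ?_, ?_, hm3, ?_⟩
  · have hb3 := bb.trans (ENNReal.ofReal_le_ofReal bb2)
    have key : ∀ t, 0 < t → ∀ x, m * (ρ₁ * (((1 + W (ρ₁ * t) x) ^ (p / 2) +
        (l * (1 + V (ρ₃ * t) x)) ^ (q / 2)) ^ (2 / q - 1) * N (ρ₁ * t) x) +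
        R * (ρ₃ * ((l * (1 + V (ρ₃ * t) x)) ^ (q / 2 - 1) * (l * NV (ρ₃ * t) x)))) ≤
        1 / 2 * (ρ₁ * (((1 + W (ρ₁ * t) x) ^ (p / 2) + (l * (1 + V (ρ₃ * t) x)) ^ (q / 2)) ^
        (2 / q - 1) * N (ρ₁ * t) x)) + R * (ρ₃ * Nw (ρ₃ * t) x) := by
      intro t ht x
      have k1 : 0 ≤ ρ₁ * t := by positivity
      have k3 : 0 ≤ ρ₃ * t := by positivity
      have n1 := hNw (ρ₃ * t) k3 x
      have n2 := sF.N0 _ k1 x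
      have n3 := sV.N0 _ k3 x
      have n4 := sF.pos _ k1 x
      have n5 := sV.pos _ k3 x
      have e1 : m ≤ 1 / 2 := min_le_left _ _
      have e2 : m ≤ η * (q / 2) := min_le_right _ _
      set X := ρ₁ * (((1 + W (ρ₁ * t) x) ^ (p / 2) +
        (l * (1 + V (ρ₃ * t) x)) ^ (q / 2)) ^ (2 / q - 1) * N (ρ₁ * t) x) with hX
      set Y := (l * (1 + V (ρ₃ * t) x)) ^ (q / 2 - 1) * (l * NV (ρ₃ * t) x) with hY
      have hX0 : 0 ≤ X := by rw [hX]; positivity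
      have hY0 : 0 ≤ Y := by rw [hY]; exact mul_nonneg (Real.rpow_nonneg n5.le _) n3
      calc m * (X + R * (ρ₃ * Y)) = m * X + R * (ρ₃ * (m * Y)) := by ring
        _ ≤ 1 / 2 * X + R * (ρ₃ * (η * (q / 2) * Y)) := by gcongr
        _ ≤ 1 / 2 * X + R * (ρ₃ * Nw (ρ₃ * t) x) := by gcongr
    have h5 : ∫⁻ t in Ioi (0:ℝ), ∫⁻ x, ENNReal.ofReal (m * (ρ₁ * (((1 + W (ρ₁ * t) x) ^ (p / 2) +
        (l * (1 + V (ρ₃ * t) x)) ^ (q / 2)) ^ (2 / q - 1) * N (ρ₁ * t) x) +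
        R * (ρ₃ * ((l * (1 + V (ρ₃ * t) x)) ^ (q / 2 - 1) * (l * NV (ρ₃ * t) x))))) ∂mT ≤
        ENNReal.ofReal B := by
      refine le_trans (setLIntegral_mono' measurableSet_Ioi fun t ht => lintegral_mono fun x =>
        ENNReal.ofReal_le_ofReal (key t ht x)) hb3
    simp_rw [ENNReal.ofReal_mul hm0.le] at h5
    simp_rw [lintegral_const_mul' _ _ ENNReal.ofReal_ne_top] at h5
    refine le_trans ?_ (ENNReal.ofReal_le_ofReal (show B / m ≤ _ by
      have : (0:ℝ) ≤ 2 * 2 ^ (q / 2) := by positivity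
      linarith))
    rw [ENNReal.ofReal_div_of_pos hm0, ENNReal.le_div_iff_mul_le (by simp [hm0]) (by simp), mul_comm]
    exact h5
  · intro t ht x
    exact ⟨sV.pos _ (by positivity) x, le_add_of_nonneg_left (Real.rpow_nonneg (sF.pos _ (by positivity) x).le _),
      sF.N0 _ (by positivity) x, sV.N0 _ (by positivity) x⟩
  · exact fun k hk t ht x => Nk k hk _ (by positivity) x
  · exact fun k hk t ht x => mul_le_mul_of_nonneg_left (NVk k hk _ (by positivity) x) hl0.le
  · intro t ht x
    have := Vk 0 (Nat.zero_le _) (ρ₃ * t) (by positivity) x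
    simp at this
    exact mul_le_mul_of_nonneg_left (by linarith) hl0.le
  · simp only [mul_zero]
    rw [eh]
    have hRi : R⁻¹ ≤ 1 := by
      apply inv_le_one_of_one_le₀
      nlinarith
    have h0 : 0 ≤ ∫ x, (1 + ‖P S₃ c₃ x‖ ^ 2) ^ (q / 2) ∂mT := integral_nonneg fun x => by positivity
    have : 0 ≤ B / m := by positivity
    nlinarith

end

end KP

set_option linter.all false
open MeasureTheory Set
namespace KP

noncomputable section

/-- sup bound -/
lemma atomS (k : ℕ) : ∃ C : ℝ, 0 < C ∧ ∀ ω S c, (∀ x, ‖P S c x‖ ≤ 1) → ∀ z, 0 ≤ z → ∀ x,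
    Sq ω S c k z x ≤ C := by
  refine ⟨Real.sqrt (2 * k.factorial), by positivity, ?_⟩
  intro ω S c h z hz x
  obtain ⟨W, W1, W2, N, sF, W0, Wnn, Wk, Nk⟩ := heat ω S c (δ := 1) one_pos le_rfl k
  have := (sF 1 one_pos).sup (by norm_num) (B := 2) (fun x => by
    rw [W0]; have := h x; nlinarith [norm_nonneg (P S c x)]) hz x
  apply Real.sqrt_le_sqrt
  have h2 := Wk k le_rfl z hz x
  have : (k.factorial : ℝ) > 0 := by positivity
  rw [one_pow, div_mul_eq_mul_div, one_mul, div_le_iff₀ this] at h2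
  nlinarith

lemma amgm {x y z : ℝ} (hx : 0 ≤ x) (hy : 0 ≤ y) (h : z ^ 2 ≤ x * y) : z ≤ x + y :=
  le_of_sq_le (by nlinarith) (by positivity)

set_option maxHeartbeats 1000000 in
lemma atomA {p q : ℝ} (hp : 2 ≤ p) (hq1 : 1 < q) (hq2 : q ≤ 2) (hpq : 1 / p + 1 / q = 1) (k₁ k₃ : ℕ)
    (hk1 : 1 ≤ k₁) (hk3 : 1 ≤ k₃) : ∃ C : ℝ, 0 < C ∧ ∀ ω S₁ c₁ S₃ c₃,
    ∫ x, ‖P S₁ c₁ x‖ ^ p ∂mT ≤ 1 → ∫ x, ‖P S₃ c₃ x‖ ^ q ∂mT ≤ 1 →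
    ∀ ρ₁ ρ₃ : ℝ, 1 ≤ ρ₁ → 1 ≤ ρ₃ →
    ∫⁻ t in Ioi (0:ℝ), ∫⁻ x, ENNReal.ofReal (t⁻¹ * (Sq ω S₁ c₁ k₁ (ρ₁ * t) x *
      Sq ω S₃ c₃ k₃ (ρ₃ * t) x)) ∂mT ≤ ENNReal.ofReal (C * (ρ₁ * ρ₃) ^ (1 / q - 1 / 2)) := by
  obtain ⟨j₁, rfl⟩ : ∃ j, k₁ = j + 1 := ⟨k₁ - 1, by omega⟩
  obtain ⟨j₃, rfl⟩ : ∃ j, k₃ = j + 1 := ⟨k₃ - 1, by omega⟩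
  obtain ⟨C, κ, hC, hκ, -, main⟩ := base hp hq1 hq2 hpq
  have hq0 : 0 < q := by linarith
  have hqm : 0 < q - 1 := by linarith
  set a₁ := (q - 1) ^ j₁ / j₁.factorial with ha1
  set a₃ := (q - 1) ^ j₃ / j₃.factorial with ha3
  have ha10 : 0 < a₁ := by positivity
  have ha30 : 0 < a₃ := by positivity
  refine ⟨C * (4 ^ (1 / q - 1 / 2) * (Real.sqrt (a₁ * a₃))⁻¹), by positivity, ?_⟩
  intro ω S₁ c₁ S₃ c₃ hF hh ρ₁ ρ₃ h1 h3
  obtain ⟨E, N, V, NV, w1, w2, Nw, hI, hpos, hN, hNV, -, -, -⟩ :=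
    main (max j₁ j₃) ω S₁ c₁ S₃ c₃ hF hh ρ₁ ρ₃ h1 h3
  have hr1 : 0 < ρ₁ := by linarith
  have hr3 : 0 < ρ₃ := by linarith
  set R := 4 * ρ₁ * ρ₃ with hR
  have hR0 : 0 < R := by positivity
  set D := R ^ (1 / q - 1 / 2) * (Real.sqrt (a₁ * a₃))⁻¹ with hD
  have hD0 : 0 < D := by positivity
  have key : ∀ t, 0 < t → ∀ x, t⁻¹ * (Sq ω S₁ c₁ (j₁ + 1) (ρ₁ * t) x * Sq ω S₃ c₃ (j₃ + 1) (ρ₃ * t) x) ≤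
      D * (ρ₁ * (E t x ^ (2 / q - 1) * N t x) + R * (ρ₃ * (V t x ^ (q / 2 - 1) * NV t x))) := by
    intro t ht x
    obtain ⟨v0, vE, n0, nv0⟩ := hpos t ht.le x
    have b1 := hN j₁ (le_max_left _ _) t ht.le x
    have b3 := hNV j₃ (le_max_right _ _) t ht.le x
    rw [mul_add]
    have vq : 0 < V t x ^ (q / 2) := by positivity
    apply amgm
    · have : 0 ≤ E t x := vq.le.trans vE
      positivity
    · positivity
    rw [mul_pow, mul_pow, Sq_sq _ _ _ _ (by positivity), Sq_sq _ _ _ _ (by positivity)]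
    set T1 := (ρ₁ * t) ^ j₁ * Th ω S₁ c₁ (j₁ + 1) 0 (ρ₁ * t) x with hT1
    set T3 := (ρ₃ * t) ^ j₃ * Th ω S₃ c₃ (j₃ + 1) 0 (ρ₃ * t) x with hT3
    have T10 : 0 ≤ T1 := by have := Th_nn ω S₁ c₁ (j₁ + 1) 0 (ρ₁ * t) x; positivity
    have T30 : 0 ≤ T3 := by have := Th_nn ω S₃ c₃ (j₃ + 1) 0 (ρ₃ * t) x; positivity
    have hEV : 1 ≤ E t x ^ (2 / q - 1) * V t x ^ (q / 2 - 1) := by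
      have e1 : (V t x ^ (q / 2)) ^ (2 / q - 1) ≤ E t x ^ (2 / q - 1) := by
        apply Real.rpow_le_rpow vq.le vE
        rw [sub_nonneg, le_div_iff₀ hq0]; linarith
      rw [← Real.rpow_mul v0.le] at e1
      calc (1:ℝ) = V t x ^ (q / 2 * (2 / q - 1)) * V t x ^ (q / 2 - 1) := by
            rw [← Real.rpow_add v0, show q / 2 * (2 / q - 1) + (q / 2 - 1) = 0 by field_simp; ring,
              Real.rpow_zero]
        _ ≤ _ := by gcongr
    have hDR : D ^ 2 * (R * R ^ (-(2 / q))) * (a₁ * a₃) = 1 := by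
      have e1 : (R ^ (1 / q - 1 / 2)) ^ 2 * (R * R ^ (-(2 / q))) = 1 := by
        rw [← Real.rpow_natCast, ← Real.rpow_mul hR0.le]
        nth_rewrite 2 [← Real.rpow_one R]
        rw [← Real.rpow_add hR0, ← Real.rpow_add hR0]
        rw [show (1 / q - 1 / 2) * ((2:ℕ):ℝ) + (1 + -(2 / q)) = 0 by push_cast; ring, Real.rpow_zero]
      rw [hD, mul_pow, inv_pow, Real.sq_sqrt (by positivity)]
      have : a₁ * a₃ ≠ 0 := by positivity
      rw [show (R ^ (1 / q - 1 / 2)) ^ 2 * (a₁ * a₃)⁻¹ * (R * R ^ (-(2 / q))) * (a₁ * a₃) =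
        ((R ^ (1 / q - 1 / 2)) ^ 2 * (R * R ^ (-(2 / q)))) * ((a₁ * a₃)⁻¹ * (a₁ * a₃)) by ring, e1,
        inv_mul_cancel₀ this, one_mul]
    calc t⁻¹ ^ 2 * ((ρ₁ * t) ^ (j₁ + 1) * Th ω S₁ c₁ (j₁ + 1) 0 (ρ₁ * t) x *
          ((ρ₃ * t) ^ (j₃ + 1) * Th ω S₃ c₃ (j₃ + 1) 0 (ρ₃ * t) x))
        = 1 * (ρ₁ * ρ₃ * (T1 * T3)) := by rw [hT1, hT3]; field_simp; ring
      _ = D ^ 2 * R * 1 * (ρ₁ * ρ₃) * ((a₁ * T1) * (R ^ (-(2 / q)) * (a₃ * T3))) := by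
          linear_combination (-(ρ₁ * ρ₃ * (T1 * T3))) * hDR
      _ ≤ D ^ 2 * R * (E t x ^ (2 / q - 1) * V t x ^ (q / 2 - 1)) * (ρ₁ * ρ₃) * (N t x * NV t x) := by
          gcongr
      _ = _ := by ring
  calc _ ≤ ∫⁻ t in Ioi (0:ℝ), ∫⁻ x, ENNReal.ofReal (D * (ρ₁ * (E t x ^ (2 / q - 1) * N t x) +
        R * (ρ₃ * (V t x ^ (q / 2 - 1) * NV t x)))) ∂mT :=
        setLIntegral_mono' measurableSet_Ioi fun t ht => lintegral_mono fun x =>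
          ENNReal.ofReal_le_ofReal (key t ht x)
    _ = ENNReal.ofReal D * ∫⁻ t in Ioi (0:ℝ), ∫⁻ x, ENNReal.ofReal ((ρ₁ * (E t x ^ (2 / q - 1) * N t x) +
        R * (ρ₃ * (V t x ^ (q / 2 - 1) * NV t x)))) ∂mT := by
        simp_rw [ENNReal.ofReal_mul hD0.le]
        simp_rw [lintegral_const_mul' _ _ ENNReal.ofReal_ne_top]
    _ ≤ ENNReal.ofReal D * ENNReal.ofReal C := by gcongr
    _ = _ := by
        rw [← ENNReal.ofReal_mul hD0.le]
        congr 1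
        rw [hD, hR, mul_assoc 4, Real.mul_rpow (by norm_num) (by positivity)]
        ring

set_option maxHeartbeats 1000000 in
lemma atomC {p q : ℝ} (hp : 2 ≤ p) (hq1 : 1 < q) (hq2 : q ≤ 2) (hpq : 1 / p + 1 / q = 1) (k₁ k₂ : ℕ)
    (hk1 : 1 ≤ k₁) (hk2 : 1 ≤ k₂) : ∃ C : ℝ, 0 < C ∧ ∀ ω S₁ c₁ S₂ c₂ S₃ c₃,
    ∫ x, ‖P S₁ c₁ x‖ ^ p ∂mT ≤ 1 → (∀ x, ‖P S₂ c₂ x‖ ≤ 1) → ∫ x, ‖P S₃ c₃ x‖ ^ q ∂mT ≤ 1 →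
    ∀ ρ₁ ρ₂ : ℝ, 1 ≤ ρ₁ → 1 ≤ ρ₂ →
    ∫⁻ t in Ioi (0:ℝ), ∫⁻ x, ENNReal.ofReal (t⁻¹ * (Sq ω S₁ c₁ k₁ (ρ₁ * t) x *
      Sq ω S₂ c₂ k₂ (ρ₂ * t) x * Sq ω S₃ c₃ 0 t x)) ∂mT ≤ ENNReal.ofReal (C * (ρ₁ * ρ₂)) := by
  obtain ⟨j₁, rfl⟩ : ∃ j, k₁ = j + 1 := ⟨k₁ - 1, by omega⟩
  obtain ⟨j₂, rfl⟩ : ∃ j, k₂ = j + 1 := ⟨k₂ - 1, by omega⟩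
  obtain ⟨C, κ, hC, hκ, hκ4, main⟩ := base hp hq1 hq2 hpq
  have hq0 : 0 < q := by linarith
  have hqm : 0 < q - 1 := by linarith
  set a₁ := (q - 1) ^ j₁ / j₁.factorial with ha1
  set a₂ := (q - 1) ^ j₂ / j₂.factorial with ha2
  have ha10 : 0 < a₁ := by positivity
  have ha20 : 0 < a₂ := by positivity
  set B := (2 * κ ^ 2 + 1) * 2 * C with hB
  have hB0 : 0 < B := by positivity
  refine ⟨4 * (Real.sqrt (a₁ * a₂))⁻¹ * (C + 2 * B), by positivity, ?_⟩
  intro ω S₁ c₁ S₂ c₂ S₃ c₃ hF hg hh ρ₁ ρ₂ h1 h2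
  obtain ⟨E, N, V, NV, w1, w2, Nw, hI, hpos, hN, -, hV, hw, hw0⟩ :=
    main (max j₁ j₂) ω S₁ c₁ S₃ c₃ hF hh ρ₁ 1 h1 le_rfl
  obtain ⟨G, G1, G2, Ng, sG, G0, Gnn, -, Ngk⟩ := heat ω S₂ c₂ (δ := q - 1) hqm (by linarith) (max j₁ j₂)
  have sG := sG 1 one_pos
  rw [show 4 / (2 - (q - 1)) = 4 / (3 - q) by congr 1; ring] at sG
  have hr1 : 0 < ρ₁ := by linarith
  have hr2 : 0 < ρ₂ := by linarith
  have hb3 := bell3 (B := 2) (sG.speed hκ4 hr2) hw hκ h2 (by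
    intro t ht x
    refine sG.sup (div_nonneg (by norm_num) (by linarith)) (fun x => ?_) (by positivity) x
    rw [G0]; have := hg x; nlinarith [norm_nonneg (P S₂ c₂ x)])
  set R := 4 * ρ₁ * 1 with hR
  have hR0 : 0 < R := by positivity
  have hR1 : 1 ≤ R := by rw [hR]; linarith
  set D := R ^ (1 / q) * (Real.sqrt (a₁ * a₂))⁻¹ with hD
  have hD0 : 0 < D := by positivity
  have key : ∀ t, 0 < t → ∀ x, t⁻¹ * (Sq ω S₁ c₁ (j₁ + 1) (ρ₁ * t) x *
      Sq ω S₂ c₂ (j₂ + 1) (ρ₂ * t) x * Sq ω S₃ c₃ 0 t x) ≤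
      D * (2 * (1 / 2 * (ρ₂ * (Ng (ρ₂ * t) x * V t x ^ (q / 2)))) +
      (ρ₁ * (E t x ^ (2 / q - 1) * N t x) + R * (1 * (V t x ^ (q / 2 - 1) * NV t x)))) := by
    intro t ht x
    obtain ⟨v0, vE, n0, nv0⟩ := hpos t ht.le x
    have b1 := hN j₁ (le_max_left _ _) t ht.le x
    have b2 := Ngk j₂ (le_max_right _ _) (ρ₂ * t) (by positivity) x
    have b3 := hV t ht.le x
    rw [one_mul] at b3
    have ng0 := sG.N0 (ρ₂ * t) (by positivity) x
    have vq : 0 < V t x ^ (q / 2) := by positivity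
    have hE0 : 0 < E t x := vq.trans_le vE
    suffices t⁻¹ * (Sq ω S₁ c₁ (j₁ + 1) (ρ₁ * t) x * Sq ω S₂ c₂ (j₂ + 1) (ρ₂ * t) x * Sq ω S₃ c₃ 0 t x) ≤
        D * (ρ₂ * (Ng (ρ₂ * t) x * V t x ^ (q / 2))) + D * (ρ₁ * (E t x ^ (2 / q - 1) * N t x)) by
      refine this.trans ?_
      have : 0 ≤ D * (R * (1 * (V t x ^ (q / 2 - 1) * NV t x))) := by positivity
      linarith
    apply amgm
    · positivity
    · positivity
    rw [mul_pow, mul_pow, mul_pow, Sq_sq _ _ _ _ (by positivity), Sq_sq _ _ _ _ (by positivity),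
      Sq_sq _ _ _ _ ht.le, pow_zero, one_mul]
    set T1 := (ρ₁ * t) ^ j₁ * Th ω S₁ c₁ (j₁ + 1) 0 (ρ₁ * t) x with hT1
    set T2 := (ρ₂ * t) ^ j₂ * Th ω S₂ c₂ (j₂ + 1) 0 (ρ₂ * t) x with hT2
    set T3 := Th ω S₃ c₃ 0 0 t x with hT3
    have T10 : 0 ≤ T1 := by have := Th_nn ω S₁ c₁ (j₁ + 1) 0 (ρ₁ * t) x; positivity
    have T20 : 0 ≤ T2 := by have := Th_nn ω S₂ c₂ (j₂ + 1) 0 (ρ₂ * t) x; positivity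
    have T30 : 0 ≤ T3 := Th_nn _ _ _ _ _ _ _
    have hEV : V t x ≤ V t x ^ (q / 2) * E t x ^ (2 / q - 1) := by
      have e1 : (V t x ^ (q / 2)) ^ (2 / q - 1) ≤ E t x ^ (2 / q - 1) := by
        apply Real.rpow_le_rpow vq.le vE
        rw [sub_nonneg, le_div_iff₀ hq0]; linarith
      rw [← Real.rpow_mul v0.le] at e1
      calc V t x = V t x ^ (q / 2) * V t x ^ (q / 2 * (2 / q - 1)) := by
            rw [← Real.rpow_add v0, show q / 2 + q / 2 * (2 / q - 1) = 1 by field_simp; ring,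
              Real.rpow_one]
        _ ≤ _ := by gcongr
    have hDR : D ^ 2 * R ^ (-(2 / q)) * (a₁ * a₂) = 1 := by
      have e1 : (R ^ (1 / q)) ^ 2 * R ^ (-(2 / q)) = 1 := by
        rw [← Real.rpow_natCast, ← Real.rpow_mul hR0.le, ← Real.rpow_add hR0]
        rw [show (1 / q) * ((2:ℕ):ℝ) + (-(2 / q)) = 0 by push_cast; ring, Real.rpow_zero]
      rw [hD, mul_pow, inv_pow, Real.sq_sqrt (by positivity)]
      have : a₁ * a₂ ≠ 0 := by positivity
      rw [show (R ^ (1 / q)) ^ 2 * (a₁ * a₂)⁻¹ * R ^ (-(2 / q)) * (a₁ * a₂) =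
        ((R ^ (1 / q)) ^ 2 * R ^ (-(2 / q))) * ((a₁ * a₂)⁻¹ * (a₁ * a₂)) by ring, e1,
        inv_mul_cancel₀ this, one_mul]
    calc t⁻¹ ^ 2 * ((ρ₁ * t) ^ (j₁ + 1) * Th ω S₁ c₁ (j₁ + 1) 0 (ρ₁ * t) x *
          ((ρ₂ * t) ^ (j₂ + 1) * Th ω S₂ c₂ (j₂ + 1) 0 (ρ₂ * t) x) * T3)
        = 1 * (ρ₁ * ρ₂ * (T1 * T2) * T3) := by rw [hT1, hT2]; field_simp; ring
      _ = D ^ 2 * (ρ₁ * ρ₂) * ((a₁ * T1) * (a₂ * T2)) * (R ^ (-(2 / q)) * T3) := by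
          linear_combination (-(ρ₁ * ρ₂ * (T1 * T2) * T3)) * hDR
      _ ≤ D ^ 2 * (ρ₁ * ρ₂) * (N t x * Ng (ρ₂ * t) x) * V t x := by
          gcongr
      _ ≤ D ^ 2 * (ρ₁ * ρ₂) * (N t x * Ng (ρ₂ * t) x) * (V t x ^ (q / 2) * E t x ^ (2 / q - 1)) := by
          gcongr
      _ = _ := by ring
  have hcts : Cts (fun t x => 2 * (1 / 2 * (ρ₂ * (Ng (ρ₂ * t) x * V t x ^ (q / 2))))) :=
    (Cts.const 2).mul ((Cts.const _).mul ((Cts.const _).mul ((sG.cN.speed hr2.le).mul hw.c0)))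
  calc _ ≤ ∫⁻ t in Ioi (0:ℝ), ∫⁻ x, ENNReal.ofReal (D * (2 * (1 / 2 * (ρ₂ * (Ng (ρ₂ * t) x * V t x ^ (q / 2)))) +
      (ρ₁ * (E t x ^ (2 / q - 1) * N t x) + R * (1 * (V t x ^ (q / 2 - 1) * NV t x))))) ∂mT :=
        setLIntegral_mono' measurableSet_Ioi fun t ht => lintegral_mono fun x =>
          ENNReal.ofReal_le_ofReal (key t ht x)
    _ = ENNReal.ofReal D * ∫⁻ t in Ioi (0:ℝ), ∫⁻ x, ENNReal.ofReal
        (2 * (1 / 2 * (ρ₂ * (Ng (ρ₂ * t) x * V t x ^ (q / 2)))) +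
      (ρ₁ * (E t x ^ (2 / q - 1) * N t x) + R * (1 * (V t x ^ (q / 2 - 1) * NV t x)))) ∂mT := by
        simp_rw [ENNReal.ofReal_mul hD0.le]
        simp_rw [lintegral_const_mul' _ _ ENNReal.ofReal_ne_top]
    _ ≤ ENNReal.ofReal D * (ENNReal.ofReal (2 * (B * ρ₂)) + ENNReal.ofReal C) := by
        gcongr
        refine (lint_add hcts).trans (add_le_add ?_ hI)
        simp_rw [ENNReal.ofReal_mul (show (0:ℝ) ≤ 2 by norm_num),
          lintegral_const_mul' _ _ ENNReal.ofReal_ne_top]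
        gcongr
        refine hb3.trans (ENNReal.ofReal_le_ofReal ?_)
        calc (2 * κ ^ 2 + 1) * 2 * ρ₂ * ∫ x, V 0 x ^ (q / 2) ∂mT ≤ (2 * κ ^ 2 + 1) * 2 * ρ₂ * C := by
              gcongr
          _ = _ := by rw [hB]; ring
    _ ≤ _ := by
        rw [← ENNReal.ofReal_add (by positivity) hC.le, ← ENNReal.ofReal_mul hD0.le]
        apply ENNReal.ofReal_le_ofReal
        have hRq : R ^ (1 / q) ≤ R := by
          calc R ^ (1 / q) ≤ R ^ (1:ℝ) := Real.rpow_le_rpow_of_exponent_le hR1 (by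
                rw [div_le_one hq0]; linarith)
            _ = R := Real.rpow_one R
        calc D * (2 * (B * ρ₂) + C) ≤ (R * (Real.sqrt (a₁ * a₂))⁻¹) * (2 * (B * ρ₂) + C * ρ₂) := by
              rw [hD]
              gcongr
              nlinarith
          _ = _ := by rw [hR]; ring

end

end KP

set_option linter.all false
open MeasureTheory Set
namespace KP

noncomputable section

/-- fractional heat extension -/
def Y (ω : ℝ × ℝ) (S : Finset (ℤ × ℤ)) (c : ℤ × ℤ → ℂ) (x : ℝ) (ε : ℕ) (t : ℝ) (y : ℝ × ℝ) : ℂ :=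
  ∑ n ∈ S, c n * ((1 + fr ω n ^ 2) ^ (x / 2) * fr ω n ^ ε *
    Real.exp (-(t * (fr ω n ^ 2 + 1 / 2))) : ℝ) * ch n y

lemma Y_cont (ω S c x ε) : Continuous (fun z : ℝ × (ℝ × ℝ) => Y ω S c x ε z.1 z.2) := by
  unfold Y
  refine continuous_finsetSum _ fun n _ => ?_
  have h1 : Continuous (fun z : ℝ × (ℝ × ℝ) => ch n z.2) := (ch_cont n).comp continuous_snd
  fun_prop

lemma beta_fin {κ L : ℝ} (hκ : 0 < κ) (hL : κ < L) : ∃ C : ℝ, 0 < C ∧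
    ∫⁻ η in Ioi (0:ℝ), ENNReal.ofReal (η ^ (κ - 1) * (1 + η) ^ (-L)) ≤ ENNReal.ofReal C := by
  have h1 : IntegrableOn (fun η : ℝ => η ^ (κ - 1)) (Ioc 0 1) := by
    have := intervalIntegral.intervalIntegrable_rpow' (a := 0) (b := 1) (r := κ - 1) (by linarith)
    rwa [intervalIntegrable_iff_integrableOn_Ioc_of_le zero_le_one] at this
  have h2 : IntegrableOn (fun η : ℝ => η ^ (κ - 1 - L)) (Ioi 1) :=
    integrableOn_Ioi_rpow_of_lt (by linarith) one_pos
  have e1 : ∫⁻ η in Ioc (0:ℝ) 1, ENNReal.ofReal (η ^ (κ - 1)) < ⊤ := h1.lintegral_lt_top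
  have e2 : ∫⁻ η in Ioi (1:ℝ), ENNReal.ofReal (η ^ (κ - 1 - L)) < ⊤ := h2.lintegral_lt_top
  set I := ∫⁻ η in Ioi (0:ℝ), ENNReal.ofReal (η ^ (κ - 1) * (1 + η) ^ (-L)) with hI
  have hfin : I < ⊤ := by
    rw [hI, ← Ioc_union_Ioi_eq_Ioi (zero_le_one (α := ℝ))]
    refine (lintegral_union_le _ _ _).trans_lt (ENNReal.add_lt_top.2 ⟨?_, ?_⟩)
    · refine lt_of_le_of_lt (setLIntegral_mono' measurableSet_Ioc fun η hη => ENNReal.ofReal_le_ofReal ?_) e1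
      have := hη.1
      refine mul_le_of_le_one_right (by positivity) ?_
      exact Real.rpow_le_one_of_one_le_of_nonpos (by linarith) (by linarith)
    · refine lt_of_le_of_lt (setLIntegral_mono' measurableSet_Ioi fun η hη => ENNReal.ofReal_le_ofReal ?_) e2
      have h0 : (0:ℝ) < η := lt_trans one_pos hη
      rw [show κ - 1 - L = (κ - 1) + (-L) by ring, Real.rpow_add h0]
      have hh : (1 + η) ^ (-L) ≤ η ^ (-L) :=
        Real.rpow_le_rpow_of_nonpos h0 (by linarith) (by linarith)
      exact mul_le_mul_of_nonneg_left hh (by positivity)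
  refine ⟨I.toReal + 1, by positivity, ?_⟩
  refine le_trans (le_of_eq (ENNReal.ofReal_toReal hfin.ne).symm) (ENNReal.ofReal_le_ofReal (by linarith))

lemma Y_int (ω S c) (n ε : ℕ) {z : ℝ} (hz : 0 < z) (y : ℝ × ℝ) :
    ‖Y ω S c (2 * n) ε z y‖ ≤ 2 ^ n * 2 ^ (2 * n + ε) * z ^ (-(n + (ε:ℝ) / 2)) * Sq ω S c (2 * n + ε) z y := by
  have hU : ∀ j ≤ 2 * n + ε, ‖U ω S c j z y‖ ≤ 2 ^ (2 * n + ε) * z ^ (-(n + (ε:ℝ) / 2)) *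
      Sq ω S c (2 * n + ε) z y := by
    intro j hj
    apply le_of_sq_le _ (by have := Sq_nn ω S c (2 * n + ε) z y; positivity)
    rw [mul_pow, mul_pow, Sq_sq _ _ _ _ hz.le]
    have e1 : (z ^ (-(n + (ε:ℝ) / 2))) ^ 2 * z ^ (2 * n + ε) = 1 := by
      rw [← Real.rpow_natCast, ← Real.rpow_mul hz.le, ← Real.rpow_natCast z, ← Real.rpow_add hz]
      rw [show -((n:ℝ) + (ε:ℝ) / 2) * ((2:ℕ):ℝ) + ((2 * n + ε : ℕ):ℝ) = 0 by push_cast; ring,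
        Real.rpow_zero]
    calc ‖U ω S c j z y‖ ^ 2 ≤ Th ω S c j 0 z y := Th_U ω S c j z y
      _ ≤ 2 ^ (2 * n + ε - j) * Th ω S c (2 * n + ε) 0 z y := Th_mono ω S c hj z y
      _ ≤ (2 ^ (2 * n + ε)) ^ 2 * Th ω S c (2 * n + ε) 0 z y := by
          have := Th_nn ω S c (2 * n + ε) 0 z y
          gcongr
          rw [← pow_mul]
          exact pow_le_pow_right₀ (by norm_num) (by omega)
      _ = _ := by linear_combination (-((2 ^ (2 * n + ε)) ^ 2 * Th ω S c (2 * n + ε) 0 z y)) * e1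
  have hY : Y ω S c (2 * n) ε z y = ∑ i ∈ Finset.range (n + 1),
      (n.choose i : ℂ) * ((-Complex.I) ^ (2 * i + ε) * U ω S c (2 * i + ε) z y) := by
    unfold Y U
    simp_rw [Finset.mul_sum]
    rw [Finset.sum_comm]
    refine Finset.sum_congr rfl fun m _ => ?_
    have e2 : ((1 + fr ω m ^ 2) ^ ((2 * (n:ℝ)) / 2) : ℝ) = ∑ i ∈ Finset.range (n + 1),
        fr ω m ^ (2 * i) * n.choose i := by
      rw [show (2 * (n:ℝ)) / 2 = n by ring, Real.rpow_natCast, add_comm, add_pow]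
      refine Finset.sum_congr rfl fun i _ => ?_
      rw [pow_mul]; simp
    rw [e2]
    push_cast
    simp_rw [Finset.sum_mul, Finset.mul_sum, Finset.sum_mul]
    refine Finset.sum_congr rfl fun i _ => ?_
    have e3 : (-Complex.I) ^ (2 * i + ε) * (Complex.I * (fr ω m : ℂ)) ^ (2 * i + ε) =
        (fr ω m : ℂ) ^ (2 * i) * (fr ω m : ℂ) ^ ε := by
      rw [← mul_pow, ← mul_assoc, neg_mul, Complex.I_mul_I, neg_neg, one_mul, pow_add]
    linear_combination (-(c m * (n.choose i : ℂ) * Complex.exp (-(z * ((fr ω m : ℂ) ^ 2 + 1 / 2))) * ch m y)) * e3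
  rw [hY]
  refine (norm_sum_le _ _).trans ?_
  have : ∀ i ∈ Finset.range (n + 1), ‖(n.choose i : ℂ) * ((-Complex.I) ^ (2 * i + ε) *
      U ω S c (2 * i + ε) z y)‖ ≤ n.choose i * (2 ^ (2 * n + ε) * z ^ (-(n + (ε:ℝ) / 2)) *
      Sq ω S c (2 * n + ε) z y) := by
    intro i hi
    rw [norm_mul, norm_mul, norm_pow, norm_neg, Complex.norm_I, one_pow, one_mul, Complex.norm_natCast]
    gcongr
    exact hU _ (by have := Finset.mem_range.1 hi; omega)
  refine (Finset.sum_le_sum this).trans (le_of_eq ?_)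
  rw [← Finset.sum_mul]
  have : ∑ i ∈ Finset.range (n + 1), (n.choose i : ℝ) = 2 ^ n := by
    exact_mod_cast Nat.sum_range_choose n
  rw [this]; ring

lemma gam_int {κ r : ℝ} (hκ : 0 < κ) (hr : 0 < r) :
    IntegrableOn (fun t : ℝ => t ^ (κ - 1) * Real.exp (-(r * t))) (Ioi 0) := by
  have := integrableOn_rpow_mul_exp_neg_mul_rpow (p := 1) (s := κ - 1) (b := r) (by linarith) one_pos hr
  simpa using this

lemma frac {x : ℝ} {n ε : ℕ} (hn : x / 2 < n) : ∃ C : ℝ, 0 < C ∧ ∀ ω S c t, 0 < t → ∀ y,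
    ‖Y ω S c x ε t y‖ₑ ≤ ENNReal.ofReal (C * t ^ (-((x + ε) / 2))) * ∫⁻ η in Ioi (0:ℝ),
      ENNReal.ofReal (η ^ (n - x / 2 - 1) * (1 + η) ^ (-(n + (ε:ℝ) / 2)) *
        Sq ω S c (2 * n + ε) (t * (1 + η)) y) := by
  set κ := (n:ℝ) - x / 2 with hκ
  have hκ0 : 0 < κ := by rw [hκ]; linarith
  have hG := Real.Gamma_pos_of_pos hκ0
  set A : ℝ := 2 ^ n * 2 ^ (2 * n + ε) with hA
  refine ⟨(Real.Gamma κ)⁻¹ * A, by positivity, ?_⟩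
  intro ω S c t ht y
  have hIntg : Y ω S c x ε t y = ∫ η in Ioi (0:ℝ),
      (((Real.Gamma κ)⁻¹ * t ^ κ * (η ^ (κ - 1) * Real.exp (-(t * η / 2))) : ℝ) : ℂ) *
        Y ω S c (2 * n) ε (t * (1 + η)) y := by
    unfold Y
    simp_rw [Finset.mul_sum]
    have e0 : ∀ m, ∀ η : ℝ, (((Real.Gamma κ)⁻¹ * t ^ κ * (η ^ (κ - 1) * Real.exp (-(t * η / 2))) : ℝ) : ℂ) *
        (c m * ((1 + fr ω m ^ 2) ^ (2 * (n:ℝ) / 2) * fr ω m ^ ε *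
          Real.exp (-(t * (1 + η) * (fr ω m ^ 2 + 1 / 2))) : ℝ) * ch m y) =
        (c m * (((Real.Gamma κ)⁻¹ * t ^ κ * (1 + fr ω m ^ 2) ^ (2 * (n:ℝ) / 2) * fr ω m ^ ε *
          Real.exp (-(t * (fr ω m ^ 2 + 1 / 2))) : ℝ) : ℂ) * ch m y) *
        ((η ^ (κ - 1) * Real.exp (-(t * (1 + fr ω m ^ 2) * η)) : ℝ) : ℂ) := by
      intro m η
      have : Real.exp (-(t * η / 2)) * Real.exp (-(t * (1 + η) * (fr ω m ^ 2 + 1 / 2))) =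
          Real.exp (-(t * (fr ω m ^ 2 + 1 / 2))) * Real.exp (-(t * (1 + fr ω m ^ 2) * η)) := by
        rw [← Real.exp_add, ← Real.exp_add]; congr 1; ring
      have t2 := congrArg (fun r : ℝ => (r : ℂ)) this
      simp only [Complex.ofReal_mul] at t2
      simp only [Complex.ofReal_mul]
      linear_combination ((((Real.Gamma κ)⁻¹ : ℝ):ℂ) * ((t ^ κ : ℝ):ℂ) * ((η ^ (κ - 1) : ℝ):ℂ) * c m *
        (((1 + fr ω m ^ 2) ^ (2 * (n:ℝ) / 2) : ℝ) : ℂ) * ((fr ω m ^ ε : ℝ) : ℂ) * ch m y) * t2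
    simp_rw [e0]
    rw [integral_finsetSum]
    · refine Finset.sum_congr rfl fun m _ => ?_
      have hB : 0 < 1 + fr ω m ^ 2 := by positivity
      rw [integral_const_mul, integral_complex_ofReal,
        Real.integral_rpow_mul_exp_neg_mul_Ioi hκ0 (by positivity)]
      have e5 : (1 + fr ω m ^ 2) ^ (x / 2) = (1 + fr ω m ^ 2) ^ (2 * (n:ℝ) / 2) *
          (1 + fr ω m ^ 2) ^ (-κ) := by
        rw [← Real.rpow_add hB]; congr 1; rw [hκ]; ring
      have e6 : (1 / (t * (1 + fr ω m ^ 2))) ^ κ = t ^ (-κ) * (1 + fr ω m ^ 2) ^ (-κ) := by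
        rw [one_div, Real.inv_rpow (by positivity), ← Real.rpow_neg (by positivity),
          Real.mul_rpow ht.le hB.le]
      have e7 : t ^ κ * t ^ (-κ) = 1 := by rw [← Real.rpow_add ht]; simp
      have e8 : (Real.Gamma κ)⁻¹ * Real.Gamma κ = 1 := inv_mul_cancel₀ hG.ne'
      rw [e5, e6]
      have : (1 + fr ω m ^ 2) ^ (2 * (n:ℝ) / 2) * (1 + fr ω m ^ 2) ^ (-κ) * fr ω m ^ ε *
          Real.exp (-(t * (fr ω m ^ 2 + 1 / 2))) = ((Real.Gamma κ)⁻¹ * t ^ κ *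
          (1 + fr ω m ^ 2) ^ (2 * (n:ℝ) / 2) * fr ω m ^ ε *
          Real.exp (-(t * (fr ω m ^ 2 + 1 / 2)))) * (t ^ (-κ) * (1 + fr ω m ^ 2) ^ (-κ) * Real.Gamma κ) := by
        set Q := (1 + fr ω m ^ 2) ^ (2 * (n:ℝ) / 2) * (1 + fr ω m ^ 2) ^ (-κ) * fr ω m ^ ε *
          Real.exp (-(t * (fr ω m ^ 2 + 1 / 2))) with hQ
        calc Q = Q * ((Real.Gamma κ)⁻¹ * Real.Gamma κ) * (t ^ κ * t ^ (-κ)) := by rw [e7, e8]; ring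
          _ = _ := by rw [hQ]; ring
      rw [this]
      push_cast
      ring
    · intro m _
      have hB : 0 < 1 + fr ω m ^ 2 := by positivity
      exact ((gam_int hκ0 (show 0 < t * (1 + fr ω m ^ 2) by positivity)).ofReal).const_mul _
  rw [hIntg]
  refine (enorm_integral_le_lintegral_enorm _).trans ?_
  rw [← lintegral_const_mul' _ _ ENNReal.ofReal_ne_top]
  refine setLIntegral_mono' measurableSet_Ioi fun η hη => ?_
  have hη0 : (0:ℝ) < η := hη
  rw [← ofReal_norm_eq_enorm, ← ENNReal.ofReal_mul (by positivity)]
  apply ENNReal.ofReal_le_ofReal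
  rw [norm_mul, Complex.norm_real, Real.norm_of_nonneg (by positivity)]
  have hY := Y_int ω S c n ε (z := t * (1 + η)) (by positivity) y
  have hs := Sq_nn ω S c (2 * n + ε) (t * (1 + η)) y
  have hexp : Real.exp (-(t * η / 2)) ≤ 1 := Real.exp_le_one_iff.2 (by
    have : 0 < t * η := by positivity
    linarith)
  calc _ ≤ (Real.Gamma κ)⁻¹ * t ^ κ * (η ^ (κ - 1) * 1) * (2 ^ n * 2 ^ (2 * n + ε) *
        (t * (1 + η)) ^ (-(n + (ε:ℝ) / 2)) * Sq ω S c (2 * n + ε) (t * (1 + η)) y) := by gcongr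
    _ = (Real.Gamma κ)⁻¹ * A * (t ^ κ * t ^ (-(n + (ε:ℝ) / 2))) * (η ^ (κ - 1) *
        (1 + η) ^ (-(n + (ε:ℝ) / 2)) * Sq ω S c (2 * n + ε) (t * (1 + η)) y) := by
        rw [Real.mul_rpow ht.le (by positivity), hA]; ring
    _ = _ := by
        rw [← Real.rpow_add ht, show κ + -(n + (ε:ℝ) / 2) = -((x + ε) / 2) by rw [hκ]; ring]

/-- sup bound for `Y` -/
lemma supY {x : ℝ} (hx : 0 ≤ x) (ε : ℕ) : ∃ C : ℝ, 0 < C ∧ ∀ ω S c, (∀ y, ‖P S c y‖ ≤ 1) →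
    ∀ t, 0 < t → ∀ y, ‖Y ω S c x ε t y‖ₑ ≤ ENNReal.ofReal (C * t ^ (-((x + ε) / 2))) := by
  by_cases h0 : 0 < x + ε
  · set n := ⌊x / 2⌋₊ + 1 with hn
    have hn' : x / 2 < n := by rw [hn]; push_cast; exact Nat.lt_floor_add_one _
    obtain ⟨C, hC, hf⟩ := frac (ε := ε) hn'
    obtain ⟨C2, hC2, hs⟩ := atomS (2 * n + ε)
    obtain ⟨C3, hC3, hb⟩ := beta_fin (κ := n - x / 2) (L := n + (ε:ℝ) / 2) (by linarith) (by linarith)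
    refine ⟨C * (C2 * C3), by positivity, ?_⟩
    intro ω S c hc t ht y
    refine (hf ω S c t ht y).trans ?_
    calc _ ≤ ENNReal.ofReal (C * t ^ (-((x + ε) / 2))) * ∫⁻ η in Ioi (0:ℝ),
          ENNReal.ofReal (C2 * (η ^ (n - x / 2 - 1) * (1 + η) ^ (-(n + (ε:ℝ) / 2)))) := by
          refine mul_le_mul' le_rfl (setLIntegral_mono' measurableSet_Ioi
            fun η hη => ENNReal.ofReal_le_ofReal ?_)
          have hη0 : (0:ℝ) < η := hη
          have := hs ω S c hc (t * (1 + η)) (by positivity) y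
          rw [mul_comm C2]
          gcongr
      _ ≤ ENNReal.ofReal (C * t ^ (-((x + ε) / 2))) * (ENNReal.ofReal C2 * ENNReal.ofReal C3) := by
          simp_rw [ENNReal.ofReal_mul hC2.le]
          rw [lintegral_const_mul' _ _ ENNReal.ofReal_ne_top]
          gcongr
      _ = _ := by
          rw [← ENNReal.ofReal_mul hC2.le, ← ENNReal.ofReal_mul (by positivity)]
          congr 1; ring
  · have hx0 : x = 0 := by have : (0:ℝ) ≤ ε := by positivity
                           linarith
    have he : ε = 0 := by
      by_contra h
      have : (0:ℝ) < ε := by exact_mod_cast Nat.pos_of_ne_zero h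
      exact h0 (by linarith)
    subst hx0; subst he
    obtain ⟨C2, hC2, hs⟩ := atomS 0
    refine ⟨C2, hC2, fun ω S c hc t ht y => ?_⟩
    rw [← ofReal_norm_eq_enorm]
    apply ENNReal.ofReal_le_ofReal
    have h1 := Y_int ω S c 0 0 ht y
    have h2 := hs ω S c hc t ht.le y
    simp at h1 ⊢
    linarith

end

end KP

set_option linter.all false
open MeasureTheory Set
namespace KP

noncomputable section

/-- the measure `dt × dx` on the half-space -/
def MM : Measure (ℝ × (ℝ × ℝ)) := (volume.restrict (Ioi (0:ℝ))).prod mT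

instance : SFinite MM := by unfold MM; infer_instance

lemma MM_ae : ∀ᵐ z ∂MM, 0 < z.1 := by
  have h : ∀ᵐ t ∂(volume.restrict (Ioi (0:ℝ))), 0 < t := ae_restrict_mem measurableSet_Ioi
  exact Measure.quasiMeasurePreserving_fst.ae h

lemma MM_mono {f g : ℝ × (ℝ × ℝ) → ENNReal} (h : ∀ z, 0 < z.1 → f z ≤ g z) :
    ∫⁻ z, f z ∂MM ≤ ∫⁻ z, g z ∂MM :=
  lintegral_mono_ae (MM_ae.mono h)

lemma MM_iter {f : ℝ × (ℝ × ℝ) → ENNReal} (hf : Measurable f) :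
    ∫⁻ z, f z ∂MM = ∫⁻ t in Ioi (0:ℝ), ∫⁻ x, f (t, x) ∂mT :=
  lintegral_prod _ hf.aemeasurable

lemma onefold {α β : Type*} [MeasurableSpace α] [MeasurableSpace β] {μ : Measure α} {ν : Measure β}
    [SFinite μ] [SFinite ν] {H : α → ENNReal} {w : β → ENNReal} {Φ : β × α → ENNReal}
    (hH : Measurable H) (hw : Measurable w) (hΦ : Measurable Φ) :
    ∫⁻ z, H z * ∫⁻ η, w η * Φ (η, z) ∂ν ∂μ = ∫⁻ η, w η * ∫⁻ z, H z * Φ (η, z) ∂μ ∂ν := by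
  have e1 : ∀ z, H z * ∫⁻ η, w η * Φ (η, z) ∂ν = ∫⁻ η, H z * (w η * Φ (η, z)) ∂ν := fun z =>
    (lintegral_const_mul _ (by fun_prop)).symm
  have e2 : ∀ η, w η * ∫⁻ z, H z * Φ (η, z) ∂μ = ∫⁻ z, w η * (H z * Φ (η, z)) ∂μ := fun z =>
    (lintegral_const_mul _ (by fun_prop)).symm
  simp_rw [e1, e2]
  rw [lintegral_lintegral_swap]
  · simp_rw [mul_left_comm]
  · apply Measurable.aemeasurable
    simp only [Function.uncurry_def]
    fun_prop

lemma twofold {α : Type*} [MeasurableSpace α] {μ : Measure α} [SFinite μ]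
    {G : α → ENNReal} {w₁ w₃ a b : ℝ → ENNReal} {Φ₁ Φ₃ : ℝ × α → ENNReal}
    (hG : Measurable G) (hw₁ : Measurable w₁) (hw₃ : Measurable w₃)
    (hΦ₁ : Measurable Φ₁) (hΦ₃ : Measurable Φ₃) (ha : Measurable a) (hb : Measurable b)
    (h : ∀ η, 0 < η → ∀ η', 0 < η' → ∫⁻ z, G z * Φ₁ (η, z) * Φ₃ (η', z) ∂μ ≤ a η * b η') :
    ∫⁻ z, G z * (∫⁻ η in Ioi (0:ℝ), w₁ η * Φ₁ (η, z)) * (∫⁻ η in Ioi (0:ℝ), w₃ η * Φ₃ (η, z)) ∂μ ≤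
    (∫⁻ η in Ioi (0:ℝ), w₁ η * a η) * (∫⁻ η in Ioi (0:ℝ), w₃ η * b η) := by
  have hm : Measurable (fun z => ∫⁻ η in Ioi (0:ℝ), w₁ η * Φ₁ (η, z)) := by
    apply Measurable.lintegral_prod_left' (f := fun p : ℝ × α => w₁ p.1 * Φ₁ p)
    fun_prop
  rw [onefold (H := fun z => G z * ∫⁻ η in Ioi (0:ℝ), w₁ η * Φ₁ (η, z)) (hG.mul hm) hw₃ hΦ₃]
  rw [← lintegral_const_mul _ (by fun_prop)]
  refine setLIntegral_mono' measurableSet_Ioi fun η' hη' => ?_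
  have e : ∀ z, G z * (∫⁻ η in Ioi (0:ℝ), w₁ η * Φ₁ (η, z)) * Φ₃ (η', z) =
    (G z * Φ₃ (η', z)) * (∫⁻ η in Ioi (0:ℝ), w₁ η * Φ₁ (η, z)) := fun z => by ring
  simp_rw [e]
  rw [onefold (by fun_prop) hw₁ hΦ₁, mul_left_comm]
  gcongr
  rw [← lintegral_mul_const _ (by fun_prop)]
  refine setLIntegral_mono' measurableSet_Ioi fun η hη => ?_
  rw [mul_assoc]
  gcongr
  refine le_trans (le_of_eq ?_) (h η hη η' hη')
  congr 1; ext z; ring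

lemma re1 {a b c k i I J : ENNReal} (h : a * b * c = k * i) : a * (b * I) * (c * J) = k * (i * I * J) := by
  calc _ = (a * b * c) * (I * J) := by ring
    _ = _ := by rw [h]; ring

lemma re2 {a b c d u v : ENNReal} (h : a * b = c * d) : a * (u * b * v) = c * (d * u * v) := by
  calc _ = (a * b) * (u * v) := by ring
    _ = _ := by rw [h]; ring

lemma re3 {a b c k i I J s : ENNReal} (h : a * (b * c) = k * i) :
    a * (b * I * (c * J) * s) = k * ((i * s) * I * J) := by
  calc _ = (a * (b * c)) * (I * J * s) := by ring
    _ = _ := by rw [h]; ring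

lemma Sq_meas (ω S c k) (ρ : ℝ) : Measurable (fun p : ℝ × (ℝ × (ℝ × ℝ)) =>
    ENNReal.ofReal (Sq ω S c k (ρ * p.2.1 * (1 + p.1)) p.2.2)) := by
  have h := (Sq_cont ω S c k).comp (show Continuous (fun p : ℝ × (ℝ × (ℝ × ℝ)) =>
    (ρ * p.2.1 * (1 + p.1), p.2.2)) by fun_prop)
  exact (ENNReal.measurable_ofReal.comp h.measurable)

lemma frac' {x : ℝ} {n ε : ℕ} (hn : x / 2 < n) : ∃ C : ℝ, 0 < C ∧ ∀ ω S c t, 0 < t → ∀ y,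
    ‖Y ω S c x ε t y‖ₑ ≤ ENNReal.ofReal (C * t ^ (-((x + ε) / 2))) * ∫⁻ η in Ioi (0:ℝ),
      ENNReal.ofReal (η ^ (n - x / 2 - 1) * (1 + η) ^ (-(n + (ε:ℝ) / 2))) *
        ENNReal.ofReal (Sq ω S c (2 * n + ε) (t * (1 + η)) y) := by
  obtain ⟨C, hC, h⟩ := frac (ε := ε) hn
  refine ⟨C, hC, fun ω S c t ht y => (h ω S c t ht y).trans ?_⟩
  refine mul_le_mul' le_rfl (setLIntegral_mono' measurableSet_Ioi fun η hη => ?_)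
  have : (0:ℝ) < η := hη
  rw [← ENNReal.ofReal_mul (by positivity)]

lemma AA {p q : ℝ} (hp : 2 ≤ p) (hq1 : 1 < q) (hq2 : q ≤ 2) (hpq : 1 / p + 1 / q = 1)
    (x₁ x₃ : ℝ) (ε₁ ε₃ : ℕ) (h1 : 1 ≤ x₁ + ε₁) (h3 : 1 ≤ x₃ + ε₃) : ∃ C : ℝ, 0 < C ∧
    ∀ ω S₁ c₁ S₃ c₃, ∫ x, ‖P S₁ c₁ x‖ ^ p ∂mT ≤ 1 → ∫ x, ‖P S₃ c₃ x‖ ^ q ∂mT ≤ 1 →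
    ∀ ρ₁ ρ₃ : ℝ, 1 ≤ ρ₁ → 1 ≤ ρ₃ →
    ∫⁻ z, ENNReal.ofReal (z.1 ^ ((x₁ + ε₁) / 2 + (x₃ + ε₃) / 2 - 1)) * ‖Y ω S₁ c₁ x₁ ε₁ (ρ₁ * z.1) z.2‖ₑ *
      ‖Y ω S₃ c₃ x₃ ε₃ (ρ₃ * z.1) z.2‖ₑ ∂MM ≤
    ENNReal.ofReal (C * (ρ₁ ^ (-((x₁ + ε₁) / 2) + (1 / q - 1 / 2)) *
      ρ₃ ^ (-((x₃ + ε₃) / 2) + (1 / q - 1 / 2)))) := by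
  set β := 1 / q - 1 / 2 with hβ
  have hβ1 : β < 1 / 2 := by
    have : 1 / q < 1 := by rw [div_lt_one (by linarith)]; exact hq1
    rw [hβ]; linarith
  obtain ⟨n₁, hn1⟩ : ∃ n : ℕ, n = ⌊x₁ / 2⌋₊ + 1 := ⟨_, rfl⟩
  obtain ⟨n₃, hn3⟩ : ∃ n : ℕ, n = ⌊x₃ / 2⌋₊ + 1 := ⟨_, rfl⟩
  have hn1' : x₁ / 2 < n₁ := by rw [hn1]; push_cast; exact Nat.lt_floor_add_one _
  have hn3' : x₃ / 2 < n₃ := by rw [hn3]; push_cast; exact Nat.lt_floor_add_one _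
  obtain ⟨C₁, hC1, f1⟩ := frac' (ε := ε₁) hn1'
  obtain ⟨C₃, hC3, f3⟩ := frac' (ε := ε₃) hn3'
  obtain ⟨C₀, hC0, f0⟩ := atomA hp hq1 hq2 hpq (2 * n₁ + ε₁) (2 * n₃ + ε₃) (by omega) (by omega)
  obtain ⟨B₁, hB1, b1⟩ := beta_fin (κ := n₁ - x₁ / 2) (L := n₁ + (ε₁:ℝ) / 2 - β) (by linarith) (by linarith)
  obtain ⟨B₃, hB3, b3⟩ := beta_fin (κ := n₃ - x₃ / 2) (L := n₃ + (ε₃:ℝ) / 2 - β) (by linarith) (by linarith)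
  refine ⟨C₁ * C₃ * C₀ * B₁ * B₃, by positivity, ?_⟩
  intro ω S₁ c₁ S₃ c₃ hc1 hc3 ρ₁ ρ₃ hr1 hr3
  have r1 : 0 < ρ₁ := by linarith
  have r3 : 0 < ρ₃ := by linarith
  set w₁ : ℝ → ENNReal := fun η => ENNReal.ofReal (η ^ (n₁ - x₁ / 2 - 1) * (1 + η) ^ (-(n₁ + (ε₁:ℝ) / 2))) with hw1
  set w₃ : ℝ → ENNReal := fun η => ENNReal.ofReal (η ^ (n₃ - x₃ / 2 - 1) * (1 + η) ^ (-(n₃ + (ε₃:ℝ) / 2))) with hw3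
  set Φ₁ : ℝ × (ℝ × (ℝ × ℝ)) → ENNReal := fun p =>
    ENNReal.ofReal (Sq ω S₁ c₁ (2 * n₁ + ε₁) (ρ₁ * p.2.1 * (1 + p.1)) p.2.2) with hΦ1
  set Φ₃ : ℝ × (ℝ × (ℝ × ℝ)) → ENNReal := fun p =>
    ENNReal.ofReal (Sq ω S₃ c₃ (2 * n₃ + ε₃) (ρ₃ * p.2.1 * (1 + p.1)) p.2.2) with hΦ3
  set K := C₁ * C₃ * (ρ₁ ^ (-((x₁ + ε₁) / 2)) * ρ₃ ^ (-((x₃ + ε₃) / 2))) with hK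
  have hK0 : 0 < K := by positivity
  have hm1 : Measurable w₁ := by rw [hw1]; fun_prop
  have hm3 : Measurable w₃ := by rw [hw3]; fun_prop
  have hmΦ1 : Measurable Φ₁ := Sq_meas _ _ _ _ _
  have hmΦ3 : Measurable Φ₃ := Sq_meas _ _ _ _ _
  have s1 : ∫⁻ z, ENNReal.ofReal (z.1 ^ ((x₁ + ε₁) / 2 + (x₃ + ε₃) / 2 - 1)) *
      ‖Y ω S₁ c₁ x₁ ε₁ (ρ₁ * z.1) z.2‖ₑ * ‖Y ω S₃ c₃ x₃ ε₃ (ρ₃ * z.1) z.2‖ₑ ∂MM ≤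
      ∫⁻ z, ENNReal.ofReal K * (ENNReal.ofReal (z.1⁻¹) * (∫⁻ η in Ioi (0:ℝ), w₁ η * Φ₁ (η, z)) *
        (∫⁻ η in Ioi (0:ℝ), w₃ η * Φ₃ (η, z))) ∂MM := by
    refine MM_mono fun z hz => ?_
    have g1 := f1 ω S₁ c₁ (ρ₁ * z.1) (by positivity) z.2
    have g3 := f3 ω S₃ c₃ (ρ₃ * z.1) (by positivity) z.2
    refine (mul_le_mul' (mul_le_mul' le_rfl g1) g3).trans (le_of_eq ?_)
    have : ENNReal.ofReal (z.1 ^ ((x₁ + ε₁) / 2 + (x₃ + ε₃) / 2 - 1)) *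
        ENNReal.ofReal (C₁ * (ρ₁ * z.1) ^ (-((x₁ + ε₁) / 2))) *
        ENNReal.ofReal (C₃ * (ρ₃ * z.1) ^ (-((x₃ + ε₃) / 2))) =
        ENNReal.ofReal K * ENNReal.ofReal (z.1⁻¹) := by
      rw [← ENNReal.ofReal_mul (by positivity), ← ENNReal.ofReal_mul (by positivity),
        ← ENNReal.ofReal_mul (by positivity)]
      congr 1
      rw [Real.mul_rpow r1.le hz.le, Real.mul_rpow r3.le hz.le, hK, ← Real.rpow_neg_one]
      have : z.1 ^ ((x₁ + ε₁) / 2 + (x₃ + ε₃) / 2 - 1) * z.1 ^ (-((x₁ + ε₁) / 2)) *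
          z.1 ^ (-((x₃ + ε₃) / 2)) = z.1 ^ (-1:ℝ) := by
        rw [← Real.rpow_add hz, ← Real.rpow_add hz]; congr 1; ring
      rw [← this]; ring
    exact re1 this
  refine s1.trans ?_
  rw [lintegral_const_mul' _ _ ENNReal.ofReal_ne_top]
  have s2 := twofold (μ := MM) (G := fun z => ENNReal.ofReal (z.1⁻¹)) (w₁ := w₁) (w₃ := w₃)
    (a := fun η => ENNReal.ofReal (C₀ * (ρ₁ ^ β * ρ₃ ^ β) * (1 + η) ^ β))
    (b := fun η => ENNReal.ofReal ((1 + η) ^ β)) (Φ₁ := Φ₁) (Φ₃ := Φ₃)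
    (by fun_prop) hm1 hm3 hmΦ1 hmΦ3 (by fun_prop) (by fun_prop) (by
      intro η hη η' hη'
      have m1 : Measurable (fun z : ℝ × (ℝ × ℝ) => ENNReal.ofReal (z.1⁻¹) * Φ₁ (η, z) * Φ₃ (η', z)) := by
        fun_prop
      rw [MM_iter m1]
      refine le_trans (setLIntegral_mono' measurableSet_Ioi fun t ht => ?_)
        ((f0 ω S₁ c₁ S₃ c₃ hc1 hc3 (ρ₁ * (1 + η)) (ρ₃ * (1 + η')) (by nlinarith) (by nlinarith)).trans
          (le_of_eq ?_))
      · have ht0 : (0:ℝ) < t := ht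
        refine lintegral_mono fun y => le_of_eq ?_
        simp only [hΦ1, hΦ3]
        rw [← ENNReal.ofReal_mul (by positivity), ← ENNReal.ofReal_mul
          (mul_nonneg (by positivity) (Sq_nn _ _ _ _ _ _)), mul_assoc,
          show ρ₁ * t * (1 + η) = ρ₁ * (1 + η) * t by ring, show ρ₃ * t * (1 + η') = ρ₃ * (1 + η') * t by ring]
      · rw [← ENNReal.ofReal_mul (by positivity), Real.mul_rpow (by positivity) (by positivity),
          Real.mul_rpow (by positivity) (by positivity), Real.mul_rpow (by positivity) (by positivity)]
        congr 1; ring)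
  refine (mul_le_mul' le_rfl s2).trans ?_
  have i1 : ∫⁻ η in Ioi (0:ℝ), w₁ η * ENNReal.ofReal (C₀ * (ρ₁ ^ β * ρ₃ ^ β) * (1 + η) ^ β) ≤
      ENNReal.ofReal (C₀ * (ρ₁ ^ β * ρ₃ ^ β)) * ENNReal.ofReal B₁ := by
    refine le_trans ?_ (mul_le_mul' le_rfl b1)
    rw [← lintegral_const_mul' _ _ ENNReal.ofReal_ne_top]
    refine setLIntegral_mono' measurableSet_Ioi fun η hη => ?_
    have : (0:ℝ) < η := hη
    simp only [hw1]
    rw [← ENNReal.ofReal_mul (by positivity), ← ENNReal.ofReal_mul (by positivity),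
      show -((n₁:ℝ) + ε₁ / 2 - β) = -(n₁ + ε₁ / 2) + β by ring, Real.rpow_add (by positivity)]
    apply le_of_eq; congr 1; ring
  have i3 : ∫⁻ η in Ioi (0:ℝ), w₃ η * ENNReal.ofReal ((1 + η) ^ β) ≤ ENNReal.ofReal B₃ := by
    refine le_trans ?_ b3
    refine setLIntegral_mono' measurableSet_Ioi fun η hη => ?_
    have : (0:ℝ) < η := hη
    simp only [hw3]
    rw [← ENNReal.ofReal_mul (by positivity),
      show -((n₃:ℝ) + ε₃ / 2 - β) = -(n₃ + ε₃ / 2) + β by ring, Real.rpow_add (by positivity)]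
    apply le_of_eq; congr 1; ring
  refine (mul_le_mul' le_rfl (mul_le_mul' i1 i3)).trans (le_of_eq ?_)
  rw [← ENNReal.ofReal_mul (by positivity), ← ENNReal.ofReal_mul (by positivity),
    ← ENNReal.ofReal_mul (by positivity), Real.rpow_add r1, Real.rpow_add r3]
  congr 1
  rw [hK]; ring

/-- with a bounded third function -/
lemma BB {p q : ℝ} (hp : 2 ≤ p) (hq1 : 1 < q) (hq2 : q ≤ 2) (hpq : 1 / p + 1 / q = 1)
    (x₁ x₂ x₃ : ℝ) (ε₁ ε₂ ε₃ : ℕ) (h1 : 1 ≤ x₁ + ε₁) (h2 : 0 ≤ x₂) (h3 : 1 ≤ x₃ + ε₃) : ∃ C : ℝ, 0 < C ∧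
    ∀ ω S₁ c₁ S₂ c₂ S₃ c₃, ∫ x, ‖P S₁ c₁ x‖ ^ p ∂mT ≤ 1 → (∀ x, ‖P S₂ c₂ x‖ ≤ 1) →
      ∫ x, ‖P S₃ c₃ x‖ ^ q ∂mT ≤ 1 →
    ∀ ρ₁ ρ₃ : ℝ, 1 ≤ ρ₁ → 1 ≤ ρ₃ → ∀ e : ℝ,
    e = (x₁ + ε₁) / 2 + (x₂ + ε₂) / 2 + (x₃ + ε₃) / 2 - 1 →
    ∫⁻ z, ENNReal.ofReal (z.1 ^ e) *
      (‖Y ω S₁ c₁ x₁ ε₁ (ρ₁ * z.1) z.2‖ₑ * ‖Y ω S₂ c₂ x₂ ε₂ z.1 z.2‖ₑ *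
      ‖Y ω S₃ c₃ x₃ ε₃ (ρ₃ * z.1) z.2‖ₑ) ∂MM ≤
    ENNReal.ofReal (C * (ρ₁ ^ (-((x₁ + ε₁) / 2) + (1 / q - 1 / 2)) *
      ρ₃ ^ (-((x₃ + ε₃) / 2) + (1 / q - 1 / 2)))) := by
  obtain ⟨C, hC, hA⟩ := AA hp hq1 hq2 hpq x₁ x₃ ε₁ ε₃ h1 h3
  obtain ⟨C', hC', hs⟩ := supY h2 ε₂
  refine ⟨C' * C, by positivity, ?_⟩
  intro ω S₁ c₁ S₂ c₂ S₃ c₃ hc1 hc2 hc3 ρ₁ ρ₃ hr1 hr3 e he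
  rw [mul_assoc C', ENNReal.ofReal_mul hC'.le]
  refine le_trans ?_ (mul_le_mul' le_rfl (hA ω S₁ c₁ S₃ c₃ hc1 hc3 ρ₁ ρ₃ hr1 hr3))
  rw [← lintegral_const_mul' _ _ ENNReal.ofReal_ne_top]
  refine MM_mono fun z hz => ?_
  refine (mul_le_mul' le_rfl (mul_le_mul' (mul_le_mul' le_rfl (hs ω S₂ c₂ hc2 z.1 hz z.2)) le_rfl)).trans (le_of_eq ?_)
  have : ENNReal.ofReal (z.1 ^ e) * ENNReal.ofReal (C' * z.1 ^ (-((x₂ + ε₂) / 2))) =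
      ENNReal.ofReal C' * ENNReal.ofReal (z.1 ^ ((x₁ + ε₁) / 2 + (x₃ + ε₃) / 2 - 1)) := by
    rw [← ENNReal.ofReal_mul (by positivity), ← ENNReal.ofReal_mul (by positivity)]
    congr 1
    rw [mul_left_comm, ← Real.rpow_add hz]
    congr 2; rw [he]; ring
  exact re2 this

lemma CC {p q : ℝ} (hp : 2 ≤ p) (hq1 : 1 < q) (hq2 : q ≤ 2) (hpq : 1 / p + 1 / q = 1)
    (x₁ x₂ : ℝ) (h1 : 2 < x₁) (h2 : 2 < x₂) : ∃ C : ℝ, 0 < C ∧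
    ∀ ω S₁ c₁ S₂ c₂ S₃ c₃, ∫ x, ‖P S₁ c₁ x‖ ^ p ∂mT ≤ 1 → (∀ x, ‖P S₂ c₂ x‖ ≤ 1) →
      ∫ x, ‖P S₃ c₃ x‖ ^ q ∂mT ≤ 1 → ∀ e : ℝ, e = x₁ / 2 + x₂ / 2 - 1 →
    ∫⁻ z, ENNReal.ofReal (z.1 ^ e) *
      (‖Y ω S₁ c₁ x₁ 0 z.1 z.2‖ₑ * ‖Y ω S₂ c₂ x₂ 0 z.1 z.2‖ₑ *
      ‖Y ω S₃ c₃ 0 0 z.1 z.2‖ₑ) ∂MM ≤ ENNReal.ofReal C := by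
  obtain ⟨n₁, hn1⟩ : ∃ n : ℕ, n = ⌊x₁ / 2⌋₊ + 1 := ⟨_, rfl⟩
  obtain ⟨n₂, hn2⟩ : ∃ n : ℕ, n = ⌊x₂ / 2⌋₊ + 1 := ⟨_, rfl⟩
  have hn1' : x₁ / 2 < n₁ := by rw [hn1]; push_cast; exact Nat.lt_floor_add_one _
  have hn2' : x₂ / 2 < n₂ := by rw [hn2]; push_cast; exact Nat.lt_floor_add_one _
  obtain ⟨C₁, hC1, f1⟩ := frac' (ε := 0) hn1'
  obtain ⟨C₂, hC2, f2⟩ := frac' (ε := 0) hn2'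
  obtain ⟨C₀, hC0, f0⟩ := atomC hp hq1 hq2 hpq (2 * n₁ + 0) (2 * n₂ + 0) (by omega) (by omega)
  obtain ⟨B₁, hB1, b1⟩ := beta_fin (κ := n₁ - x₁ / 2) (L := n₁ - 1) (by linarith) (by linarith)
  obtain ⟨B₂, hB2, b2⟩ := beta_fin (κ := n₂ - x₂ / 2) (L := n₂ - 1) (by linarith) (by linarith)
  refine ⟨C₁ * C₂ * C₀ * B₁ * B₂, by positivity, ?_⟩
  intro ω S₁ c₁ S₂ c₂ S₃ c₃ hc1 hc2 hc3 e he
  set w₁ : ℝ → ENNReal := fun η => ENNReal.ofReal (η ^ (n₁ - x₁ / 2 - 1) * (1 + η) ^ (-(n₁ + ((0:ℕ):ℝ) / 2))) with hw1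
  set w₂ : ℝ → ENNReal := fun η => ENNReal.ofReal (η ^ (n₂ - x₂ / 2 - 1) * (1 + η) ^ (-(n₂ + ((0:ℕ):ℝ) / 2))) with hw2
  set Φ₁ : ℝ × (ℝ × (ℝ × ℝ)) → ENNReal := fun p =>
    ENNReal.ofReal (Sq ω S₁ c₁ (2 * n₁ + 0) (1 * p.2.1 * (1 + p.1)) p.2.2) with hΦ1
  set Φ₂ : ℝ × (ℝ × (ℝ × ℝ)) → ENNReal := fun p =>
    ENNReal.ofReal (Sq ω S₂ c₂ (2 * n₂ + 0) (1 * p.2.1 * (1 + p.1)) p.2.2) with hΦ2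
  set G : ℝ × (ℝ × ℝ) → ENNReal := fun z => ENNReal.ofReal (z.1⁻¹) *
    ENNReal.ofReal (Sq ω S₃ c₃ 0 z.1 z.2) with hG
  have hm1 : Measurable w₁ := by rw [hw1]; fun_prop
  have hm2 : Measurable w₂ := by rw [hw2]; fun_prop
  have hmΦ1 : Measurable Φ₁ := Sq_meas _ _ _ _ _
  have hmΦ2 : Measurable Φ₂ := Sq_meas _ _ _ _ _
  have hmG : Measurable G := by
    have := (Sq_cont ω S₃ c₃ 0).measurable
    rw [hG]; fun_prop
  have s1 : ∫⁻ z, ENNReal.ofReal (z.1 ^ e) *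
      (‖Y ω S₁ c₁ x₁ 0 z.1 z.2‖ₑ * ‖Y ω S₂ c₂ x₂ 0 z.1 z.2‖ₑ *
      ‖Y ω S₃ c₃ 0 0 z.1 z.2‖ₑ) ∂MM ≤
      ∫⁻ z, ENNReal.ofReal (C₁ * C₂) * (G z * (∫⁻ η in Ioi (0:ℝ), w₁ η * Φ₁ (η, z)) *
        (∫⁻ η in Ioi (0:ℝ), w₂ η * Φ₂ (η, z))) ∂MM := by
    refine MM_mono fun z hz => ?_
    have g1 := f1 ω S₁ c₁ (1 * z.1) (by positivity) z.2
    have g2 := f2 ω S₂ c₂ (1 * z.1) (by positivity) z.2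
    have g3 : ‖Y ω S₃ c₃ 0 0 z.1 z.2‖ₑ ≤ ENNReal.ofReal (Sq ω S₃ c₃ 0 z.1 z.2) := by
      rw [← ofReal_norm_eq_enorm]
      apply ENNReal.ofReal_le_ofReal
      have h1 := Y_int ω S₃ c₃ 0 0 hz z.2
      simpa using h1
    have this : ENNReal.ofReal (z.1 ^ e) *
        (ENNReal.ofReal (C₁ * (1 * z.1) ^ (-((x₁ + ((0:ℕ):ℝ)) / 2))) *
        ENNReal.ofReal (C₂ * (1 * z.1) ^ (-((x₂ + ((0:ℕ):ℝ)) / 2)))) =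
        ENNReal.ofReal (C₁ * C₂) * ENNReal.ofReal (z.1⁻¹) := by
      rw [one_mul, ← ENNReal.ofReal_mul (by positivity), ← ENNReal.ofReal_mul (by positivity),
        ← ENNReal.ofReal_mul (by positivity)]
      congr 1
      rw [← Real.rpow_neg_one]
      have : z.1 ^ e * z.1 ^ (-((x₁ + ((0:ℕ):ℝ)) / 2)) *
          z.1 ^ (-((x₂ + ((0:ℕ):ℝ)) / 2)) = z.1 ^ (-1:ℝ) := by
        rw [← Real.rpow_add hz, ← Real.rpow_add hz]; congr 1; rw [he]; push_cast; ring
      rw [← this]; ring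
    rw [one_mul] at g1 g2
    rw [one_mul] at this
    simp only [hG, hΦ1, hΦ2, one_mul]
    refine (mul_le_mul' le_rfl (mul_le_mul' (mul_le_mul' g1 g2) g3)).trans (le_of_eq ?_)
    exact re3 this
  refine s1.trans ?_
  rw [lintegral_const_mul' _ _ ENNReal.ofReal_ne_top]
  have s2 := twofold (μ := MM) (G := G) (w₁ := w₁) (w₃ := w₂)
    (a := fun η => ENNReal.ofReal (C₀ * (1 + η)))
    (b := fun η => ENNReal.ofReal (1 + η)) (Φ₁ := Φ₁) (Φ₃ := Φ₂)
    hmG hm1 hm2 hmΦ1 hmΦ2 (by fun_prop) (by fun_prop) (by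
      intro η hη η' hη'
      have m1 : Measurable (fun z : ℝ × (ℝ × ℝ) => G z * Φ₁ (η, z) * Φ₂ (η', z)) := by
        fun_prop
      rw [MM_iter m1]
      refine le_trans (setLIntegral_mono' measurableSet_Ioi fun t ht => ?_)
        ((f0 ω S₁ c₁ S₂ c₂ S₃ c₃ hc1 hc2 hc3 (1 + η) (1 + η') (by linarith) (by linarith)).trans
          (le_of_eq ?_))
      · have ht0 : (0:ℝ) < t := ht
        refine lintegral_mono fun y => le_of_eq ?_
        simp only [hΦ1, hΦ2, hG]
        have n1 := Sq_nn ω S₁ c₁ (2 * n₁ + 0) ((1 + η) * t) y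
        have n2 := Sq_nn ω S₂ c₂ (2 * n₂ + 0) ((1 + η') * t) y
        have n3 := Sq_nn ω S₃ c₃ 0 t y
        rw [show 1 * t * (1 + η) = (1 + η) * t by ring, show 1 * t * (1 + η') = (1 + η') * t by ring,
          ← ENNReal.ofReal_mul (by positivity), ← ENNReal.ofReal_mul (by positivity),
          ← ENNReal.ofReal_mul (by positivity)]
        congr 1; ring
      · rw [← ENNReal.ofReal_mul (by positivity)]
        congr 1; ring)
  refine (mul_le_mul' le_rfl s2).trans ?_
  have i1 : ∫⁻ η in Ioi (0:ℝ), w₁ η * ENNReal.ofReal (C₀ * (1 + η)) ≤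
      ENNReal.ofReal C₀ * ENNReal.ofReal B₁ := by
    refine le_trans ?_ (mul_le_mul' le_rfl b1)
    rw [← lintegral_const_mul' _ _ ENNReal.ofReal_ne_top]
    refine setLIntegral_mono' measurableSet_Ioi fun η hη => ?_
    have : (0:ℝ) < η := hη
    simp only [hw1]
    rw [← ENNReal.ofReal_mul (by positivity), ← ENNReal.ofReal_mul (by positivity),
      show -((n₁:ℝ) - 1) = -(n₁ + ((0:ℕ):ℝ) / 2) + 1 by push_cast; ring, Real.rpow_add (by positivity),
      Real.rpow_one]
    apply le_of_eq; congr 1; ring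
  have i3 : ∫⁻ η in Ioi (0:ℝ), w₂ η * ENNReal.ofReal (1 + η) ≤ ENNReal.ofReal B₂ := by
    refine le_trans ?_ b2
    refine setLIntegral_mono' measurableSet_Ioi fun η hη => ?_
    have : (0:ℝ) < η := hη
    simp only [hw2]
    rw [← ENNReal.ofReal_mul (by positivity),
      show -((n₂:ℝ) - 1) = -(n₂ + ((0:ℕ):ℝ) / 2) + 1 by push_cast; ring, Real.rpow_add (by positivity),
      Real.rpow_one]
    apply le_of_eq; congr 1; ring
  refine (mul_le_mul' le_rfl (mul_le_mul' i1 i3)).trans (le_of_eq ?_)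
  rw [← ENNReal.ofReal_mul (by positivity), ← ENNReal.ofReal_mul (by positivity),
    ← ENNReal.ofReal_mul (by positivity)]
  congr 1
  ring

end

end KP

set_option linter.all false
open MeasureTheory Set
namespace KP

noncomputable section

abbrev Z2 := ℤ × ℤ

/-- zero-sum triples -/
def ZZ (S₁ S₂ S₃ : Finset Z2) : Finset (Z2 × Z2 × Z2) :=
  (S₁ ×ˢ S₂ ×ˢ S₃).filter (fun k => k.1 + k.2.1 + k.2.2 = 0)

/-- multiplier of `Y` -/
def ys (ω : ℝ × ℝ) (x : ℝ) (ε : ℕ) (t : ℝ) (n : Z2) : ℝ :=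
  (1 + fr ω n ^ 2) ^ (x / 2) * fr ω n ^ ε * Real.exp (-(t * (fr ω n ^ 2 + 1 / 2)))

lemma Y_eq (ω S c x ε t y) : Y ω S c x ε t y = P S (fun n => c n * (ys ω x ε t n : ℂ)) y := rfl

lemma tri_prod (S₁ S₂ S₃ : Finset Z2) (u₁ u₂ u₃ : Z2 → ℂ) :
    ∑ k ∈ ZZ S₁ S₂ S₃, u₁ k.1 * u₂ k.2.1 * u₃ k.2.2 =
    ∫ y, P S₁ u₁ y * P S₂ u₂ y * P S₃ u₃ y ∂mT := by
  have e : ∀ y, P S₁ u₁ y * P S₂ u₂ y * P S₃ u₃ y = ∑ k ∈ S₁ ×ˢ S₂ ×ˢ S₃,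
      u₁ k.1 * u₂ k.2.1 * u₃ k.2.2 * ch (k.1 + k.2.1 + k.2.2) y := by
    intro y
    unfold P
    rw [mul_assoc, Finset.sum_mul_sum, Finset.sum_mul_sum, Finset.sum_product]
    simp_rw [Finset.sum_product, Finset.mul_sum]
    refine Finset.sum_congr rfl fun a _ => Finset.sum_congr rfl fun b _ =>
      Finset.sum_congr rfl fun d _ => ?_
    rw [← ch_mul, ← ch_mul]; ring
  simp_rw [e]
  rw [integral_finsetSum _ (fun k _ => (mT_integrable (ch_cont _)).const_mul _)]
  simp_rw [integral_const_mul, ch_int]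
  rw [ZZ, Finset.sum_filter]
  refine Finset.sum_congr rfl fun k _ => ?_
  split_ifs <;> simp

lemma tri_bound (ω) (S₁ S₂ S₃ : Finset Z2) (c₁ c₂ c₃ : Z2 → ℂ) (x₁ x₂ x₃ : ℝ) (ε₁ ε₂ ε₃ : ℕ) (t₁ t₂ t₃ : ℝ) :
    ‖∑ k ∈ ZZ S₁ S₂ S₃, c₁ k.1 * c₂ k.2.1 * c₃ k.2.2 *
      ((ys ω x₁ ε₁ t₁ k.1 * ys ω x₂ ε₂ t₂ k.2.1 * ys ω x₃ ε₃ t₃ k.2.2 : ℝ) : ℂ)‖ₑ ≤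
    ∫⁻ y, ‖Y ω S₁ c₁ x₁ ε₁ t₁ y‖ₑ * ‖Y ω S₂ c₂ x₂ ε₂ t₂ y‖ₑ * ‖Y ω S₃ c₃ x₃ ε₃ t₃ y‖ₑ ∂mT := by
  have h := tri_prod S₁ S₂ S₃ (fun n => c₁ n * (ys ω x₁ ε₁ t₁ n : ℂ)) (fun n => c₂ n * (ys ω x₂ ε₂ t₂ n : ℂ))
    (fun n => c₃ n * (ys ω x₃ ε₃ t₃ n : ℂ))
  have e : ∑ k ∈ ZZ S₁ S₂ S₃, c₁ k.1 * c₂ k.2.1 * c₃ k.2.2 *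
      ((ys ω x₁ ε₁ t₁ k.1 * ys ω x₂ ε₂ t₂ k.2.1 * ys ω x₃ ε₃ t₃ k.2.2 : ℝ) : ℂ) =
      ∫ y, Y ω S₁ c₁ x₁ ε₁ t₁ y * Y ω S₂ c₂ x₂ ε₂ t₂ y * Y ω S₃ c₃ x₃ ε₃ t₃ y ∂mT := by
    simp_rw [Y_eq]
    rw [← h]
    refine Finset.sum_congr rfl fun k _ => ?_
    push_cast; ring
  rw [e]
  refine (enorm_integral_le_lintegral_enorm _).trans (le_of_eq ?_)
  simp_rw [enorm_mul]

lemma P_smul (S : Finset Z2) (c : Z2 → ℂ) (a : ℝ) (y) : P S (fun n => (a:ℂ) * c n) y = a * P S c y := by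
  unfold P; rw [Finset.mul_sum]; simp_rw [mul_assoc]

lemma Y_smul (ω) (S : Finset Z2) (c : Z2 → ℂ) (a : ℝ) (x ε t y) :
    Y ω S (fun n => (a:ℂ) * c n) x ε t y = a * Y ω S c x ε t y := by
  unfold Y; rw [Finset.mul_sum]; simp_rw [mul_assoc]

lemma Y_sc (ω) (S : Finset Z2) (c : Z2 → ℂ) {a : ℝ} (ha : 0 < a) (x ε t y) :
    ‖Y ω S c x ε t y‖ₑ = ENNReal.ofReal a * ‖Y ω S (fun n => ((a⁻¹:ℝ):ℂ) * c n) x ε t y‖ₑ := by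
  rw [Y_smul, enorm_mul, ← mul_assoc]
  have : ENNReal.ofReal a * ‖((a⁻¹ : ℝ) : ℂ)‖ₑ = 1 := by
    rw [← ofReal_norm_eq_enorm, Complex.norm_real, Real.norm_of_nonneg (by positivity),
      ← ENNReal.ofReal_mul ha.le, mul_inv_cancel₀ ha.ne', ENNReal.ofReal_one]
  rw [this, one_mul]

lemma Lp_sc {S : Finset Z2} {c : Z2 → ℂ} {a p : ℝ} (ha : 0 < a)
    (h : ∫ x, ‖P S c x‖ ^ p ∂mT ≤ a ^ p) : ∫ x, ‖P S (fun n => ((a⁻¹:ℝ):ℂ) * c n) x‖ ^ p ∂mT ≤ 1 := by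
  have e : ∀ x, ‖P S (fun n => ((a⁻¹:ℝ):ℂ) * c n) x‖ ^ p = (a ^ p)⁻¹ * ‖P S c x‖ ^ p := by
    intro x
    rw [P_smul, norm_mul, Complex.norm_real, Real.norm_of_nonneg (by positivity),
      Real.mul_rpow (by positivity) (by positivity), Real.inv_rpow ha.le]
  simp_rw [e]
  rw [integral_const_mul]
  have : 0 < a ^ p := by positivity
  rw [inv_mul_le_iff₀ this]; linarith

lemma sup_sc {S : Finset Z2} {c : Z2 → ℂ} {a : ℝ} (ha : 0 < a)
    (h : ∀ x, ‖P S c x‖ ≤ a) (x) : ‖P S (fun n => ((a⁻¹:ℝ):ℂ) * c n) x‖ ≤ 1 := by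
  rw [P_smul, norm_mul, Complex.norm_real, Real.norm_of_nonneg (by positivity), inv_mul_le_iff₀ ha]
  linarith [h x]

lemma re4 {a b c d e f g : ENNReal} : a * (b * e * (c * f) * (d * g)) = (b * c * d) * (a * (e * f * g)) := by ring

lemma Ym (ω S c x ε) (ρ : ℝ) : Measurable (fun z : ℝ × (ℝ × ℝ) => ‖Y ω S c x ε (ρ * z.1) z.2‖ₑ) := by
  have h := (Y_cont ω S c x ε).comp (show Continuous (fun z : ℝ × (ℝ × ℝ) => (ρ * z.1, z.2)) by fun_prop)
  exact h.measurable.enorm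

lemma PB1 {p q : ℝ} (hp : 2 ≤ p) (hq1 : 1 < q) (hq2 : q ≤ 2) (hpq : 1 / p + 1 / q = 1)
    (x₁ x₂ x₃ : ℝ) (ε₁ ε₂ ε₃ : ℕ) (h1 : 1 ≤ x₁ + ε₁) (h2 : 0 ≤ x₂) (h3 : 1 ≤ x₃ + ε₃) : ∃ C : ℝ, 0 < C ∧
    ∀ ω S₁ c₁ S₂ c₂ S₃ c₃, ∀ a₁ a₂ a₃ : ℝ, 0 < a₁ → 0 < a₂ → 0 < a₃ →
      ∫ x, ‖P S₁ c₁ x‖ ^ p ∂mT ≤ a₁ ^ p → (∀ x, ‖P S₂ c₂ x‖ ≤ a₂) →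
      ∫ x, ‖P S₃ c₃ x‖ ^ q ∂mT ≤ a₃ ^ q → ∀ ρ₁ ρ₃ : ℝ, 1 ≤ ρ₁ → 1 ≤ ρ₃ → ∀ e : ℝ,
    e = (x₁ + ε₁) / 2 + (x₂ + ε₂) / 2 + (x₃ + ε₃) / 2 - 1 →
    ∫⁻ z, ENNReal.ofReal (z.1 ^ e) *
      (‖Y ω S₁ c₁ x₁ ε₁ (ρ₁ * z.1) z.2‖ₑ * ‖Y ω S₂ c₂ x₂ ε₂ (1 * z.1) z.2‖ₑ *
      ‖Y ω S₃ c₃ x₃ ε₃ (ρ₃ * z.1) z.2‖ₑ) ∂MM ≤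
    ENNReal.ofReal (C * (ρ₁ ^ (-((x₁ + ε₁) / 2) + (1 / q - 1 / 2)) *
      ρ₃ ^ (-((x₃ + ε₃) / 2) + (1 / q - 1 / 2))) * (a₁ * a₂ * a₃)) := by
  obtain ⟨C, hC, h⟩ := BB hp hq1 hq2 hpq x₁ x₂ x₃ ε₁ ε₂ ε₃ h1 h2 h3
  refine ⟨C, hC, fun ω S₁ c₁ S₂ c₂ S₃ c₃ a₁ a₂ a₃ ha1 ha2 ha3 hc1 hc2 hc3 ρ₁ ρ₃ hr1 hr3 e he => ?_⟩
  have := h ω S₁ _ S₂ _ S₃ _ (Lp_sc ha1 hc1) (sup_sc ha2 hc2) (Lp_sc ha3 hc3) ρ₁ ρ₃ hr1 hr3 e he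
  simp_rw [Y_sc ω S₁ c₁ ha1, Y_sc ω S₂ c₂ ha2, Y_sc ω S₃ c₃ ha3, re4, one_mul]
  have hne : ENNReal.ofReal a₁ * ENNReal.ofReal a₂ * ENNReal.ofReal a₃ ≠ ⊤ := by
    simp [ENNReal.mul_eq_top]
  rw [lintegral_const_mul' _ _ hne]
  refine (mul_le_mul' le_rfl this).trans (le_of_eq ?_)
  rw [← ENNReal.ofReal_mul (by positivity), ← ENNReal.ofReal_mul (by positivity), ← ENNReal.ofReal_mul (by positivity),
    mul_comm]

lemma PC1 {p q : ℝ} (hp : 2 ≤ p) (hq1 : 1 < q) (hq2 : q ≤ 2) (hpq : 1 / p + 1 / q = 1)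
    (x₁ x₂ : ℝ) (h1 : 2 < x₁) (h2 : 2 < x₂) : ∃ C : ℝ, 0 < C ∧
    ∀ ω S₁ c₁ S₂ c₂ S₃ c₃, ∀ a₁ a₂ a₃ : ℝ, 0 < a₁ → 0 < a₂ → 0 < a₃ →
      ∫ x, ‖P S₁ c₁ x‖ ^ p ∂mT ≤ a₁ ^ p → (∀ x, ‖P S₂ c₂ x‖ ≤ a₂) →
      ∫ x, ‖P S₃ c₃ x‖ ^ q ∂mT ≤ a₃ ^ q → ∀ e : ℝ, e = x₁ / 2 + x₂ / 2 - 1 →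
    ∫⁻ z, ENNReal.ofReal (z.1 ^ e) *
      (‖Y ω S₁ c₁ x₁ 0 z.1 z.2‖ₑ * ‖Y ω S₂ c₂ x₂ 0 z.1 z.2‖ₑ *
      ‖Y ω S₃ c₃ 0 0 z.1 z.2‖ₑ) ∂MM ≤ ENNReal.ofReal (C * (a₁ * a₂ * a₃)) := by
  obtain ⟨C, hC, h⟩ := CC hp hq1 hq2 hpq x₁ x₂ h1 h2
  refine ⟨C, hC, fun ω S₁ c₁ S₂ c₂ S₃ c₃ a₁ a₂ a₃ ha1 ha2 ha3 hc1 hc2 hc3 e he => ?_⟩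
  have := h ω S₁ _ S₂ _ S₃ _ (Lp_sc ha1 hc1) (sup_sc ha2 hc2) (Lp_sc ha3 hc3) e he
  simp_rw [Y_sc ω S₁ c₁ ha1, Y_sc ω S₂ c₂ ha2, Y_sc ω S₃ c₃ ha3, re4]
  have hne : ENNReal.ofReal a₁ * ENNReal.ofReal a₂ * ENNReal.ofReal a₃ ≠ ⊤ := by
    simp [ENNReal.mul_eq_top]
  rw [lintegral_const_mul' _ _ hne]
  refine (mul_le_mul' le_rfl this).trans (le_of_eq ?_)
  rw [← ENNReal.ofReal_mul (by positivity), ← ENNReal.ofReal_mul (by positivity), ← ENNReal.ofReal_mul (by positivity),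
    mul_comm]

/-- trilinear sums -/
def TT (ω : ℝ × ℝ) (S₁ S₂ S₃ : Finset Z2) (c₁ c₂ c₃ : Z2 → ℂ) (x₁ x₂ x₃ : ℝ) (ε₁ ε₂ ε₃ : ℕ) (t₁ t₂ t₃ : ℝ) : ℂ :=
  ∑ k ∈ ZZ S₁ S₂ S₃, c₁ k.1 * c₂ k.2.1 * c₃ k.2.2 *
      ((ys ω x₁ ε₁ t₁ k.1 * ys ω x₂ ε₂ t₂ k.2.1 * ys ω x₃ ε₃ t₃ k.2.2 : ℝ) : ℂ)

lemma TT_MM (ω) (S₁ S₂ S₃ : Finset Z2) (c₁ c₂ c₃ : Z2 → ℂ) (x₁ x₂ x₃ : ℝ) (ε₁ ε₂ ε₃ : ℕ) (ρ₁ ρ₂ ρ₃ e : ℝ) :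
    ∫⁻ t in Ioi (0:ℝ), ENNReal.ofReal (t ^ e) *
      ‖TT ω S₁ S₂ S₃ c₁ c₂ c₃ x₁ x₂ x₃ ε₁ ε₂ ε₃ (ρ₁ * t) (ρ₂ * t) (ρ₃ * t)‖ₑ ≤
    ∫⁻ z, ENNReal.ofReal (z.1 ^ e) *
      (‖Y ω S₁ c₁ x₁ ε₁ (ρ₁ * z.1) z.2‖ₑ * ‖Y ω S₂ c₂ x₂ ε₂ (ρ₂ * z.1) z.2‖ₑ *
      ‖Y ω S₃ c₃ x₃ ε₃ (ρ₃ * z.1) z.2‖ₑ) ∂MM := by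
  have m1 := Ym ω S₁ c₁ x₁ ε₁ ρ₁
  have m2 := Ym ω S₂ c₂ x₂ ε₂ ρ₂
  have m3 := Ym ω S₃ c₃ x₃ ε₃ ρ₃
  rw [MM_iter (by fun_prop)]
  refine lintegral_mono fun t => ?_
  dsimp only
  rw [lintegral_const_mul' _ _ ENNReal.ofReal_ne_top]
  exact mul_le_mul' le_rfl (tri_bound _ _ _ _ _ _ _ _ _ _ _ _ _ _ _ _)

/-- negative powers as superpositions of exponentials -/
lemma gamma_super {ι : Type*} (Q : Finset ι) (a : ι → ℂ) (l : ι → ℝ) (hl : ∀ k ∈ Q, 0 < l k) {κ t : ℝ}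
    (hκ : 0 < κ) (ht : 0 < t) :
    ‖∑ k ∈ Q, a k * ((l k ^ (-κ) : ℝ) : ℂ)‖ₑ ≤ ENNReal.ofReal ((Real.Gamma κ)⁻¹ * t ^ κ) *
      ∫⁻ η in Ioi (0:ℝ), ENNReal.ofReal (η ^ (κ - 1)) * ‖∑ k ∈ Q, a k * (Real.exp (-(η * t * l k)) : ℂ)‖ₑ := by
  have hG := Real.Gamma_pos_of_pos hκ
  have e : ∑ k ∈ Q, a k * ((l k ^ (-κ) : ℝ) : ℂ) = (((Real.Gamma κ)⁻¹ * t ^ κ : ℝ) : ℂ) *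
      ∫ η in Ioi (0:ℝ), ((η ^ (κ - 1) : ℝ) : ℂ) * ∑ k ∈ Q, a k * (Real.exp (-(η * t * l k)) : ℂ) := by
    have e0 : ∀ η : ℝ, ((η ^ (κ - 1) : ℝ) : ℂ) * ∑ k ∈ Q, a k * (Real.exp (-(η * t * l k)) : ℂ) =
        ∑ k ∈ Q, a k * ((η ^ (κ - 1) * Real.exp (-((t * l k) * η)) : ℝ) : ℂ) := by
      intro η
      rw [Finset.mul_sum]
      refine Finset.sum_congr rfl fun k _ => ?_
      rw [show -(η * t * l k) = -((t * l k) * η) by ring, Complex.ofReal_mul]; ring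
    simp_rw [e0]
    rw [integral_finsetSum, Finset.mul_sum]
    · refine Finset.sum_congr rfl fun k hk => ?_
      have := hl k hk
      rw [integral_const_mul, integral_complex_ofReal,
        Real.integral_rpow_mul_exp_neg_mul_Ioi hκ (by positivity)]
      have e6 : (1 / (t * l k)) ^ κ = t ^ (-κ) * (l k) ^ (-κ) := by
        rw [one_div, Real.inv_rpow (by positivity), ← Real.rpow_neg (by positivity),
          Real.mul_rpow ht.le this.le]
      have e7 : t ^ κ * t ^ (-κ) = 1 := by rw [← Real.rpow_add ht]; simp
      have e9 : l k ^ (-κ) = ((Real.Gamma κ)⁻¹ * t ^ κ) * ((1 / (t * l k)) ^ κ * Real.Gamma κ) := by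
        rw [e6]
        calc l k ^ (-κ) = (l k ^ (-κ)) * ((Real.Gamma κ)⁻¹ * Real.Gamma κ) * (t ^ κ * t ^ (-κ)) := by
              rw [e7, inv_mul_cancel₀ hG.ne']; ring
          _ = _ := by ring
      rw [e9, Complex.ofReal_mul ((Real.Gamma κ)⁻¹ * t ^ κ)]; ring
    · intro k hk
      have := hl k hk
      exact ((gam_int hκ (show 0 < t * l k by positivity)).ofReal).const_mul _
  rw [e, enorm_mul, ← ofReal_norm_eq_enorm ((((Real.Gamma κ)⁻¹ * t ^ κ : ℝ) : ℂ)), Complex.norm_real,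
    Real.norm_of_nonneg (by positivity)]
  refine mul_le_mul' le_rfl ((enorm_integral_le_lintegral_enorm _).trans ?_)
  refine setLIntegral_mono' measurableSet_Ioi fun η hη => ?_
  have : (0:ℝ) < η := hη
  rw [enorm_mul, ← ofReal_norm_eq_enorm ((η ^ (κ - 1) : ℝ) : ℂ), Complex.norm_real,
    Real.norm_of_nonneg (by positivity)]

lemma ftc {B C s : ℝ} (hB : 0 < B) (hC : 0 < C) :
    C ^ s - B ^ s = ∫ θ in (0:ℝ)..1, s * (C - B) * (θ * C + (1 - θ) * B) ^ (s - 1) := by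
  have hpos : ∀ θ ∈ uIcc (0:ℝ) 1, 0 < θ * C + (1 - θ) * B := by
    intro θ hθ
    rw [uIcc_of_le zero_le_one] at hθ
    rcases eq_or_lt_of_le hθ.1 with h | h
    · rw [← h]; simpa using hB
    · have : 0 ≤ 1 - θ := by linarith [hθ.2]
      positivity
  rw [intervalIntegral.integral_eq_sub_of_hasDerivAt (f := fun θ => (θ * C + (1 - θ) * B) ^ s)]
  · simp
  · intro θ hθ
    have h1 : HasDerivAt (fun θ : ℝ => θ * C + (1 - θ) * B) (C - B) θ := by
      have := ((hasDerivAt_id θ).mul_const C).add (((hasDerivAt_id θ).const_sub 1).mul_const B)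
      exact this.congr_deriv (by ring)
    exact (h1.rpow_const (p := s) (Or.inl (hpos θ hθ).ne')).congr_deriv (by ring)
  · apply ContinuousOn.intervalIntegrable
    intro θ hθ
    apply ContinuousAt.continuousWithinAt
    have : ContinuousAt (fun θ : ℝ => (θ * C + (1 - θ) * B) ^ (s - 1)) θ :=
      ContinuousAt.rpow_const (by fun_prop) (Or.inl (hpos θ hθ).ne')
    exact continuousAt_const.mul this

lemma theta_super {ι : Type*} (Q : Finset ι) (a : ι → ℂ) (b c : ι → ℝ) (hb : ∀ k ∈ Q, 0 < b k)
    (hc : ∀ k ∈ Q, 0 < c k) {s : ℝ} (hs : 0 < s) :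
    ‖∑ k ∈ Q, a k * ((c k ^ s - b k ^ s : ℝ) : ℂ)‖ₑ ≤ ENNReal.ofReal s *
      ∫⁻ θ in Ioc (0:ℝ) 1, ‖∑ k ∈ Q, a k * (((c k - b k) * (θ * c k + (1 - θ) * b k) ^ (s - 1) : ℝ) : ℂ)‖ₑ := by
  have e : ∑ k ∈ Q, a k * ((c k ^ s - b k ^ s : ℝ) : ℂ) = (s : ℂ) * ∫ θ in Ioc (0:ℝ) 1,
      ∑ k ∈ Q, a k * (((c k - b k) * (θ * c k + (1 - θ) * b k) ^ (s - 1) : ℝ) : ℂ) := by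
    rw [integral_finsetSum, Finset.mul_sum]
    · refine Finset.sum_congr rfl fun k hk => ?_
      rw [integral_const_mul, integral_complex_ofReal, ftc (hb k hk) (hc k hk),
        intervalIntegral.integral_of_le zero_le_one]
      simp_rw [mul_assoc s]
      rw [integral_const_mul]
      push_cast; ring
    · intro k hk
      refine Integrable.const_mul (Integrable.ofReal ?_) _
      refine IntegrableOn.mono_set (t := Icc 0 1) ?_ Ioc_subset_Icc_self
      apply ContinuousOn.integrableOn_compact isCompact_Icc
      intro θ hθ
      apply ContinuousAt.continuousWithinAt
      have hpos : 0 < θ * c k + (1 - θ) * b k := by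
        have h1 := hb k hk
        have h2 := hc k hk
        rcases eq_or_lt_of_le hθ.1 with h | h
        · rw [← h]; simpa using h1
        · have : 0 ≤ 1 - θ := by linarith [hθ.2]
          positivity
      have : ContinuousAt (fun θ : ℝ => (θ * c k + (1 - θ) * b k) ^ (s - 1)) θ :=
        ContinuousAt.rpow_const (by fun_prop) (Or.inl hpos.ne')
      exact continuousAt_const.mul this
  rw [e, enorm_mul, ← ofReal_norm_eq_enorm (s:ℂ), Complex.norm_real, Real.norm_of_nonneg hs.le]
  exact mul_le_mul' le_rfl (enorm_integral_le_lintegral_enorm _)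

end

end KP

set_option linter.all false
open MeasureTheory Set
namespace KP

noncomputable section

lemma conv_int {Ψ : ℝ → ENNReal} (hΨ : Measurable Ψ) :
    ∫⁻ r in Ioi (0:ℝ), ∫⁻ r' in Ioi (0:ℝ), Ψ (r + r') = ∫⁻ t in Ioi (0:ℝ), ENNReal.ofReal t * Ψ t := by
  have hm : MeasurableSet {p : ℝ × ℝ | 0 < p.1 ∧ p.1 < p.2} :=
    (measurableSet_lt measurable_const measurable_fst).inter (measurableSet_lt measurable_fst measurable_snd)
  have e1 : ∀ r, ∫⁻ r' in Ioi (0:ℝ), Ψ (r + r') = ∫⁻ u, (Ioi r).indicator Ψ u := by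
    intro r
    rw [← lintegral_indicator measurableSet_Ioi, ← lintegral_add_left_eq_self (fun u => (Ioi r).indicator Ψ u) r]
    congr 1; ext u
    by_cases h : 0 < u <;> simp [indicator, h]
  simp_rw [e1]
  rw [← lintegral_indicator measurableSet_Ioi, ← lintegral_indicator measurableSet_Ioi]
  have e2 : ∀ r, (Ioi (0:ℝ)).indicator (fun r => ∫⁻ u, (Ioi r).indicator Ψ u) r =
      ∫⁻ u, {p : ℝ × ℝ | 0 < p.1 ∧ p.1 < p.2}.indicator (fun p => Ψ p.2) (r, u) := by
    intro r
    by_cases h : 0 < r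
    · simp only [indicator, mem_Ioi, h, if_true, mem_setOf_eq, true_and]
    · simp [indicator, h]
  simp_rw [e2]
  rw [lintegral_lintegral_swap]
  · congr 1; ext u
    have e3 : ∀ r, {p : ℝ × ℝ | 0 < p.1 ∧ p.1 < p.2}.indicator (fun p => Ψ p.2) (r, u) =
        (Ioo 0 u).indicator (fun _ => Ψ u) r := by
      intro r
      simp [indicator]
    simp_rw [e3]
    rw [lintegral_indicator measurableSet_Ioo, setLIntegral_const, Real.volume_Ioo, sub_zero, mul_comm]
    by_cases h : 0 < u
    · simp [indicator, h]
    · simp only [indicator, mem_Ioi, h, if_false]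
      rw [ENNReal.ofReal_of_nonpos (by linarith), zero_mul]
  · apply Measurable.aemeasurable
    simp only [Function.uncurry_def]
    exact (hΨ.comp measurable_snd).indicator hm

lemma enorm_le_of {x y : ℂ} {r : ℝ} (hr : 0 ≤ r) (h : x = (r : ℂ) * y) {R : ℝ} (hR : r ≤ R) :
    ‖x‖ₑ ≤ ENNReal.ofReal R * ‖y‖ₑ := by
  rw [h, enorm_mul, ← ofReal_norm_eq_enorm (r:ℂ), Complex.norm_real, Real.norm_of_nonneg hr]
  exact mul_le_mul' (ENNReal.ofReal_le_ofReal hR) le_rfl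

lemma re5 {a b c n : ENNReal} : a * (b * (c * n)) = (a * b * c) * n := by ring

lemma re6 {a b n : ENNReal} : a * (b * n) = (a * b) * n := by ring

lemma repro (m : ℕ) (hm : 1 ≤ m) : ∃ K : ℝ, 0 < K ∧ ∀ (Q : Finset (Z2 × Z2 × Z2)) (v : Z2 × Z2 × Z2 → ℂ)
    (a b c : Z2 × Z2 × Z2 → ℝ), (∀ k ∈ Q, a k + b k + c k = 0) → ∀ D : ENNReal,
    (∀ i j l, i + j + l = m → ∫⁻ t in Ioi (0:ℝ), ENNReal.ofReal (t ^ (2 * (m:ℝ) - 1)) *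
      ‖∑ k ∈ Q, v k * (((1 + a k ^ 2) ^ (i + l) * (1 + b k ^ 2) ^ (i + j) * (1 + c k ^ 2) ^ (j + l) *
        Real.exp (-(t * (a k ^ 2 + b k ^ 2 + c k ^ 2 + 3 / 2))) : ℝ) : ℂ)‖ₑ ≤ D) →
    ‖∑ k ∈ Q, v k‖ₑ ≤ ENNReal.ofReal K * D := by
  have hm0 : (0:ℝ) < m := by exact_mod_cast hm
  have hG := Real.Gamma_pos_of_pos hm0
  set G := (Real.Gamma (m:ℝ))⁻¹ * (1:ℝ) ^ (m:ℝ) with hGd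
  have hG0 : 0 < G := by positivity
  refine ⟨G * (G * 4 ^ m) * 3 ^ m, by positivity, ?_⟩
  intro Q v a b c habc D hD
  set q : Z2 × Z2 × Z2 → ℝ := fun k => a k ^ 2 + b k ^ 2 + c k ^ 2 + 3 / 2 with hq
  set W : Z2 × Z2 × Z2 → ℝ := fun k => (1 + a k ^ 2) * (1 + b k ^ 2) + ((1 + b k ^ 2) * (1 + c k ^ 2) +
    (1 + c k ^ 2) * (1 + a k ^ 2)) with hW
  set N : ℝ → ℂ := fun t => ∑ k ∈ Q, v k * ((W k ^ m * Real.exp (-(t * q k)) : ℝ) : ℂ) with hN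
  have hq0 : ∀ k, 0 < q k := fun k => by simp only [hq]; positivity
  have hNc : Continuous N := by
    rw [hN]; fun_prop
  have alg : ∀ k ∈ Q, (1:ℝ) = 4 ^ m * W k ^ m * (q k + 9 / 2) ^ (-(m:ℝ)) * (q k + 1 / 2) ^ (-(m:ℝ)) := by
    intro k hk
    have hk0 := hq0 k
    have h1 : 4 * W k = (q k + 9 / 2) * (q k + 1 / 2) := by
      have : c k = - (a k + b k) := by linarith [habc k hk]
      simp only [hW, hq, this]; ring
    rw [Real.rpow_neg (by positivity), Real.rpow_neg (by positivity), Real.rpow_natCast, Real.rpow_natCast,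
      ← mul_pow, h1, mul_pow]
    field_simp
  have s1 : ‖∑ k ∈ Q, v k‖ₑ ≤ ENNReal.ofReal G * ∫⁻ r in Ioi (0:ℝ), ENNReal.ofReal (r ^ ((m:ℝ) - 1)) *
      (ENNReal.ofReal G * ∫⁻ r' in Ioi (0:ℝ), ENNReal.ofReal (r' ^ ((m:ℝ) - 1)) *
        (ENNReal.ofReal (4 ^ m) * ‖N (r + r')‖ₑ)) := by
    have e1 : ∑ k ∈ Q, v k = ∑ k ∈ Q, (v k * ((4 ^ m * W k ^ m * (q k + 9 / 2) ^ (-(m:ℝ)) : ℝ) : ℂ)) *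
        (((q k + 1 / 2) ^ (-(m:ℝ)) : ℝ) : ℂ) := by
      refine Finset.sum_congr rfl fun k hk => ?_
      rw [mul_assoc, ← Complex.ofReal_mul, ← alg k hk]; simp
    rw [e1]
    refine (gamma_super Q _ (fun k => q k + 1 / 2) (fun k _ => by have := hq0 k; positivity) hm0 one_pos).trans ?_
    refine mul_le_mul' le_rfl (setLIntegral_mono' measurableSet_Ioi fun r hr => mul_le_mul' le_rfl ?_)
    have hr0 : (0:ℝ) < r := hr
    have e2 : ∑ k ∈ Q, (v k * ((4 ^ m * W k ^ m * (q k + 9 / 2) ^ (-(m:ℝ)) : ℝ) : ℂ)) *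
        (Real.exp (-(r * 1 * (q k + 1 / 2))) : ℂ) = ∑ k ∈ Q, (v k * ((4 ^ m * W k ^ m *
          Real.exp (-(r * 1 * (q k + 1 / 2))) : ℝ) : ℂ)) * (((q k + 9 / 2) ^ (-(m:ℝ)) : ℝ) : ℂ) := by
      refine Finset.sum_congr rfl fun k hk => ?_
      simp only [Complex.ofReal_mul]; ring
    rw [e2]
    refine (gamma_super Q _ (fun k => q k + 9 / 2) (fun k _ => by have := hq0 k; positivity) hm0 one_pos).trans ?_
    refine mul_le_mul' le_rfl (setLIntegral_mono' measurableSet_Ioi fun r' hr' => mul_le_mul' le_rfl ?_)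
    have hr0' : (0:ℝ) < r' := hr'
    refine enorm_le_of (r := 4 ^ m * Real.exp (-(r / 2 + r' * (9 / 2)))) (by positivity) ?_
      (mul_le_of_le_one_right (by positivity) (Real.exp_le_one_iff.2 (by linarith)))
    rw [hN, Finset.mul_sum]
    refine Finset.sum_congr rfl fun k hk => ?_
    have : Real.exp (-(r * 1 * (q k + 1 / 2))) * Real.exp (-(r' * 1 * (q k + 9 / 2))) =
        Real.exp (-(r / 2 + r' * (9 / 2))) * Real.exp (-((r + r') * q k)) := by
      rw [← Real.exp_add, ← Real.exp_add]; congr 1; ring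
    have t2 := congrArg (fun r : ℝ => (r : ℂ)) this
    simp only [Complex.ofReal_mul] at t2
    simp only [Complex.ofReal_mul]
    linear_combination (v k * ((4 ^ m : ℝ) : ℂ) * ((W k ^ m : ℝ) : ℂ)) * t2
  have hΨ : Measurable (fun t : ℝ => ENNReal.ofReal (t ^ (2 * (m:ℝ) - 2)) * ‖N t‖ₑ) :=
    (by fun_prop : Measurable (fun t : ℝ => ENNReal.ofReal (t ^ (2 * (m:ℝ) - 2)))).mul hNc.measurable.enorm
  have s2 : ∫⁻ r in Ioi (0:ℝ), ENNReal.ofReal (r ^ ((m:ℝ) - 1)) *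
      (ENNReal.ofReal G * ∫⁻ r' in Ioi (0:ℝ), ENNReal.ofReal (r' ^ ((m:ℝ) - 1)) *
        (ENNReal.ofReal (4 ^ m) * ‖N (r + r')‖ₑ)) ≤ ENNReal.ofReal (G * 4 ^ m) *
      ∫⁻ t in Ioi (0:ℝ), ENNReal.ofReal (t ^ (2 * (m:ℝ) - 1)) * ‖N t‖ₑ := by
    have : ∫⁻ t in Ioi (0:ℝ), ENNReal.ofReal (t ^ (2 * (m:ℝ) - 1)) * ‖N t‖ₑ =
        ∫⁻ r in Ioi (0:ℝ), ∫⁻ r' in Ioi (0:ℝ), ENNReal.ofReal ((r + r') ^ (2 * (m:ℝ) - 2)) * ‖N (r + r')‖ₑ := by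
      rw [conv_int hΨ]
      refine setLIntegral_congr_fun measurableSet_Ioi fun t ht => ?_
      have ht0 : (0:ℝ) < t := ht
      rw [← mul_assoc, ← ENNReal.ofReal_mul ht0.le]
      congr 2
      rw [show 2 * (m:ℝ) - 1 = 1 + (2 * (m:ℝ) - 2) by ring, Real.rpow_add ht0, Real.rpow_one]
    rw [this, ← lintegral_const_mul' _ _ ENNReal.ofReal_ne_top]
    refine setLIntegral_mono' measurableSet_Ioi fun r hr => ?_
    have hr0 : (0:ℝ) < r := hr
    rw [← mul_assoc, ← ENNReal.ofReal_mul (by positivity), ← lintegral_const_mul' _ _ ENNReal.ofReal_ne_top,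
      ← lintegral_const_mul' _ _ ENNReal.ofReal_ne_top]
    refine setLIntegral_mono' measurableSet_Ioi fun r' hr' => ?_
    have hr0' : (0:ℝ) < r' := hr'
    rw [re5, re6, ← ENNReal.ofReal_mul (by positivity), ← ENNReal.ofReal_mul (by positivity),
      ← ENNReal.ofReal_mul (by positivity)]
    refine mul_le_mul' (ENNReal.ofReal_le_ofReal ?_) le_rfl
    have h1 : r ^ ((m:ℝ) - 1) ≤ (r + r') ^ ((m:ℝ) - 1) := by
      have : (1:ℝ) ≤ m := by exact_mod_cast hm
      exact Real.rpow_le_rpow hr0.le (by linarith) (by linarith)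
    have h2 : r' ^ ((m:ℝ) - 1) ≤ (r + r') ^ ((m:ℝ) - 1) := by
      have : (1:ℝ) ≤ m := by exact_mod_cast hm
      exact Real.rpow_le_rpow hr0'.le (by linarith) (by linarith)
    calc _ = G * 4 ^ m * (r ^ ((m:ℝ) - 1) * r' ^ ((m:ℝ) - 1)) := by ring
      _ ≤ G * 4 ^ m * ((r + r') ^ ((m:ℝ) - 1) * (r + r') ^ ((m:ℝ) - 1)) := by gcongr
      _ = _ := by rw [← Real.rpow_add (by positivity)]; congr 2; ring
  set pc : ℕ → ℕ → ℝ → ℂ := fun i j t => ∑ k ∈ Q, v k * (((1 + a k ^ 2) ^ (i + (m - i - j)) *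
    (1 + b k ^ 2) ^ (i + j) * (1 + c k ^ 2) ^ (j + (m - i - j)) *
        Real.exp (-(t * (a k ^ 2 + b k ^ 2 + c k ^ 2 + 3 / 2))) : ℝ) : ℂ) with hpc
  have hpm : ∀ i j, Measurable (fun t => ‖pc i j t‖ₑ) := by
    intro i j
    have : Continuous (pc i j) := by rw [hpc]; fun_prop
    exact this.measurable.enorm
  have hexp : ∀ t, N t = ∑ i ∈ Finset.range (m + 1), ∑ j ∈ Finset.range (m - i + 1),
      ((m.choose i * (m - i).choose j : ℕ) : ℂ) * pc i j t := by
    intro t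
    simp only [hN, hpc, hq]
    simp_rw [Finset.mul_sum]
    simp_rw [Finset.sum_comm (s := Finset.range _) (t := Q)]
    refine Finset.sum_congr rfl fun k _ => ?_
    have : W k ^ m = ∑ i ∈ Finset.range (m + 1), ∑ j ∈ Finset.range (m - i + 1),
        ((m.choose i * (m - i).choose j : ℕ) : ℝ) * ((1 + a k ^ 2) ^ (i + (m - i - j)) *
    (1 + b k ^ 2) ^ (i + j) * (1 + c k ^ 2) ^ (j + (m - i - j))) := by
      simp only [hW]
      rw [add_pow]
      refine Finset.sum_congr rfl fun i _ => ?_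
      rw [add_pow, Finset.mul_sum, Finset.sum_mul]
      refine Finset.sum_congr rfl fun j _ => ?_
      push_cast
      rw [mul_pow, mul_pow, mul_pow, pow_add, pow_add, pow_add]; ring
    rw [this]
    push_cast
    simp_rw [Finset.sum_mul, Finset.mul_sum]
    refine Finset.sum_congr rfl fun i _ => Finset.sum_congr rfl fun j _ => ?_
    ring
  have s3 : ∫⁻ t in Ioi (0:ℝ), ENNReal.ofReal (t ^ (2 * (m:ℝ) - 1)) * ‖N t‖ₑ ≤ ENNReal.ofReal (3 ^ m) * D := by
    have hb : ∀ t, ENNReal.ofReal (t ^ (2 * (m:ℝ) - 1)) * ‖N t‖ₑ ≤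
        ∑ i ∈ Finset.range (m + 1), ∑ j ∈ Finset.range (m - i + 1),
        ((m.choose i * (m - i).choose j : ℕ) : ENNReal) * (ENNReal.ofReal (t ^ (2 * (m:ℝ) - 1)) * ‖pc i j t‖ₑ) := by
      intro t
      have e : ∑ i ∈ Finset.range (m + 1), ∑ j ∈ Finset.range (m - i + 1),
        ((m.choose i * (m - i).choose j : ℕ) : ENNReal) * (ENNReal.ofReal (t ^ (2 * (m:ℝ) - 1)) * ‖pc i j t‖ₑ) =
        ENNReal.ofReal (t ^ (2 * (m:ℝ) - 1)) * ∑ i ∈ Finset.range (m + 1), ∑ j ∈ Finset.range (m - i + 1),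
        ((m.choose i * (m - i).choose j : ℕ) : ENNReal) * ‖pc i j t‖ₑ := by
        simp_rw [Finset.mul_sum]
        refine Finset.sum_congr rfl fun i _ => Finset.sum_congr rfl fun j _ => by ring
      rw [e]
      refine mul_le_mul' le_rfl ?_
      rw [hexp]
      refine (enorm_sum_le _ _).trans (Finset.sum_le_sum fun i _ => (enorm_sum_le _ _).trans
        (Finset.sum_le_sum fun j _ => ?_))
      rw [enorm_mul]
      refine le_of_eq ?_
      congr 1
      rw [← ofReal_norm_eq_enorm, Complex.norm_natCast, ENNReal.ofReal_natCast]
    refine (lintegral_mono hb).trans ?_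
    rw [lintegral_finsetSum _ (by
      intro i _
      refine Finset.measurable_fun_sum _ fun j _ => ?_
      have := hpm i j
      fun_prop)]
    calc _ ≤ ∑ i ∈ Finset.range (m + 1), ∑ j ∈ Finset.range (m - i + 1),
          ((m.choose i * (m - i).choose j : ℕ) : ENNReal) * D := by
          refine Finset.sum_le_sum fun i hi => ?_
          rw [lintegral_finsetSum _ (by
            intro j _
            have := hpm i j
            fun_prop)]
          refine Finset.sum_le_sum fun j hj => ?_
          rw [lintegral_const_mul' _ _ (ENNReal.natCast_ne_top _)]
          refine mul_le_mul' le_rfl (hD i j (m - i - j) ?_)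
          have := Finset.mem_range.1 hi
          have := Finset.mem_range.1 hj
          omega
      _ = _ := by
          simp_rw [← Finset.sum_mul]
          congr 1
          have : ∑ i ∈ Finset.range (m + 1), ∑ j ∈ Finset.range (m - i + 1),
            (m.choose i * (m - i).choose j) = 3 ^ m := by
            simp_rw [← Finset.mul_sum, Nat.sum_range_choose]
            have := add_pow (1:ℕ) 2 m
            norm_num at this
            rw [this]
            refine Finset.sum_congr rfl fun i _ => by ring
          rw [show ENNReal.ofReal (3 ^ m) = ((3 ^ m : ℕ) : ENNReal) by
            rw [← ENNReal.ofReal_natCast]; push_cast; rfl, ← this]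
          push_cast; rfl
  refine s1.trans ((mul_le_mul' le_rfl (s2.trans (mul_le_mul' le_rfl s3))).trans (le_of_eq ?_))
  rw [← mul_assoc, ← mul_assoc, ← ENNReal.ofReal_mul (by positivity), ← ENNReal.ofReal_mul (by positivity)]

end

end KP

set_option linter.all false
open MeasureTheory Set
namespace KP

noncomputable section

/-- hypotheses on the three factors -/
structure Hyp (p q : ℝ) (ω : ℝ × ℝ) (s : ℝ) (S₁ S₂ S₃ : Finset Z2) (f g h : Z2 → ℂ) (aF ag aD aG ah : ℝ) : Prop where
  pF : 0 < aF
  pg : 0 < ag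
  pD : 0 < aD
  pG : 0 < aG
  ph : 0 < ah
  hF : ∫ x, ‖P S₁ (fun n => (((1 + fr ω n ^ 2) ^ (s / 2) : ℝ) : ℂ) * f n) x‖ ^ p ∂mT ≤ aF ^ p
  hg : ∀ x, ‖P S₂ g x‖ ≤ ag
  hD : ∀ x, ‖P S₁ (fun n => (fr ω n : ℂ) * f n) x‖ ≤ aD
  hG : ∫ x, ‖P S₂ (fun n => (((1 + fr ω n ^ 2) ^ ((s - 1) / 2) : ℝ) : ℂ) * g n) x‖ ^ p ∂mT ≤ aG ^ p
  hh : ∫ x, ‖P S₃ h x‖ ^ q ∂mT ≤ ah ^ q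

/-- weighted trilinear sum -/
def Wt (ω : ℝ × ℝ) (S₁ S₂ S₃ : Finset Z2) (f g h : Z2 → ℂ) (s : ℝ) (α β γ : ℕ) (t : ℝ) : ℂ :=
  ∑ k ∈ ZZ S₁ S₂ S₃, (f k.1 * g k.2.1 * h k.2.2 *
    (((1 + fr ω k.2.2 ^ 2) ^ (s / 2) - (1 + fr ω k.2.1 ^ 2) ^ (s / 2) : ℝ) : ℂ)) *
    (((1 + fr ω k.1 ^ 2) ^ α * (1 + fr ω k.2.1 ^ 2) ^ β * (1 + fr ω k.2.2 ^ 2) ^ γ *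
      Real.exp (-(t * (fr ω k.1 ^ 2 + fr ω k.2.1 ^ 2 + fr ω k.2.2 ^ 2 + 3 / 2))) : ℝ) : ℂ)

lemma TT_cont (ω S₁ S₂ S₃ c₁ c₂ c₃ x₁ x₂ x₃ ε₁ ε₂ ε₃) :
    Continuous (fun z : ℝ × ℝ × ℝ => TT ω S₁ S₂ S₃ c₁ c₂ c₃ x₁ x₂ x₃ ε₁ ε₂ ε₃ z.1 z.2.1 z.2.2) := by
  unfold TT ys
  refine continuous_finsetSum _ fun n _ => ?_
  fun_prop

lemma TT_cont1 (ω S₁ S₂ S₃ c₁ c₂ c₃ x₁ x₂ x₃ ε₁ ε₂ ε₃) (ρ₁ ρ₂ ρ₃ : ℝ) :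
    Continuous (fun t : ℝ => TT ω S₁ S₂ S₃ c₁ c₂ c₃ x₁ x₂ x₃ ε₁ ε₂ ε₃ (ρ₁ * t) (ρ₂ * t) (ρ₃ * t)) := by
  unfold TT ys
  refine continuous_finsetSum _ fun n _ => ?_
  fun_prop

lemma sq1_pos (a : ℝ) : 0 < 1 + a ^ 2 := by positivity

lemma rp1 (a s : ℝ) (α : ℕ) : (1 + a ^ 2) ^ (s / 2) * (1 + a ^ 2) ^ ((2 * α - s) / 2) = (1 + a ^ 2) ^ α := by
  rw [← Real.rpow_add (sq1_pos a), ← Real.rpow_natCast (1 + a ^ 2) α]; congr 1; ring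

lemma rp2 (a s : ℝ) (α : ℕ) : (1 + a ^ 2) ^ ((2 * α + s) / 2) = (1 + a ^ 2) ^ α * (1 + a ^ 2) ^ (s / 2) := by
  rw [← Real.rpow_natCast (1 + a ^ 2) α, ← Real.rpow_add (sq1_pos a)]; congr 1; ring

lemma rp3 (a : ℝ) (α : ℕ) : (1 + a ^ 2) ^ ((2 * α : ℝ) / 2) = (1 + a ^ 2) ^ α := by
  rw [← Real.rpow_natCast (1 + a ^ 2) α]; congr 1; ring

lemma Wt_eq1 (ω S₁ S₂ S₃ f g h s α β γ t) : Wt ω S₁ S₂ S₃ f g h s α β γ t =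
    TT ω S₁ S₂ S₃ (fun n => (((1 + fr ω n ^ 2) ^ (s / 2) : ℝ) : ℂ) * f n) g h (2 * α - s) (2 * β) (2 * γ + s) 0 0 0
      (1 * t) (1 * t) (1 * t) -
    TT ω S₁ S₂ S₃ (fun n => (((1 + fr ω n ^ 2) ^ (s / 2) : ℝ) : ℂ) * f n) g h (2 * α - s) (2 * β + s) (2 * γ) 0 0 0
      (1 * t) (1 * t) (1 * t) := by
  unfold Wt TT ys
  rw [← Finset.sum_sub_distrib]
  refine Finset.sum_congr rfl fun k _ => ?_
  simp only [rp2, rp3, pow_zero, mul_one, one_mul]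
  have e1 : Real.exp (-(t * (fr ω k.1 ^ 2 + fr ω k.2.1 ^ 2 + fr ω k.2.2 ^ 2 + 3 / 2))) =
    Real.exp (-(t * (fr ω k.1 ^ 2 + 1 / 2))) * Real.exp (-(t * (fr ω k.2.1 ^ 2 + 1 / 2))) *
      Real.exp (-(t * (fr ω k.2.2 ^ 2 + 1 / 2))) := by
    rw [← Real.exp_add, ← Real.exp_add]; congr 1; ring
  rw [e1, ← rp1 (fr ω k.1) s α]
  push_cast
  ring

lemma lint_two (e : ℝ) {F G : ℝ → ℂ} (hF : Continuous F) {X Y : ENNReal}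
    (h1 : ∫⁻ t in Ioi (0:ℝ), ENNReal.ofReal (t ^ e) * ‖F t‖ₑ ≤ X)
    (h2 : ∫⁻ t in Ioi (0:ℝ), ENNReal.ofReal (t ^ e) * ‖G t‖ₑ ≤ Y) :
    ∫⁻ t in Ioi (0:ℝ), ENNReal.ofReal (t ^ e) * ‖F t - G t‖ₑ ≤ X + Y := by
  refine le_trans ?_ (add_le_add h1 h2)
  rw [← lintegral_add_left]
  · refine lintegral_mono fun t => ?_
    rw [← mul_add]
    exact mul_le_mul' le_rfl (enorm_sub_le)
  · have := hF.measurable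
    fun_prop

lemma case12 {p q : ℝ} (hp : 2 ≤ p) (hq1 : 1 < q) (hq2 : q ≤ 2) (hpq : 1 / p + 1 / q = 1) {s : ℝ} (hs : 1 ≤ s)
    {m : ℕ} (hm : s + 5 ≤ m) {i j l : ℕ} (hijl : i + j + l = m) (hα : s + 1 ≤ 2 * ((i + l : ℕ) : ℝ)) :
    ∃ C : ℝ, 0 < C ∧ ∀ ω S₁ S₂ S₃ f g h aF ag aD aG ah, Hyp p q ω s S₁ S₂ S₃ f g h aF ag aD aG ah →
    ∫⁻ t in Ioi (0:ℝ), ENNReal.ofReal (t ^ (2 * (m:ℝ) - 1)) * ‖Wt ω S₁ S₂ S₃ f g h s (i + l) (i + j) (j + l) t‖ₑ ≤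
      ENNReal.ofReal (C * ((aF * ag + aD * aG) * ah)) := by
  have hmr : (2 * (m:ℝ) - 1) = (2 * ((i + l : ℕ):ℝ) - s + (0:ℕ)) / 2 + (2 * ((i + j : ℕ):ℝ) + (0:ℕ)) / 2 +
      (2 * ((j + l : ℕ):ℝ) + s + (0:ℕ)) / 2 - 1 := by
    rw [← hijl]; push_cast; ring
  obtain ⟨C₁, hC₁, H1⟩ := PB1 hp hq1 hq2 hpq (2 * ((i + l : ℕ):ℝ) - s) (2 * ((i + j : ℕ):ℝ)) (2 * ((j + l : ℕ):ℝ) + s) 0 0 0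
    (by push_cast at *; linarith) (by positivity) (by push_cast; nlinarith [Nat.cast_nonneg (α := ℝ) j, Nat.cast_nonneg (α := ℝ) l])
  have H2 : ∃ C₂ : ℝ, 0 < C₂ ∧ ∀ ω S₁ S₂ S₃ f g h aF ag aD aG ah, Hyp p q ω s S₁ S₂ S₃ f g h aF ag aD aG ah →
    ∫⁻ t in Ioi (0:ℝ), ENNReal.ofReal (t ^ (2 * (m:ℝ) - 1)) *
      ‖TT ω S₁ S₂ S₃ (fun n => (((1 + fr ω n ^ 2) ^ (s / 2) : ℝ) : ℂ) * f n) g h (2 * ((i + l : ℕ):ℝ) - s) (2 * ((i + j : ℕ):ℝ) + s)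
        (2 * ((j + l : ℕ):ℝ)) 0 0 0 (1 * t) (1 * t) (1 * t)‖ₑ ≤ ENNReal.ofReal (C₂ * (aF * ag * ah)) := by
    rcases Nat.eq_zero_or_pos (j + l) with h0 | h0
    · have hj : j = 0 := by omega
      have hl : l = 0 := by omega
      subst hj; subst hl
      have hi : i = m := by omega
      subst hi
      simp only [Nat.add_zero, Nat.cast_zero, mul_zero] at *
      obtain ⟨C₂, hC₂, H2⟩ := PC1 hp hq1 hq2 hpq (2 * (i:ℝ) - s) (2 * (i:ℝ) + s) (by linarith) (by linarith)
      refine ⟨C₂, hC₂, fun ω S₁ S₂ S₃ f g h aF ag aD aG ah H => ?_⟩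
      refine (TT_MM _ _ _ _ _ _ _ _ _ _ _ _ _ _ _ _ _).trans ?_
      simp only [one_mul]
      exact H2 ω S₁ _ S₂ _ S₃ _ _ _ _ H.pF H.pg H.ph H.hF H.hg H.hh _ (by ring)
    · have hγ : (1:ℝ) ≤ ((j + l : ℕ):ℝ) := by exact_mod_cast h0
      obtain ⟨C₂, hC₂, H2⟩ := PB1 hp hq1 hq2 hpq (2 * ((i + l : ℕ):ℝ) - s) (2 * ((i + j : ℕ):ℝ) + s) (2 * ((j + l : ℕ):ℝ)) 0 0 0
        (by push_cast at *; linarith) (by positivity) (by push_cast at *; linarith)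
      refine ⟨C₂, hC₂, fun ω S₁ S₂ S₃ f g h aF ag aD aG ah H => ?_⟩
      refine (TT_MM _ _ _ _ _ _ _ _ _ _ _ _ _ _ _ _ _).trans ?_
      refine (H2 ω S₁ _ S₂ _ S₃ _ _ _ _ H.pF H.pg H.ph H.hF H.hg H.hh 1 1 le_rfl le_rfl _ ?_).trans (le_of_eq ?_)
      · rw [hmr]; push_cast; ring
      · simp
  obtain ⟨C₂, hC₂, H2⟩ := H2
  refine ⟨C₁ + C₂, by positivity, fun ω S₁ S₂ S₃ f g h aF ag aD aG ah H => ?_⟩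
  simp_rw [Wt_eq1]
  have h1 : ∫⁻ t in Ioi (0:ℝ), ENNReal.ofReal (t ^ (2 * (m:ℝ) - 1)) *
      ‖TT ω S₁ S₂ S₃ (fun n => (((1 + fr ω n ^ 2) ^ (s / 2) : ℝ) : ℂ) * f n) g h (2 * ((i + l : ℕ):ℝ) - s) (2 * ((i + j : ℕ):ℝ))
        (2 * ((j + l : ℕ):ℝ) + s) 0 0 0 (1 * t) (1 * t) (1 * t)‖ₑ ≤ ENNReal.ofReal (C₁ * (aF * ag * ah)) := by
    refine (TT_MM _ _ _ _ _ _ _ _ _ _ _ _ _ _ _ _ _).trans ?_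
    refine (H1 ω S₁ _ S₂ _ S₃ _ _ _ _ H.pF H.pg H.ph H.hF H.hg H.hh 1 1 le_rfl le_rfl _ hmr).trans (le_of_eq ?_)
    simp
  have h2 := H2 ω S₁ S₂ S₃ f g h aF ag aD aG ah H
  refine (lint_two _ (TT_cont1 _ _ _ _ _ _ _ _ _ _ _ _ _ _ _ _) h1 h2).trans ?_
  · have := H.pF; have := H.pg; have := H.ph; have := H.pD; have := H.pG
    rw [← ENNReal.ofReal_add (by positivity) (by positivity)]
    apply ENNReal.ofReal_le_ofReal
    have : 0 ≤ (C₁ + C₂) * (aD * aG * ah) := by positivity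
    nlinarith

end

end KP

set_option linter.all false
open MeasureTheory Set
namespace KP

noncomputable section

lemma swap3 {H : ℝ × ℝ × ℝ → ENNReal} (hH : Measurable H) (A B D : Set ℝ) :
    ∫⁻ t in A, ∫⁻ θ in B, ∫⁻ η in D, H (t, θ, η) = ∫⁻ θ in B, ∫⁻ η in D, ∫⁻ t in A, H (t, θ, η) := by
  rw [lintegral_lintegral_swap]
  · refine lintegral_congr fun θ => ?_
    rw [lintegral_lintegral_swap]
    exact (hH.comp (by fun_prop : Measurable (fun z : ℝ × ℝ => (z.1, θ, z.2)))).aemeasurable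
  · have : Measurable (fun w : (ℝ × ℝ) × ℝ => H (w.1.1, w.1.2, w.2)) := hH.comp (by fun_prop)
    exact (this.lintegral_prod_right' (ν := volume.restrict D)).aemeasurable

lemma re7 {a b c : ENNReal} : a * (b * c) = b * (a * c) := by ring
lemma re8 {a b c d : ENNReal} : a * (b * c * d) = a * (c * b * d) := by ring

lemma TT_meas3 (ω S₁ S₂ S₃ c₁ c₂ c₃ x₁ x₂ x₃ ε₁ ε₂ ε₃) :
    Measurable (fun z : ℝ × ℝ × ℝ => ‖TT ω S₁ S₂ S₃ c₁ c₂ c₃ x₁ x₂ x₃ ε₁ ε₂ ε₃ (1 * z.1)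
      ((1 + z.2.2 * (1 - z.2.1)) * z.1) ((1 + z.2.2 * z.2.1) * z.1)‖ₑ) := by
  have : Continuous (fun z : ℝ × ℝ × ℝ => TT ω S₁ S₂ S₃ c₁ c₂ c₃ x₁ x₂ x₃ ε₁ ε₂ ε₃ (1 * z.1)
      ((1 + z.2.2 * (1 - z.2.1)) * z.1) ((1 + z.2.2 * z.2.1) * z.1)) := by
    unfold TT ys
    refine continuous_finsetSum _ fun n _ => ?_
    fun_prop
  exact this.measurable.enorm

lemma wts {θ η E₁ E₂ : ℝ} (hθ0 : 0 ≤ θ) (hθ1 : θ ≤ 1) (hη : 0 ≤ η) (h1 : E₁ ≤ -2) (h2 : E₂ ≤ -2) :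
    (1 + η * (1 - θ)) ^ E₁ * (1 + η * θ) ^ E₂ ≤ (1 + η) ^ (-2 : ℝ) := by
  have hu : 1 ≤ 1 + η * (1 - θ) := by nlinarith
  have hv : 1 ≤ 1 + η * θ := by nlinarith
  calc (1 + η * (1 - θ)) ^ E₁ * (1 + η * θ) ^ E₂
      ≤ (1 + η * (1 - θ)) ^ (-2:ℝ) * (1 + η * θ) ^ (-2:ℝ) := by
        gcongr
    _ = ((1 + η * (1 - θ)) * (1 + η * θ)) ^ (-2:ℝ) := by
        rw [Real.mul_rpow (by linarith) (by linarith)]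
    _ ≤ _ := by
        apply Real.rpow_le_rpow_of_nonpos (by linarith) _ (by norm_num)
        have : 0 ≤ η * (1 - θ) * (η * θ) := mul_nonneg (mul_nonneg hη (by linarith)) (mul_nonneg hη hθ0)
        nlinarith

lemma case3T {p q : ℝ} (hp : 2 ≤ p) (hq1 : 1 < q) (hq2 : q ≤ 2) (hpq : 1 / p + 1 / q = 1) {s : ℝ}
    (α : ℕ) {x₂ x₃ κ : ℝ} (ε₂ ε₃ : ℕ) (h2 : 5 ≤ x₂) (h3 : 5 ≤ x₃) (hκ : 0 < κ) (hκ2 : κ < 2) {e : ℝ}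
    (he : e = (x₂ + ε₂) / 2 + (2 * α + (0:ℕ)) / 2 + (x₃ + ε₃) / 2 - 1) :
    ∃ C : ℝ, 0 < C ∧ ∀ ω S₁ S₂ S₃ f g h aF ag aD aG ah, Hyp p q ω s S₁ S₂ S₃ f g h aF ag aD aG ah →
    ∫⁻ t in Ioi (0:ℝ), ∫⁻ θ in Ioc (0:ℝ) 1, ∫⁻ η in Ioi (0:ℝ), ENNReal.ofReal (t ^ e) * (ENNReal.ofReal (η ^ (κ - 1)) *
      ‖TT ω S₁ S₂ S₃ (fun n => (fr ω n : ℂ) * f n) (fun n => (((1 + fr ω n ^ 2) ^ ((s - 1) / 2) : ℝ) : ℂ) * g n) h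
        (2 * α) x₂ x₃ 0 ε₂ ε₃ (1 * t) ((1 + η * (1 - θ)) * t) ((1 + η * θ) * t)‖ₑ) ≤
      ENNReal.ofReal (C * (aD * aG * ah)) := by
  obtain ⟨C₁, hC₁, H1⟩ := PB1 hp hq1 hq2 hpq x₂ (2 * α) x₃ ε₂ 0 ε₃ (by linarith [Nat.cast_nonneg (α := ℝ) ε₂]) (by positivity)
    (by linarith [Nat.cast_nonneg (α := ℝ) ε₃])
  obtain ⟨C₂, hC₂, H2⟩ := beta_fin hκ hκ2
  have hq : 1 / q ≤ 1 := by rw [div_le_one (by linarith)]; linarith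
  refine ⟨C₂ * C₁, by positivity, fun ω S₁ S₂ S₃ f g h aF ag aD aG ah H => ?_⟩
  have := H.pF; have := H.pg; have := H.ph; have := H.pD; have := H.pG
  have hm := TT_meas3 ω S₁ S₂ S₃ (fun n => (fr ω n : ℂ) * f n) (fun n => (((1 + fr ω n ^ 2) ^ ((s - 1) / 2) : ℝ) : ℂ) * g n) h
        (2 * α) x₂ x₃ 0 ε₂ ε₃
  have hM : Measurable (fun z : ℝ × ℝ × ℝ => ENNReal.ofReal (z.1 ^ e) * (ENNReal.ofReal (z.2.2 ^ (κ - 1)) *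
      ‖TT ω S₁ S₂ S₃ (fun n => (fr ω n : ℂ) * f n) (fun n => (((1 + fr ω n ^ 2) ^ ((s - 1) / 2) : ℝ) : ℂ) * g n) h
        (2 * α) x₂ x₃ 0 ε₂ ε₃ (1 * z.1) ((1 + z.2.2 * (1 - z.2.1)) * z.1) ((1 + z.2.2 * z.2.1) * z.1)‖ₑ)) := by
    refine Measurable.mul (by fun_prop) (Measurable.mul (by fun_prop) hm)
  have hsw := swap3 hM (Ioi 0) (Ioc 0 1) (Ioi 0)
  simp only at hsw
  rw [hsw]
  have inner : ∀ θ ∈ Ioc (0:ℝ) 1, (∫⁻ η in Ioi (0:ℝ), ∫⁻ t in Ioi (0:ℝ), ENNReal.ofReal (t ^ e) * (ENNReal.ofReal (η ^ (κ - 1)) *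
      ‖TT ω S₁ S₂ S₃ (fun n => (fr ω n : ℂ) * f n) (fun n => (((1 + fr ω n ^ 2) ^ ((s - 1) / 2) : ℝ) : ℂ) * g n) h
        (2 * α) x₂ x₃ 0 ε₂ ε₃ (1 * t) ((1 + η * (1 - θ)) * t) ((1 + η * θ) * t)‖ₑ)) ≤
      ENNReal.ofReal (C₂ * C₁ * (aD * aG * ah)) := by
    intro θ hθ
    have step : ∀ η ∈ Ioi (0:ℝ), (∫⁻ t in Ioi (0:ℝ), ENNReal.ofReal (t ^ e) * (ENNReal.ofReal (η ^ (κ - 1)) *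
      ‖TT ω S₁ S₂ S₃ (fun n => (fr ω n : ℂ) * f n) (fun n => (((1 + fr ω n ^ 2) ^ ((s - 1) / 2) : ℝ) : ℂ) * g n) h
        (2 * α) x₂ x₃ 0 ε₂ ε₃ (1 * t) ((1 + η * (1 - θ)) * t) ((1 + η * θ) * t)‖ₑ)) ≤
        ENNReal.ofReal (C₁ * (aD * aG * ah)) * ENNReal.ofReal (η ^ (κ - 1) * (1 + η) ^ (-2:ℝ)) := by
      intro η hη
      have hη' : 0 < η := hη
      simp_rw [re7 (b := ENNReal.ofReal (η ^ (κ - 1)))]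
      rw [lintegral_const_mul' _ _ ENNReal.ofReal_ne_top]
      have hb := (TT_MM ω S₁ S₂ S₃ (fun n => (fr ω n : ℂ) * f n) (fun n => (((1 + fr ω n ^ 2) ^ ((s - 1) / 2) : ℝ) : ℂ) * g n) h
        (2 * α) x₂ x₃ 0 ε₂ ε₃ 1 (1 + η * (1 - θ)) (1 + η * θ) e)
      simp_rw [re8 (b := ‖Y ω S₁ _ _ _ _ _‖ₑ)] at hb
      have hb2 := H1 ω S₂ _ S₁ _ S₃ _ _ _ _ H.pG H.pD H.ph H.hG H.hD H.hh (1 + η * (1 - θ)) (1 + η * θ)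
        (by nlinarith [hθ.1, hθ.2]) (by nlinarith [hθ.1, hθ.2]) e he
      refine (mul_le_mul' le_rfl (hb.trans hb2)).trans ?_
      rw [← ENNReal.ofReal_mul (by positivity), ← ENNReal.ofReal_mul (by positivity)]
      apply ENNReal.ofReal_le_ofReal
      have hw := wts hθ.1.le hθ.2 hη'.le (E₁ := -((x₂ + ε₂) / 2) + (1 / q - 1 / 2)) (E₂ := -((x₃ + ε₃) / 2) + (1 / q - 1 / 2))
        (by linarith [Nat.cast_nonneg (α := ℝ) ε₂]) (by linarith [Nat.cast_nonneg (α := ℝ) ε₃])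
      have h0 : 0 ≤ η ^ (κ - 1) * C₁ * (aD * aG * ah) := by positivity
      calc _ = (η ^ (κ - 1) * C₁ * (aD * aG * ah)) * ((1 + η * (1 - θ)) ^ (-((x₂ + ε₂) / 2) + (1 / q - 1 / 2)) *
              (1 + η * θ) ^ (-((x₃ + ε₃) / 2) + (1 / q - 1 / 2))) := by ring
        _ ≤ (η ^ (κ - 1) * C₁ * (aD * aG * ah)) * (1 + η) ^ (-2:ℝ) := mul_le_mul_of_nonneg_left hw h0
        _ = _ := by ring
    refine (setLIntegral_mono' measurableSet_Ioi step).trans ?_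
    rw [lintegral_const_mul' _ _ ENNReal.ofReal_ne_top]
    refine (mul_le_mul' le_rfl H2).trans (le_of_eq ?_)
    rw [← ENNReal.ofReal_mul (by positivity)]
    congr 1; ring
  refine (setLIntegral_mono' measurableSet_Ioc inner).trans ?_
  simp

end

end KP

set_option linter.all false
open MeasureTheory Set
namespace KP

noncomputable section

lemma fr_zero_sum (ω) {S₁ S₂ S₃ : Finset Z2} {k : Z2 × Z2 × Z2} (hk : k ∈ ZZ S₁ S₂ S₃) :
    fr ω k.1 + fr ω k.2.1 + fr ω k.2.2 = 0 := by
  have h := (Finset.mem_filter.1 hk).2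
  have h1 : ((k.1.1 + k.2.1.1 + k.2.2.1 : ℤ) : ℝ) = 0 := by exact_mod_cast congrArg Prod.fst h
  have h2 : ((k.1.2 + k.2.1.2 + k.2.2.2 : ℤ) : ℝ) = 0 := by exact_mod_cast congrArg Prod.snd h
  push_cast at h1 h2
  unfold fr
  linear_combination ω.1 * h1 + ω.2 * h2

lemma rp4 (b s : ℝ) (β M : ℕ) : (1 + b ^ 2) ^ ((s - 1) / 2) * (1 + b ^ 2) ^ ((2 * β + 2 * M - s + 1) / 2) =
    (1 + b ^ 2) ^ β * (1 + b ^ 2) ^ M := by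
  rw [← Real.rpow_add (sq1_pos b), ← pow_add, ← Real.rpow_natCast (1 + b ^ 2) (β + M)]; congr 1; push_cast; ring

lemma rp5 (c : ℝ) (γ r : ℕ) : (1 + c ^ 2) ^ ((2 * γ + 2 * r : ℝ) / 2) = (1 + c ^ 2) ^ γ * (1 + c ^ 2) ^ r := by
  rw [← pow_add, ← Real.rpow_natCast (1 + c ^ 2) (γ + r)]; congr 1; push_cast; ring

lemma U_eq (ω) (S₁ S₂ S₃ : Finset Z2) (f g h : Z2 → ℂ) (s : ℝ) (α β γ N : ℕ) (t θ η : ℝ) :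
    ∑ k ∈ ZZ S₁ S₂ S₃, (f k.1 * g k.2.1 * h k.2.2 *
    (((1 + fr ω k.1 ^ 2) ^ α * (1 + fr ω k.2.1 ^ 2) ^ β * (1 + fr ω k.2.2 ^ 2) ^ γ *
      Real.exp (-(t * (fr ω k.1 ^ 2 + fr ω k.2.1 ^ 2 + fr ω k.2.2 ^ 2 + 3 / 2))) : ℝ) : ℂ)) *
      ((((1 + fr ω k.2.2 ^ 2) - (1 + fr ω k.2.1 ^ 2)) *
        (θ * (1 + fr ω k.2.2 ^ 2) + (1 - θ) * (1 + fr ω k.2.1 ^ 2)) ^ N : ℝ) : ℂ) *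
      (Real.exp (-(η * t * (θ * (1 + fr ω k.2.2 ^ 2) + (1 - θ) * (1 + fr ω k.2.1 ^ 2)))) : ℂ) =
    ∑ r ∈ Finset.range (N + 1), ((Real.exp (-(η * t / 2)) * (θ ^ r * (1 - θ) ^ (N - r) * (N.choose r)) : ℝ) : ℂ) *
     (TT ω S₁ S₂ S₃ (fun n => (fr ω n : ℂ) * f n) (fun n => (((1 + fr ω n ^ 2) ^ ((s - 1) / 2) : ℝ) : ℂ) * g n) h
        (2 * α) (2 * β + 2 * (N - r : ℕ) - s + 1) (2 * γ + 2 * r) 0 1 0 (1 * t) ((1 + η * (1 - θ)) * t) ((1 + η * θ) * t) -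
      TT ω S₁ S₂ S₃ (fun n => (fr ω n : ℂ) * f n) (fun n => (((1 + fr ω n ^ 2) ^ ((s - 1) / 2) : ℝ) : ℂ) * g n) h
        (2 * α) (2 * β + 2 * (N - r : ℕ) - s + 1) (2 * γ + 2 * r) 0 0 1 (1 * t) ((1 + η * (1 - θ)) * t) ((1 + η * θ) * t)) := by
  unfold TT ys
  simp_rw [← Finset.sum_sub_distrib, Finset.mul_sum]
  rw [Finset.sum_comm]
  refine Finset.sum_congr rfl fun k hk => ?_
  have hz := fr_zero_sum ω hk
  generalize fr ω k.1 = a at *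
  generalize fr ω k.2.1 = b at *
  generalize fr ω k.2.2 = c at *
  rw [add_pow (θ * (1 + c ^ 2)) ((1 - θ) * (1 + b ^ 2)) N, Finset.mul_sum, Complex.ofReal_sum, Finset.mul_sum, Finset.sum_mul]
  refine Finset.sum_congr rfl fun r hr => ?_
  have hE : Real.exp (-(t * (a ^ 2 + b ^ 2 + c ^ 2 + 3 / 2))) * Real.exp (-(η * t * (θ * (1 + c ^ 2) + (1 - θ) * (1 + b ^ 2)))) =
      Real.exp (-(η * t / 2)) * (Real.exp (-(1 * t * (a ^ 2 + 1 / 2))) * Real.exp (-((1 + η * (1 - θ)) * t * (b ^ 2 + 1 / 2))) *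
        Real.exp (-((1 + η * θ) * t * (c ^ 2 + 1 / 2)))) := by
    simp only [← Real.exp_add]; congr 1; ring
  have hB := rp4 b s β (N - r)
  have hF : (c ^ 2 - b ^ 2) = a * (b - c) := by
    have : a = -(b + c) := by linarith
    rw [this]; ring
  rw [rp5, rp3, mul_pow, mul_pow]
  simp only [pow_zero, mul_one, pow_one]
  have hE' := congrArg (fun r : ℝ => (r : ℂ)) hE
  have hB' := congrArg (fun r : ℝ => (r : ℂ)) hB
  have hF' := congrArg (fun r : ℝ => (r : ℂ)) hF
  generalize Real.exp (-(t * (a ^ 2 + b ^ 2 + c ^ 2 + 3 / 2))) = E1 at *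
  generalize Real.exp (-(η * t * (θ * (1 + c ^ 2) + (1 - θ) * (1 + b ^ 2)))) = E2 at *
  generalize Real.exp (-(η * t / 2)) = E3 at *
  generalize Real.exp (-(1 * t * (a ^ 2 + 1 / 2))) = E4 at *
  generalize Real.exp (-((1 + η * (1 - θ)) * t * (b ^ 2 + 1 / 2))) = E5 at *
  generalize Real.exp (-((1 + η * θ) * t * (c ^ 2 + 1 / 2))) = E6 at *
  generalize (1 + b ^ 2) ^ ((s - 1) / 2) = B1 at *
  generalize (1 + b ^ 2) ^ ((2 * (β:ℝ) + 2 * ((N - r : ℕ):ℝ) - s + 1) / 2) = B2 at *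
  simp only [Complex.ofReal_mul, Complex.ofReal_sub, Complex.ofReal_pow, Complex.ofReal_add, Complex.ofReal_one] at *
  generalize (1 - (θ:ℂ)) ^ (N - r) = T1 at *
  generalize (1 + (b:ℂ) ^ 2) ^ (N - r) = T2 at *
  generalize (θ:ℂ) ^ r = T3 at *
  generalize (1 + (b:ℂ) ^ 2) ^ β = T4 at *
  generalize (1 + (c:ℂ) ^ 2) ^ γ = T5 at *
  generalize (1 + (c:ℂ) ^ 2) ^ r = T6 at *
  generalize (1 + (a:ℂ) ^ 2) ^ α = T7 at *
  calc _ = f k.1 * g k.2.1 * h k.2.2 * T7 * T5 * T6 * T3 * T1 * (((N.choose r : ℕ) : ℝ) : ℂ) * (T4 * T2) * ((c:ℂ) ^ 2 - (b:ℂ) ^ 2) *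
        ((E1:ℂ) * E2) := by push_cast; ring
    _ = _ := by rw [hE', ← hB', hF']; ring

end

end KP

set_option linter.all false
open MeasureTheory Set
namespace KP

noncomputable section

/-- triple product measure -/
def M3 : Measure (ℝ × ℝ × ℝ) :=
  (volume.restrict (Ioi (0:ℝ))).prod ((volume.restrict (Ioc (0:ℝ) 1)).prod (volume.restrict (Ioi (0:ℝ))))

lemma M3_iter {H : ℝ × ℝ × ℝ → ENNReal} (hH : Measurable H) :
    ∫⁻ z, H z ∂M3 = ∫⁻ t in Ioi (0:ℝ), ∫⁻ θ in Ioc (0:ℝ) 1, ∫⁻ η in Ioi (0:ℝ), H (t, θ, η) := by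
  unfold M3
  rw [lintegral_prod _ hH.aemeasurable]
  refine lintegral_congr fun t => ?_
  rw [lintegral_prod]
  exact (hH.comp (by fun_prop : Measurable (fun z : ℝ × ℝ => (t, z)))).aemeasurable

lemma re9 {a b c d e n : ENNReal} : a * (b * (c * d * (e * n))) = b * c * (a * d * (e * n)) := by ring

/-- the `r`-th term -/
def XX (ω : ℝ × ℝ) (S₁ S₂ S₃ : Finset Z2) (f g h : Z2 → ℂ) (s e κ : ℝ) (α : ℕ) (x₂ x₃ : ℝ) (ε₂ ε₃ : ℕ)
    (z : ℝ × ℝ × ℝ) : ENNReal :=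
  ENNReal.ofReal (z.1 ^ e) * (ENNReal.ofReal (z.2.2 ^ (κ - 1)) *
      ‖TT ω S₁ S₂ S₃ (fun n => (fr ω n : ℂ) * f n) (fun n => (((1 + fr ω n ^ 2) ^ ((s - 1) / 2) : ℝ) : ℂ) * g n) h
        (2 * α) x₂ x₃ 0 ε₂ ε₃ (1 * z.1) ((1 + z.2.2 * (1 - z.2.1)) * z.1) ((1 + z.2.2 * z.2.1) * z.1)‖ₑ)

lemma XX_meas (ω S₁ S₂ S₃ f g h s e κ α x₂ x₃ ε₂ ε₃) : Measurable (XX ω S₁ S₂ S₃ f g h s e κ α x₂ x₃ ε₂ ε₃) := by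
  unfold XX
  refine Measurable.mul (by fun_prop) (Measurable.mul (by fun_prop) (TT_meas3 _ _ _ _ _ _ _ _ _ _ _ _ _))

lemma Wt_pt (ω) (S₁ S₂ S₃ : Finset Z2) (f g h : Z2 → ℂ) {s : ℝ} (hs : 1 ≤ s) (α β γ N : ℕ) {κ : ℝ} (hκ : 0 < κ)
    (hN : s / 2 - 1 = N + -κ) (M : ℝ) {t : ℝ} (ht : 0 < t) :
    ENNReal.ofReal (t ^ M) * ‖Wt ω S₁ S₂ S₃ f g h s α β γ t‖ₑ ≤
    ∫⁻ θ in Ioc (0:ℝ) 1, ∫⁻ η in Ioi (0:ℝ), ∑ r ∈ Finset.range (N + 1),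
      ENNReal.ofReal (s / 2 * (Real.Gamma κ)⁻¹ * N.choose r) *
       (XX ω S₁ S₂ S₃ f g h s (M + κ) κ α (2 * β + 2 * (N - r : ℕ) - s + 1) (2 * γ + 2 * r) 1 0 (t, θ, η) +
        XX ω S₁ S₂ S₃ f g h s (M + κ) κ α (2 * β + 2 * (N - r : ℕ) - s + 1) (2 * γ + 2 * r) 0 1 (t, θ, η)) := by
  have hG := Real.Gamma_pos_of_pos hκ
  have hs2 : 0 < s / 2 := by linarith
  have e1 : Wt ω S₁ S₂ S₃ f g h s α β γ t = ∑ k ∈ ZZ S₁ S₂ S₃, (f k.1 * g k.2.1 * h k.2.2 *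
    (((1 + fr ω k.1 ^ 2) ^ α * (1 + fr ω k.2.1 ^ 2) ^ β * (1 + fr ω k.2.2 ^ 2) ^ γ *
      Real.exp (-(t * (fr ω k.1 ^ 2 + fr ω k.2.1 ^ 2 + fr ω k.2.2 ^ 2 + 3 / 2))) : ℝ) : ℂ)) *
    (((1 + fr ω k.2.2 ^ 2) ^ (s / 2) - (1 + fr ω k.2.1 ^ 2) ^ (s / 2) : ℝ) : ℂ) := by
    unfold Wt
    exact Finset.sum_congr rfl fun k _ => mul_right_comm _ _ _
  have h1 := theta_super (ZZ S₁ S₂ S₃) (fun k => (f k.1 * g k.2.1 * h k.2.2 *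
    (((1 + fr ω k.1 ^ 2) ^ α * (1 + fr ω k.2.1 ^ 2) ^ β * (1 + fr ω k.2.2 ^ 2) ^ γ *
      Real.exp (-(t * (fr ω k.1 ^ 2 + fr ω k.2.1 ^ 2 + fr ω k.2.2 ^ 2 + 3 / 2))) : ℝ) : ℂ)))
      (fun k => 1 + fr ω k.2.1 ^ 2) (fun k => 1 + fr ω k.2.2 ^ 2) (fun k _ => sq1_pos _) (fun k _ => sq1_pos _) hs2
  rw [← e1] at h1
  refine (mul_le_mul' le_rfl h1).trans ?_
  rw [← lintegral_const_mul' _ _ ENNReal.ofReal_ne_top, ← lintegral_const_mul' _ _ ENNReal.ofReal_ne_top]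
  refine setLIntegral_mono' measurableSet_Ioc fun θ hθ => ?_
  have hpos : ∀ k ∈ ZZ S₁ S₂ S₃, 0 < θ * (1 + fr ω k.2.2 ^ 2) + (1 - θ) * (1 + fr ω k.2.1 ^ 2) := by
    intro k _
    have h0 := hθ.1
    have : 0 ≤ 1 - θ := by linarith [hθ.2]
    positivity
  have h2 := gamma_super (ZZ S₁ S₂ S₃) (fun k => (f k.1 * g k.2.1 * h k.2.2 *
    (((1 + fr ω k.1 ^ 2) ^ α * (1 + fr ω k.2.1 ^ 2) ^ β * (1 + fr ω k.2.2 ^ 2) ^ γ *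
      Real.exp (-(t * (fr ω k.1 ^ 2 + fr ω k.2.1 ^ 2 + fr ω k.2.2 ^ 2 + 3 / 2))) : ℝ) : ℂ)) *
      ((((1 + fr ω k.2.2 ^ 2) - (1 + fr ω k.2.1 ^ 2)) *
        (θ * (1 + fr ω k.2.2 ^ 2) + (1 - θ) * (1 + fr ω k.2.1 ^ 2)) ^ N : ℝ) : ℂ))
      (fun k => θ * (1 + fr ω k.2.2 ^ 2) + (1 - θ) * (1 + fr ω k.2.1 ^ 2)) hpos hκ ht
  have e2 : ∑ k ∈ ZZ S₁ S₂ S₃, (f k.1 * g k.2.1 * h k.2.2 *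
    (((1 + fr ω k.1 ^ 2) ^ α * (1 + fr ω k.2.1 ^ 2) ^ β * (1 + fr ω k.2.2 ^ 2) ^ γ *
      Real.exp (-(t * (fr ω k.1 ^ 2 + fr ω k.2.1 ^ 2 + fr ω k.2.2 ^ 2 + 3 / 2))) : ℝ) : ℂ)) *
      ((((1 + fr ω k.2.2 ^ 2) - (1 + fr ω k.2.1 ^ 2)) *
        (θ * (1 + fr ω k.2.2 ^ 2) + (1 - θ) * (1 + fr ω k.2.1 ^ 2)) ^ (s / 2 - 1) : ℝ) : ℂ) =
    ∑ k ∈ ZZ S₁ S₂ S₃, (f k.1 * g k.2.1 * h k.2.2 *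
    (((1 + fr ω k.1 ^ 2) ^ α * (1 + fr ω k.2.1 ^ 2) ^ β * (1 + fr ω k.2.2 ^ 2) ^ γ *
      Real.exp (-(t * (fr ω k.1 ^ 2 + fr ω k.2.1 ^ 2 + fr ω k.2.2 ^ 2 + 3 / 2))) : ℝ) : ℂ)) *
      ((((1 + fr ω k.2.2 ^ 2) - (1 + fr ω k.2.1 ^ 2)) *
        (θ * (1 + fr ω k.2.2 ^ 2) + (1 - θ) * (1 + fr ω k.2.1 ^ 2)) ^ N : ℝ) : ℂ) *
      (((θ * (1 + fr ω k.2.2 ^ 2) + (1 - θ) * (1 + fr ω k.2.1 ^ 2)) ^ (-κ) : ℝ) : ℂ) := by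
    refine Finset.sum_congr rfl fun k hk => ?_
    rw [hN, Real.rpow_add (hpos k hk), Real.rpow_natCast]
    simp only [Complex.ofReal_mul]
    ring
  rw [e2]
  refine (mul_le_mul' le_rfl (mul_le_mul' le_rfl h2)).trans ?_
  rw [← lintegral_const_mul' _ _ ENNReal.ofReal_ne_top, ← lintegral_const_mul' _ _ ENNReal.ofReal_ne_top,
    ← lintegral_const_mul' _ _ ENNReal.ofReal_ne_top]
  refine setLIntegral_mono' measurableSet_Ioi fun η hη => ?_
  have hη' : 0 < η := hη
  beta_reduce
  rw [U_eq ω S₁ S₂ S₃ f g h s α β γ N t θ η]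
  have hb : ∀ r ∈ Finset.range (N + 1), ∀ w : ℂ, ‖((Real.exp (-(η * t / 2)) * (θ ^ r * (1 - θ) ^ (N - r) * (N.choose r)) : ℝ) : ℂ) * w‖ₑ ≤
      ENNReal.ofReal (N.choose r) * ‖w‖ₑ := by
    intro r _ w
    have h0 := hθ.1
    have h0' : 0 ≤ 1 - θ := by linarith [hθ.2]
    refine enorm_le_of (by positivity) rfl ?_
    have i1 : Real.exp (-(η * t / 2)) ≤ 1 := Real.exp_le_one_iff.2 (by have := mul_pos hη' ht; linarith)
    have i2 : θ ^ r ≤ 1 := pow_le_one₀ h0.le hθ.2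
    have i3 : (1 - θ) ^ (N - r) ≤ 1 := pow_le_one₀ h0' (by linarith)
    calc _ ≤ (1:ℝ) * (1 * 1 * (N.choose r)) := by gcongr
      _ = _ := by ring
  refine (mul_le_mul' le_rfl (mul_le_mul' le_rfl (mul_le_mul' le_rfl (mul_le_mul' le_rfl
    ((enorm_sum_le _ _).trans (Finset.sum_le_sum fun r hr => (hb r hr _).trans (mul_le_mul' le_rfl enorm_sub_le))))))).trans ?_
  simp_rw [Finset.mul_sum]
  refine Finset.sum_le_sum fun r _ => le_of_eq ?_
  unfold XX
  simp only
  rw [Real.rpow_add ht, ENNReal.ofReal_mul (by positivity : 0 ≤ (Real.Gamma κ)⁻¹), ENNReal.ofReal_mul (by positivity : 0 ≤ t ^ M),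
    ENNReal.ofReal_mul (by positivity : 0 ≤ s / 2 * (Real.Gamma κ)⁻¹), ENNReal.ofReal_mul hs2.le]
  ring

lemma case3 {p q : ℝ} (hp : 2 ≤ p) (hq1 : 1 < q) (hq2 : q ≤ 2) (hpq : 1 / p + 1 / q = 1) {s : ℝ} (hs : 1 ≤ s)
    {m : ℕ} (hm : s + 5 ≤ m) {i j l : ℕ} (hijl : i + j + l = m) (hα : 2 * ((i + l : ℕ) : ℝ) < s + 1) :
    ∃ C : ℝ, 0 < C ∧ ∀ ω S₁ S₂ S₃ f g h aF ag aD aG ah, Hyp p q ω s S₁ S₂ S₃ f g h aF ag aD aG ah →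
    ∫⁻ t in Ioi (0:ℝ), ENNReal.ofReal (t ^ (2 * (m:ℝ) - 1)) * ‖Wt ω S₁ S₂ S₃ f g h s (i + l) (i + j) (j + l) t‖ₑ ≤
      ENNReal.ofReal (C * ((aF * ag + aD * aG) * ah)) := by
  obtain ⟨N, hN⟩ : ∃ N : ℕ, N = ⌊s / 2⌋₊ := ⟨_, rfl⟩
  have hN1 : (N:ℝ) ≤ s / 2 := by rw [hN]; exact Nat.floor_le (by linarith)
  have hN2 : s / 2 < N + 1 := by rw [hN]; exact Nat.lt_floor_add_one _
  obtain ⟨κ, hκd⟩ : ∃ κ : ℝ, κ = N + 1 - s / 2 := ⟨_, rfl⟩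
  have hκ : 0 < κ := by linarith
  have hκ2 : κ < 2 := by linarith
  have hG := Real.Gamma_pos_of_pos hκ
  have hs2 : 0 < s / 2 := by linarith
  have hmr : (m:ℝ) = i + j + l := by rw [← hijl]; push_cast; ring
  push_cast at hα
  have nn : ∀ n : ℕ, (0:ℝ) ≤ n := fun n => Nat.cast_nonneg n
  have h2 : ∀ r, 5 ≤ 2 * ((i + j : ℕ):ℝ) + 2 * ((N - r : ℕ):ℝ) - s + 1 := by
    intro r; have := nn (N - r); have := nn i; have := nn l; push_cast; linarith
  have h3 : ∀ r : ℕ, 5 ≤ 2 * ((j + l : ℕ):ℝ) + 2 * (r:ℝ) := by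
    intro r; have := nn r; have := nn i; have := nn l; push_cast; linarith
  have he : ∀ r ∈ Finset.range (N + 1), ((N - r : ℕ) : ℝ) = N - r := fun r hr =>
    Nat.cast_sub (by have := Finset.mem_range.1 hr; omega)
  have T1 := fun r => case3T hp hq1 hq2 hpq (s := s) (i + l) 1 0 (h2 r) (h3 r) hκ hκ2 rfl
  have T2 := fun r => case3T hp hq1 hq2 hpq (s := s) (i + l) 0 1 (h2 r) (h3 r) hκ hκ2 rfl
  choose C₁ hC₁ H1 using T1
  choose C₂ hC₂ H2 using T2
  refine ⟨∑ r ∈ Finset.range (N + 1), s / 2 * (Real.Gamma κ)⁻¹ * N.choose r * (C₁ r + C₂ r), ?_, ?_⟩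
  · refine Finset.sum_pos (fun r hr => ?_) (by simp)
    have := hC₁ r; have := hC₂ r
    have : 0 < N.choose r := Nat.choose_pos (by have := Finset.mem_range.1 hr; omega)
    positivity
  intro ω S₁ S₂ S₃ f g h aF ag aD aG ah H
  have := H.pF; have := H.pg; have := H.ph; have := H.pD; have := H.pG
  refine (setLIntegral_mono' measurableSet_Ioi fun t ht => Wt_pt ω S₁ S₂ S₃ f g h hs (i + l) (i + j) (j + l) N hκ
    (by rw [hκd]; ring) (2 * (m:ℝ) - 1) ht).trans ?_
  rw [← M3_iter (H := fun z => ∑ r ∈ Finset.range (N + 1),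
      ENNReal.ofReal (s / 2 * (Real.Gamma κ)⁻¹ * N.choose r) *
       (XX ω S₁ S₂ S₃ f g h s (2 * (m:ℝ) - 1 + κ) κ (i + l) (2 * ((i + j : ℕ):ℝ) + 2 * (N - r : ℕ) - s + 1) (2 * ((j + l : ℕ):ℝ) + 2 * r) 1 0 z +
        XX ω S₁ S₂ S₃ f g h s (2 * (m:ℝ) - 1 + κ) κ (i + l) (2 * ((i + j : ℕ):ℝ) + 2 * (N - r : ℕ) - s + 1) (2 * ((j + l : ℕ):ℝ) + 2 * r) 0 1 z))
    (Finset.measurable_fun_sum _ fun r _ => ((XX_meas _ _ _ _ _ _ _ _ _ _ _ _ _ _ _).add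
        (XX_meas _ _ _ _ _ _ _ _ _ _ _ _ _ _ _)).const_mul _)]
  rw [lintegral_finsetSum]
  swap
  · intro r _
    exact ((XX_meas _ _ _ _ _ _ _ _ _ _ _ _ _ _ _).add
        (XX_meas _ _ _ _ _ _ _ _ _ _ _ _ _ _ _)).const_mul _
  have key : ∀ r ∈ Finset.range (N + 1), (∫⁻ z, ENNReal.ofReal (s / 2 * (Real.Gamma κ)⁻¹ * N.choose r) *
       (XX ω S₁ S₂ S₃ f g h s (2 * (m:ℝ) - 1 + κ) κ (i + l) (2 * ((i + j : ℕ):ℝ) + 2 * (N - r : ℕ) - s + 1) (2 * ((j + l : ℕ):ℝ) + 2 * r) 1 0 z +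
        XX ω S₁ S₂ S₃ f g h s (2 * (m:ℝ) - 1 + κ) κ (i + l) (2 * ((i + j : ℕ):ℝ) + 2 * (N - r : ℕ) - s + 1) (2 * ((j + l : ℕ):ℝ) + 2 * r) 0 1 z) ∂M3) ≤
      ENNReal.ofReal (s / 2 * (Real.Gamma κ)⁻¹ * N.choose r * (C₁ r + C₂ r) * (aD * aG * ah)) := by
    intro r hr
    rw [lintegral_const_mul' _ _ ENNReal.ofReal_ne_top, lintegral_add_left (XX_meas _ _ _ _ _ _ _ _ _ _ _ _ _ _ _),
      M3_iter (XX_meas _ _ _ _ _ _ _ _ _ _ _ _ _ _ _), M3_iter (XX_meas _ _ _ _ _ _ _ _ _ _ _ _ _ _ _)]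
    have k1 := H1 r ω S₁ S₂ S₃ f g h aF ag aD aG ah H
    have k2 := H2 r ω S₁ S₂ S₃ f g h aF ag aD aG ah H
    have ee1 : (2 * ((i + j : ℕ):ℝ) + 2 * ((N - r : ℕ):ℝ) - s + 1 + ((1:ℕ):ℝ)) / 2 + (2 * ((i + l : ℕ):ℝ) + ((0:ℕ):ℝ)) / 2 +
        (2 * ((j + l : ℕ):ℝ) + 2 * (r:ℝ) + ((0:ℕ):ℝ)) / 2 - 1 = 2 * (m:ℝ) - 1 + κ := by
      rw [he r hr, hκd, hmr]; push_cast; ring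
    have ee2 : (2 * ((i + j : ℕ):ℝ) + 2 * ((N - r : ℕ):ℝ) - s + 1 + ((0:ℕ):ℝ)) / 2 + (2 * ((i + l : ℕ):ℝ) + ((0:ℕ):ℝ)) / 2 +
        (2 * ((j + l : ℕ):ℝ) + 2 * (r:ℝ) + ((1:ℕ):ℝ)) / 2 - 1 = 2 * (m:ℝ) - 1 + κ := by
      rw [he r hr, hκd, hmr]; push_cast; ring
    rw [ee1] at k1
    rw [ee2] at k2
    have h1p := hC₁ r
    have h2p := hC₂ r
    refine (mul_le_mul' le_rfl (add_le_add k1 k2)).trans (le_of_eq ?_)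
    rw [← ENNReal.ofReal_add (by positivity) (by positivity), ← ENNReal.ofReal_mul (by positivity)]
    congr 1; ring
  refine (Finset.sum_le_sum key).trans ?_
  rw [← ENNReal.ofReal_sum_of_nonneg (fun r _ => by have := hC₁ r; have := hC₂ r; positivity), ← Finset.sum_mul]
  apply ENNReal.ofReal_le_ofReal
  refine mul_le_mul_of_nonneg_left ?_ (Finset.sum_nonneg fun r _ => by have := hC₁ r; have := hC₂ r; positivity)
  have : 0 < aF * ag * ah := by positivity
  nlinarith

lemma main_tri {p q : ℝ} (hp : 2 ≤ p) (hq1 : 1 < q) (hq2 : q ≤ 2) (hpq : 1 / p + 1 / q = 1) {s : ℝ} (hs : 1 ≤ s) :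
    ∃ C : ℝ, 0 < C ∧ ∀ ω S₁ S₂ S₃ f g h aF ag aD aG ah, Hyp p q ω s S₁ S₂ S₃ f g h aF ag aD aG ah →
    ‖∑ k ∈ ZZ S₁ S₂ S₃, f k.1 * g k.2.1 * h k.2.2 *
    (((1 + fr ω k.2.2 ^ 2) ^ (s / 2) - (1 + fr ω k.2.1 ^ 2) ^ (s / 2) : ℝ) : ℂ)‖ ≤ C * ((aF * ag + aD * aG) * ah) := by
  obtain ⟨m, hm⟩ := exists_nat_ge (s + 5)
  have hm1 : 1 ≤ m := by
    have : (1:ℝ) ≤ m := by linarith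
    exact_mod_cast this
  have cs : ∀ i j l : ℕ, ∃ C : ℝ, 0 < C ∧ (i + j + l = m → ∀ ω S₁ S₂ S₃ f g h aF ag aD aG ah, Hyp p q ω s S₁ S₂ S₃ f g h aF ag aD aG ah →
    ∫⁻ t in Ioi (0:ℝ), ENNReal.ofReal (t ^ (2 * (m:ℝ) - 1)) * ‖Wt ω S₁ S₂ S₃ f g h s (i + l) (i + j) (j + l) t‖ₑ ≤
      ENNReal.ofReal (C * ((aF * ag + aD * aG) * ah))) := by
    intro i j l
    by_cases h : i + j + l = m
    · rcases le_or_gt (s + 1) (2 * ((i + l : ℕ) : ℝ)) with h' | h'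
      · obtain ⟨C, hC, H⟩ := case12 hp hq1 hq2 hpq hs hm h h'
        exact ⟨C, hC, fun _ => H⟩
      · obtain ⟨C, hC, H⟩ := case3 hp hq1 hq2 hpq hs hm h h'
        exact ⟨C, hC, fun _ => H⟩
    · exact ⟨1, one_pos, fun h0 => absurd h0 h⟩
  choose c hc hcs using cs
  obtain ⟨K, hK, HK⟩ := repro m hm1
  set C0 := ∑ i ∈ Finset.range (m + 1), ∑ j ∈ Finset.range (m + 1), ∑ l ∈ Finset.range (m + 1), c i j l with hC0
  have hle : ∀ i j l, i + j + l = m → c i j l ≤ C0 := by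
    intro i j l h
    have a1 : c i j l ≤ ∑ l ∈ Finset.range (m + 1), c i j l :=
      Finset.single_le_sum (f := fun l => c i j l) (fun l _ => (hc i j l).le) (Finset.mem_range.2 (by omega))
    have a2 : ∑ l ∈ Finset.range (m + 1), c i j l ≤ ∑ j ∈ Finset.range (m + 1), ∑ l ∈ Finset.range (m + 1), c i j l :=
      Finset.single_le_sum (f := fun j => ∑ l ∈ Finset.range (m + 1), c i j l)
        (fun j _ => Finset.sum_nonneg fun l _ => (hc i j l).le) (Finset.mem_range.2 (by omega))
    have a3 : ∑ j ∈ Finset.range (m + 1), ∑ l ∈ Finset.range (m + 1), c i j l ≤ C0 :=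
      Finset.single_le_sum (f := fun i => ∑ j ∈ Finset.range (m + 1), ∑ l ∈ Finset.range (m + 1), c i j l)
        (fun i _ => Finset.sum_nonneg fun j _ => Finset.sum_nonneg fun l _ => (hc i j l).le) (Finset.mem_range.2 (by omega))
    linarith
  have hC0p : 0 < C0 := lt_of_lt_of_le (hc m 0 0) (hle m 0 0 (by omega))
  refine ⟨K * C0, by positivity, fun ω S₁ S₂ S₃ f g h aF ag aD aG ah H => ?_⟩
  have := H.pF; have := H.pg; have := H.ph; have := H.pD; have := H.pG
  have := HK (ZZ S₁ S₂ S₃) (fun k => f k.1 * g k.2.1 * h k.2.2 *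
    (((1 + fr ω k.2.2 ^ 2) ^ (s / 2) - (1 + fr ω k.2.1 ^ 2) ^ (s / 2) : ℝ) : ℂ)) (fun k => fr ω k.1) (fun k => fr ω k.2.1)
    (fun k => fr ω k.2.2) (fun k hk => fr_zero_sum ω hk) (ENNReal.ofReal (C0 * ((aF * ag + aD * aG) * ah))) (by
      intro i j l hijl
      refine (hcs i j l hijl ω S₁ S₂ S₃ f g h aF ag aD aG ah H).trans (ENNReal.ofReal_le_ofReal ?_)
      exact mul_le_mul_of_nonneg_right (hle i j l hijl) (by positivity))
  rw [← ENNReal.ofReal_mul hK.le, ← ofReal_norm_eq_enorm, ENNReal.ofReal_le_ofReal_iff (by positivity)] at this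
  linarith

end

end KP

set_option linter.all false
open MeasureTheory Set
namespace KP

noncomputable section

/-- characters as a monoid homomorphism -/
def chHom : Multiplicative Z2 →* (ℝ × ℝ → ℂ) where
  toFun n := ch n.toAdd
  map_one' := by funext x; exact ch_zero x
  map_mul' a b := by funext x; exact (ch_mul _ _ x).symm

/-- algebra of trigonometric polynomials -/
def TP : Subalgebra ℂ (ℝ × ℝ → ℂ) := (AddMonoidAlgebra.lift ℂ (ℝ × ℝ → ℂ) Z2 chHom).range

lemma TP_ex {u : ℝ × ℝ → ℂ} (hu : u ∈ TP) : ∃ S c, u = P S c := by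
  obtain ⟨F, rfl⟩ := hu
  refine ⟨F.coeff.support, F.coeff, ?_⟩
  funext x
  change (AddMonoidAlgebra.lift ℂ (ℝ × ℝ → ℂ) Z2 chHom F) x = _
  rw [AddMonoidAlgebra.lift_apply, Finsupp.sum, Finset.sum_apply]
  rfl

lemma ch_TP (n : Z2) : ch n ∈ TP := by
  refine ⟨AddMonoidAlgebra.single n 1, ?_⟩
  change (AddMonoidAlgebra.lift ℂ (ℝ × ℝ → ℂ) Z2 chHom (AddMonoidAlgebra.single n 1)) = _
  rw [AddMonoidAlgebra.lift_single, one_smul]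
  rfl

lemma sum_TP {ι : Type*} (s : Finset ι) (c : ι → ℂ) (n : ι → Z2) : (fun x => ∑ i ∈ s, c i * ch (n i) x) ∈ TP := by
  have : (fun x => ∑ i ∈ s, c i * ch (n i) x) = ∑ i ∈ s, c i • ch (n i) := by
    funext x; simp
  rw [this]
  exact sum_mem fun i _ => Subalgebra.smul_mem _ (ch_TP _) _

lemma P_TP (S c) : P S c ∈ TP := sum_TP S c id

lemma conj_TP {u : ℝ × ℝ → ℂ} (hu : u ∈ TP) : (fun x => (starRingEnd ℂ) (u x)) ∈ TP := by
  obtain ⟨S, c, rfl⟩ := TP_ex hu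
  have : (fun x => (starRingEnd ℂ) (P S c x)) = fun x => ∑ n ∈ S, (starRingEnd ℂ) (c n) * ch (-n) x := by
    funext x
    unfold P
    rw [map_sum]
    refine Finset.sum_congr rfl fun n _ => ?_
    rw [map_mul]; congr 1
    unfold ch
    rw [← Complex.exp_conj]
    congr 1
    have h2 : (starRingEnd ℂ) (2:ℂ) = 2 := Complex.conj_eq_iff_real.2 ⟨2, by norm_num⟩
    simp [h2]
    ring
  rw [this]
  exact sum_TP S _ _

lemma TP_cont {u : ℝ × ℝ → ℂ} (hu : u ∈ TP) : Continuous u := by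
  obtain ⟨S, c, rfl⟩ := TP_ex hu
  exact P_cont S c

lemma P_bd (S : Finset Z2) (c : Z2 → ℂ) (x) : ‖P S c x‖ ≤ ∑ n ∈ S, ‖c n‖ := by
  unfold P
  refine (norm_sum_le _ _).trans (le_of_eq (Finset.sum_congr rfl fun n _ => ?_))
  rw [norm_mul, ch_norm, mul_one]

lemma poly_TP {T : ℝ × ℝ → ℂ} (hT : T ∈ TP) (Q : Polynomial ℝ) :
    (fun x => (starRingEnd ℂ) (T x) * ((Q.eval (‖T x‖ ^ 2) : ℝ) : ℂ)) ∈ TP := by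
  have hc := conj_TP hT
  have e : (fun x => (starRingEnd ℂ) (T x) * ((Q.eval (‖T x‖ ^ 2) : ℝ) : ℂ)) =
      (fun x => (starRingEnd ℂ) (T x)) * ∑ i ∈ Finset.range (Q.natDegree + 1),
        (Q.coeff i : ℂ) • ((T * fun x => (starRingEnd ℂ) (T x)) ^ i) := by
    funext x
    simp only [Pi.mul_apply, Finset.sum_apply, Pi.smul_apply, Pi.pow_apply, smul_eq_mul]
    rw [Polynomial.eval_eq_sum_range, Complex.ofReal_sum]
    congr 1
    refine Finset.sum_congr rfl fun i _ => ?_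
    rw [Complex.mul_conj, Complex.normSq_eq_norm_sq]
    push_cast; ring
  rw [e]
  exact mul_mem hc (sum_mem fun i _ => Subalgebra.smul_mem _ (pow_mem (mul_mem hT hc) _) _)

lemma dual {p q : ℝ} (hp : 2 ≤ p) (hq1 : 1 < q) (hq2 : q ≤ 2) (hpq : 1 / p + 1 / q = 1) {T : ℝ × ℝ → ℂ} (hT : T ∈ TP)
    {B : ℝ} (hB : 0 ≤ B)
    (H : ∀ S c a, 0 < a → ∫ x, ‖P S c x‖ ^ q ∂mT ≤ a ^ q → ‖∫ x, T x * P S c x ∂mT‖ ≤ B * a) :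
    (∫ x, ‖T x‖ ^ p ∂mT) ^ (1 / p) ≤ 8 * B := by
  have hp0 : 0 < p := by linarith
  have hq0 : 0 < q := by linarith
  have hcT := TP_cont hT
  set X := ∫ x, ‖T x‖ ^ p ∂mT with hX
  have hX0 : 0 ≤ X := integral_nonneg fun x => by positivity
  rcases hX0.eq_or_lt with h0 | hXp
  · rw [← h0, Real.zero_rpow (by positivity)]; linarith
  obtain ⟨M, hM, hTM⟩ : ∃ M : ℝ, 0 < M ∧ ∀ x, ‖T x‖ ≤ M := by
    obtain ⟨S, c, rfl⟩ := TP_ex hT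
    refine ⟨∑ n ∈ S, ‖c n‖ + 1, by positivity, fun x => (P_bd S c x).trans (by linarith)⟩
  obtain ⟨δ, hδd⟩ : ∃ δ, δ = min (X / (2 * M ^ 2)) (X ^ (1 / q) / M) := ⟨_, rfl⟩
  have hδ : 0 < δ := by rw [hδd]; positivity
  have hδ1 : δ * M ^ 2 ≤ X / 2 := by
    have : δ ≤ X / (2 * M ^ 2) := by rw [hδd]; exact min_le_left _ _
    calc δ * M ^ 2 ≤ X / (2 * M ^ 2) * M ^ 2 := by gcongr
      _ = X / 2 := by field_simp
  have hδ2 : δ * M ≤ X ^ (1 / q) := by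
    have : δ ≤ X ^ (1 / q) / M := by rw [hδd]; exact min_le_right _ _
    calc δ * M ≤ X ^ (1 / q) / M * M := by gcongr
      _ = _ := by field_simp
  obtain ⟨Q, hQ⟩ := exists_polynomial_near_of_continuousOn 0 (M ^ 2) (fun u => u ^ ((p - 2) / 2))
    (Continuous.continuousOn (continuous_id.rpow_const fun u => Or.inr (by linarith))) δ hδ
  have hQ' : ∀ x, |Q.eval (‖T x‖ ^ 2) - ‖T x‖ ^ (p - 2)| ≤ δ := by
    intro x
    have := (hQ (‖T x‖ ^ 2) ⟨by positivity, pow_le_pow_left₀ (norm_nonneg _) (hTM x) 2⟩).le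
    have e : (‖T x‖ ^ 2) ^ ((p - 2) / 2) = ‖T x‖ ^ (p - 2) := by
      rw [← Real.rpow_natCast ‖T x‖ 2, ← Real.rpow_mul (norm_nonneg _)]; congr 1; push_cast; ring
    rw [e] at this
    exact this
  obtain ⟨S, c, hSc⟩ := TP_ex (poly_TP hT Q)
  have hP : ∀ x, P S c x = (starRingEnd ℂ) (T x) * ((Q.eval (‖T x‖ ^ 2) : ℝ) : ℂ) := fun x => (congrFun hSc x).symm
  have hpw2 : ∀ r : ℝ, 0 ≤ r → r ^ 2 * r ^ (p - 2) = r ^ p := by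
    intro r hr
    rcases hr.eq_or_lt with h | h
    · rw [← h, Real.zero_rpow hp0.ne']; simp
    · rw [← Real.rpow_natCast, ← Real.rpow_add h]; congr 1; push_cast; ring
  have hpw1 : ∀ r : ℝ, 0 ≤ r → (r * r ^ (p - 2)) ^ q = r ^ p := by
    intro r hr
    rcases hr.eq_or_lt with h | h
    · rw [← h, Real.zero_rpow hp0.ne', zero_mul, Real.zero_rpow hq0.ne']
    · have : r * r ^ (p - 2) = r ^ (p - 1) := by
        rw [mul_comm, ← Real.rpow_add_one h.ne']; congr 1; ring
      rw [this, ← Real.rpow_mul h.le]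
      congr 1
      field_simp at hpq
      linarith
  have hci : Continuous fun x => ‖T x‖ ^ p := hcT.norm.rpow_const fun x => Or.inr hp0.le
  have n1 : ∫ x, ‖P S c x‖ ^ q ∂mT ≤ (4 * X ^ (1 / q)) ^ q := by
    have pt : ∀ x, ‖P S c x‖ ^ q ≤ 2 ^ q * (‖T x‖ ^ p + X) := by
      intro x
      have hn : ‖P S c x‖ ≤ ‖T x‖ * ‖T x‖ ^ (p - 2) + δ * M := by
        rw [hP, norm_mul, RCLike.norm_conj, Complex.norm_real, Real.norm_eq_abs]
        have h1 : |Q.eval (‖T x‖ ^ 2)| ≤ ‖T x‖ ^ (p - 2) + δ := by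
          have := hQ' x
          have h0 : 0 ≤ ‖T x‖ ^ (p - 2) := by positivity
          rw [abs_le] at *
          constructor <;> linarith [this.1, this.2]
        calc _ ≤ ‖T x‖ * (‖T x‖ ^ (p - 2) + δ) := by gcongr
          _ = ‖T x‖ * ‖T x‖ ^ (p - 2) + δ * ‖T x‖ := by ring
          _ ≤ _ := by gcongr; exact hTM x
      have hn2 : ‖P S c x‖ ≤ 2 * max (‖T x‖ * ‖T x‖ ^ (p - 2)) (X ^ (1 / q)) := by
        have := le_max_left (‖T x‖ * ‖T x‖ ^ (p - 2)) (X ^ (1 / q))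
        have := le_max_right (‖T x‖ * ‖T x‖ ^ (p - 2)) (X ^ (1 / q))
        linarith
      calc ‖P S c x‖ ^ q ≤ (2 * max (‖T x‖ * ‖T x‖ ^ (p - 2)) (X ^ (1 / q))) ^ q := by gcongr
        _ = 2 ^ q * (max (‖T x‖ * ‖T x‖ ^ (p - 2)) (X ^ (1 / q))) ^ q := by
          rw [Real.mul_rpow (by norm_num) (by positivity)]
        _ ≤ _ := by
          gcongr
          have e1 := hpw1 ‖T x‖ (norm_nonneg _)
          have e2 : (X ^ (1 / q)) ^ q = X := by
            rw [← Real.rpow_mul hX0]; field_simp; simp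
          have : 0 ≤ ‖T x‖ ^ p := by positivity
          rcases max_cases (‖T x‖ * ‖T x‖ ^ (p - 2)) (X ^ (1 / q)) with h | h
          · rw [h.1, e1]; linarith
          · rw [h.1, e2]; linarith
    have hi1 := mT_integrable hci
    calc ∫ x, ‖P S c x‖ ^ q ∂mT ≤ ∫ x, 2 ^ q * (‖T x‖ ^ p + X) ∂mT := by
          refine integral_mono (mT_integrable ((P_cont S c).norm.rpow_const fun x => Or.inr hq0.le)) ?_ pt
          exact (hi1.add (integrable_const _)).const_mul _
      _ = 2 ^ q * (X + X) := by
          rw [integral_const_mul, integral_add hi1 (integrable_const _)]; simp [← hX]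
      _ ≤ 2 ^ q * (2 ^ q * X) := by
          gcongr
          have : (2:ℝ) ^ (1:ℝ) ≤ 2 ^ q := Real.rpow_le_rpow_of_exponent_le (by norm_num) hq1.le
          rw [Real.rpow_one] at this
          nlinarith
      _ = _ := by
          have e2 : (X ^ (1 / q)) ^ q = X := by
            rw [← Real.rpow_mul hX0]; field_simp; simp
          rw [Real.mul_rpow (by norm_num) (by positivity), e2, ← mul_assoc, ← Real.mul_rpow (by norm_num) (by norm_num)]
          norm_num
  have h1 := H S c (4 * X ^ (1 / q)) (by positivity) n1
  have h2 : X / 2 ≤ ‖∫ x, T x * P S c x ∂mT‖ := by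
    have e1 : ∀ x, T x * P S c x = ((‖T x‖ ^ 2 * Q.eval (‖T x‖ ^ 2) : ℝ) : ℂ) := by
      intro x
      rw [hP, ← mul_assoc, Complex.mul_conj, Complex.normSq_eq_norm_sq]; push_cast; ring
    simp_rw [e1]
    rw [integral_complex_ofReal, Complex.norm_real]
    refine le_trans ?_ (le_abs_self _)
    have hi1 := mT_integrable hci
    calc X / 2 ≤ X - δ * M ^ 2 := by linarith
      _ = ∫ x, (‖T x‖ ^ p - δ * M ^ 2) ∂mT := by
        rw [integral_sub hi1 (integrable_const _)]; simp [← hX]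
      _ ≤ _ := by
        refine integral_mono (hi1.sub (integrable_const _)) (mT_integrable ?_) fun x => ?_
        · have := Q.continuous
          fun_prop
        · have h1 := (abs_le.1 (hQ' x)).1
          have h2 := hpw2 ‖T x‖ (norm_nonneg _)
          have h3 : ‖T x‖ ^ 2 ≤ M ^ 2 := pow_le_pow_left₀ (norm_nonneg _) (hTM x) 2
          have h4 : ‖T x‖ ^ 2 * (‖T x‖ ^ (p - 2) - δ) ≤ ‖T x‖ ^ 2 * Q.eval (‖T x‖ ^ 2) := by
            gcongr; linarith
          have h5 : δ * ‖T x‖ ^ 2 ≤ δ * M ^ 2 := by gcongr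
          simp only
          nlinarith
  have h3 : X ≤ 8 * B * X ^ (1 / q) := by linarith
  have e3 : X = X ^ (1 / p) * X ^ (1 / q) := by rw [← Real.rpow_add hXp, hpq, Real.rpow_one]
  have hpos : 0 < X ^ (1 / q) := by positivity
  rw [e3] at h3
  nth_rewrite 2 [← e3] at h3
  exact le_of_mul_le_mul_right h3 hpos

end

end KP

set_option linter.all false
open MeasureTheory Set
namespace KP

noncomputable section

lemma trig_P {c : Z2 → ℂ} {S : Finset Z2} (h : ∀ n ∉ S, c n = 0) (x) : trigSum c x = P S c x := by
  unfold trigSum P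
  rw [tsum_eq_sum (s := S)]
  · rfl
  · intro n hn; rw [h n hn, zero_mul]

lemma trig_conv {f g : Z2 → ℂ} {S₁ S₂ : Finset Z2} (hf : ∀ n ∉ S₁, f n = 0) (hg : ∀ n ∉ S₂, g n = 0) (w : Z2 → ℂ) (x) :
    trigSum (fun n => w n * convCoef f g n) x =
      ∑ a ∈ S₁, ∑ b ∈ S₂, f a * g b * w (a + b) * ch (a + b) x := by
  have e1 : ∀ n, convCoef f g n = ∑ a ∈ S₁, f a * g (n - a) := by
    intro n
    unfold convCoef
    exact tsum_eq_sum fun a ha => by rw [hf a ha, zero_mul]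
  unfold trigSum
  have e2 : ∀ n : Z2, w n * convCoef f g n * Complex.exp (2 * Real.pi * Complex.I *
    (((n.1 : ℝ) * x.1 + (n.2 : ℝ) * x.2 : ℝ) : ℂ)) = ∑ a ∈ S₁, f a * g (n - a) * w n * ch n x := by
    intro n
    rw [e1, Finset.mul_sum, Finset.sum_mul]
    refine Finset.sum_congr rfl fun a _ => ?_
    unfold ch; ring
  rw [tsum_congr e2]
  have hs : ∀ a b, b ∉ S₂ → f a * g (a + b - a) * w (a + b) * ch (a + b) x = 0 := by
    intro a b hb
    rw [add_sub_cancel_left, hg b hb]; simp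
  rw [Summable.tsum_finsetSum]
  · refine Finset.sum_congr rfl fun a _ => ?_
    rw [← (Equiv.addLeft a).tsum_eq]
    simp only [Equiv.coe_addLeft]
    rw [tsum_eq_sum (s := S₂) fun b hb => hs a b hb]
    simp only [add_sub_cancel_left]
  · intro a _
    rw [← (Equiv.addLeft a).summable_iff]
    exact summable_of_ne_finset_zero (s := S₂) fun b hb => hs a b hb

/-- commutator -/
def Tc (ω : ℝ × ℝ) (s : ℝ) (S₁ S₂ : Finset Z2) (f g : Z2 → ℂ) (x : ℝ × ℝ) : ℂ :=
  ∑ k ∈ S₁ ×ˢ S₂, f k.1 * g k.2 * ((lamX ω s (k.1 + k.2) - lamX ω s k.2 : ℝ) : ℂ) * ch (k.1 + k.2) x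

lemma Tc_TP (ω s S₁ S₂ f g) : Tc ω s S₁ S₂ f g ∈ TP := sum_TP _ _ _

lemma Tc_eq (ω : ℝ × ℝ) (s : ℝ) {f g : Z2 → ℂ} {S₁ S₂ : Finset Z2} (hf : ∀ n ∉ S₁, f n = 0) (hg : ∀ n ∉ S₂, g n = 0) (x) :
    trigSum (fun n => (lamX ω s n : ℂ) * convCoef f g n) x - trigSum f x * trigSum (fun n => (lamX ω s n : ℂ) * g n) x =
    Tc ω s S₁ S₂ f g x := by
  rw [trig_conv hf hg, trig_P hf, trig_P (S := S₂) (c := fun n => (lamX ω s n : ℂ) * g n) fun n hn => by simp [hg n hn]]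
  unfold P Tc
  rw [Finset.sum_mul_sum, Finset.sum_product, ← Finset.sum_sub_distrib]
  refine Finset.sum_congr rfl fun a _ => ?_
  rw [← Finset.sum_sub_distrib]
  refine Finset.sum_congr rfl fun b _ => ?_
  rw [← ch_mul]; push_cast; ring

lemma Tc_int (ω : ℝ × ℝ) (s : ℝ) (f g h : Z2 → ℂ) (S₁ S₂ S₃ : Finset Z2) :
    ∫ x, Tc ω s S₁ S₂ f g x * P S₃ h x ∂mT = ∑ k ∈ ZZ S₁ S₂ S₃, f k.1 * g k.2.1 * h k.2.2 *
    (((1 + fr ω k.2.2 ^ 2) ^ (s / 2) - (1 + fr ω k.2.1 ^ 2) ^ (s / 2) : ℝ) : ℂ) := by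
  have e : ∀ y, Tc ω s S₁ S₂ f g y * P S₃ h y = ∑ k ∈ S₁ ×ˢ S₂ ×ˢ S₃,
      f k.1 * g k.2.1 * h k.2.2 * ((lamX ω s (k.1 + k.2.1) - lamX ω s k.2.1 : ℝ) : ℂ) * ch (k.1 + k.2.1 + k.2.2) y := by
    intro y
    unfold P Tc
    rw [Finset.sum_mul_sum, Finset.sum_product, Finset.sum_product]
    simp_rw [Finset.sum_product]
    refine Finset.sum_congr rfl fun a _ => Finset.sum_congr rfl fun b _ =>
      Finset.sum_congr rfl fun d _ => ?_
    rw [← ch_mul (a + b) d]; ring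
  simp_rw [e]
  rw [integral_finsetSum _ (fun k _ => (mT_integrable (ch_cont _)).const_mul _)]
  simp_rw [integral_const_mul, ch_int]
  rw [ZZ, Finset.sum_filter]
  refine Finset.sum_congr rfl fun k _ => ?_
  split_ifs with h0
  · rw [mul_one]
    congr 2
    have h1 : ((k.1.1 + k.2.1.1 + k.2.2.1 : ℤ) : ℝ) = 0 := by exact_mod_cast congrArg Prod.fst h0
    have h2 : ((k.1.2 + k.2.1.2 + k.2.2.2 : ℤ) : ℝ) = 0 := by exact_mod_cast congrArg Prod.snd h0
    push_cast at h1 h2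
    unfold lamX
    congr 3
    unfold fr
    have : ω.1 * ((k.1 + k.2.1).1 : ℝ) + ω.2 * ((k.1 + k.2.1).2 : ℝ) = -(ω.1 * (k.2.2.1:ℝ) + ω.2 * (k.2.2.2:ℝ)) := by
      simp only [Prod.fst_add, Prod.snd_add]; push_cast
      linear_combination ω.1 * h1 + ω.2 * h2
    rw [this]; ring
  · simp

lemma lp_pow {p : ℝ} (hp : 2 ≤ p) {u v : ℝ × ℝ → ℂ} (huv : ∀ x, u x = v x) {ε : ℝ} (hε : 0 < ε) :
    0 ≤ lpNormT2 p u ∧ ∫ x, ‖v x‖ ^ p ∂mT ≤ (lpNormT2 p u + ε) ^ p := by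
  have h0 : 0 ≤ ∫ x, ‖v x‖ ^ p ∂mT := integral_nonneg fun x => by positivity
  have e : lpNormT2 p u = (∫ x, ‖v x‖ ^ p ∂mT) ^ (1 / p) := by
    unfold lpNormT2 mT
    simp_rw [huv]
  have hn : 0 ≤ lpNormT2 p u := by rw [e]; positivity
  refine ⟨hn, ?_⟩
  calc ∫ x, ‖v x‖ ^ p ∂mT = (lpNormT2 p u) ^ p := by
        rw [e, ← Real.rpow_mul h0, one_div_mul_cancel (by linarith), Real.rpow_one]
    _ ≤ _ := by gcongr; linarith

lemma sup_bd {c : Z2 → ℂ} {S : Finset Z2} (h : ∀ n ∉ S, c n = 0) (x) : ‖P S c x‖ ≤ supNorm c := by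
  rw [← trig_P h]
  unfold supNorm
  refine le_ciSup (f := fun x => ‖trigSum c x‖) ⟨∑ n ∈ S, ‖c n‖, ?_⟩ x
  rintro _ ⟨y, rfl⟩
  simp only
  rw [trig_P h]
  exact P_bd S c y

lemma final (ω : ℝ × ℝ) (s₁ : ℝ) (hs₁ : 1 ≤ s₁) (p : ℝ) (hp : 2 ≤ p) :
    ∃ C : ℝ, ∀ f g : ℤ × ℤ → ℂ, (Function.support f).Finite → (Function.support g).Finite →
      lpNormT2 p (fun x => trigSum (fun n => (lamX ω s₁ n : ℂ) * convCoef f g n) x -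
        trigSum f x * trigSum (fun n => (lamX ω s₁ n : ℂ) * g n) x) ≤
      C * (lpNormT2 p (trigSum (fun n => (lamX ω s₁ n : ℂ) * f n)) * supNorm g +
        supNorm (fun n => ((ω.1 * (n.1:ℝ) + ω.2 * (n.2:ℝ) : ℝ) : ℂ) * f n) *
        lpNormT2 p (trigSum (fun n => (lamX ω (s₁ - 1) n : ℂ) * g n))) := by
  obtain ⟨q, hqd⟩ : ∃ q, q = p / (p - 1) := ⟨_, rfl⟩
  have hp1 : 0 < p - 1 := by linarith
  have hq1 : 1 < q := by rw [hqd, lt_div_iff₀ hp1]; linarith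
  have hq2 : q ≤ 2 := by rw [hqd, div_le_iff₀ hp1]; linarith
  have hpq : 1 / p + 1 / q = 1 := by rw [hqd]; field_simp; ring
  obtain ⟨C, hC, H⟩ := main_tri hp hq1 hq2 hpq hs₁
  refine ⟨8 * C, fun f g hf hg => ?_⟩
  have hf' : ∀ n ∉ hf.toFinset, f n = 0 := fun n hn => by simpa using hn
  have hg' : ∀ n ∉ hg.toFinset, g n = 0 := fun n hn => by simpa using hn
  generalize hf.toFinset = S₁ at hf'
  generalize hg.toFinset = S₂ at hg'
  have z1 : ∀ n ∉ S₁, (lamX ω s₁ n : ℂ) * f n = 0 := fun n hn => by simp [hf' n hn]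
  have z2 : ∀ n ∉ S₂, (lamX ω (s₁ - 1) n : ℂ) * g n = 0 := fun n hn => by simp [hg' n hn]
  have z3 : ∀ n ∉ S₁, ((ω.1 * (n.1:ℝ) + ω.2 * (n.2:ℝ) : ℝ) : ℂ) * f n = 0 := fun n hn => by simp [hf' n hn]
  have l1 := fun ε hε => lp_pow hp (ε := ε) (trig_P z1) hε
  have l2 := fun ε hε => lp_pow hp (ε := ε) (trig_P z2) hε
  have l3 := sup_bd hg'
  have l4 := sup_bd z3
  set nF := lpNormT2 p (trigSum (fun n => (lamX ω s₁ n : ℂ) * f n))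
  set ng := supNorm g
  set nD := supNorm (fun n => ((ω.1 * (n.1:ℝ) + ω.2 * (n.2:ℝ) : ℝ) : ℂ) * f n)
  set nG := lpNormT2 p (trigSum (fun n => (lamX ω (s₁ - 1) n : ℂ) * g n))
  have p1 : 0 ≤ nF := (l1 1 one_pos).1
  have p2 : 0 ≤ nG := (l2 1 one_pos).1
  have p3 : 0 ≤ ng := (norm_nonneg _).trans (l3 0)
  have p4 : 0 ≤ nD := (norm_nonneg _).trans (l4 0)
  have eL : lpNormT2 p (fun x => trigSum (fun n => (lamX ω s₁ n : ℂ) * convCoef f g n) x -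
        trigSum f x * trigSum (fun n => (lamX ω s₁ n : ℂ) * g n) x) = (∫ x, ‖Tc ω s₁ S₁ S₂ f g x‖ ^ p ∂mT) ^ (1 / p) := by
    unfold lpNormT2 mT
    simp_rw [Tc_eq ω s₁ hf' hg']
  rw [eL]
  have key : ∀ ε : ℝ, 0 < ε → (∫ x, ‖Tc ω s₁ S₁ S₂ f g x‖ ^ p ∂mT) ^ (1 / p) ≤
      8 * C * ((nF + ε) * (ng + ε) + (nD + ε) * (nG + ε)) := by
    intro ε hε
    have := dual hp hq1 hq2 hpq (Tc_TP ω s₁ S₁ S₂ f g) (B := C * ((nF + ε) * (ng + ε) + (nD + ε) * (nG + ε)))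
      (by positivity) (by
        intro S₃ h a ha hh
        rw [Tc_int]
        refine (H ω S₁ S₂ S₃ f g h (nF + ε) (ng + ε) (nD + ε) (nG + ε) a ?_).trans (le_of_eq (by ring))
        exact
          { pF := by positivity
            pg := by positivity
            pD := by positivity
            pG := by positivity
            ph := ha
            hF := (l1 ε hε).2
            hg := fun x => (l3 x).trans (by linarith)
            hD := fun x => (l4 x).trans (by linarith)
            hG := (l2 ε hε).2
            hh := hh })
    linarith
  have lim : Filter.Tendsto (fun ε : ℝ => 8 * C * ((nF + ε) * (ng + ε) + (nD + ε) * (nG + ε))) (nhdsWithin 0 (Ioi 0))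
      (nhds (8 * C * (nF * ng + nD * nG))) := by
    have : Continuous (fun ε : ℝ => 8 * C * ((nF + ε) * (ng + ε) + (nD + ε) * (nG + ε))) := by fun_prop
    have h := this.tendsto 0
    simp only [add_zero] at h
    exact h.mono_left nhdsWithin_le_nhds
  exact ge_of_tendsto lim (Filter.eventually_of_mem self_mem_nhdsWithin fun ε hε => key ε hε)

end

end KP


/-- the quasi-periodic Kato–Ponce commutator estimate
`‖Λ_x^{s₁}(fg) − f Λ_x^{s₁}g‖_{L^p(𝕋²)}
  ≤ C(‖Λ_x^{s₁}f‖_{L^p}‖g‖_∞ + ‖D_x f‖_∞ ‖Λ_x^{s₁−1}g‖_{L^p})`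
for trigonometric polynomials, where `Λ_x^s` has symbol `(1+(ω·n)²)^{s/2}` and
`D_x` has symbol `ω·n`. -/
theorem stmt_7 (ω : ℝ × ℝ) (s₁ : ℝ) (hs₁ : 1 ≤ s₁) (p : ℝ) (hp : 2 ≤ p) :
    ∃ C : ℝ, ∀ f g : ℤ × ℤ → ℂ,
      (Function.support f).Finite → (Function.support g).Finite →
      lpNormT2 p (fun x =>
          trigSum (fun n => (lamX ω s₁ n : ℂ) * convCoef f g n) x -
            trigSum f x * trigSum (fun n => (lamX ω s₁ n : ℂ) * g n) x) ≤
        C * (lpNormT2 p (trigSum (fun n => (lamX ω s₁ n : ℂ) * f n)) *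
              supNorm g +
            supNorm (fun n => ((ω.1 * (n.1 : ℝ) + ω.2 * (n.2 : ℝ) : ℝ) : ℂ) * f n) *
              lpNormT2 p (trigSum (fun n => (lamX ω (s₁ - 1) n : ℂ) * g n))) := KP.final ω s₁ hs₁ p hp
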